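/- Let (G_i) be a sequence of finite vertex-transitive graphs with |G_i| → ∞ such that diam(G_i)/|G_i|^p does not tend to 0 for some p > 0 (i.e., limsup > 0). If each G_i is the 1-skeleton of a simply connected 2-complex, then no subsequence of the rescaled graphs G_i/diam(G_i) can converge in the Gromov–Hausdorff sense to a simply connected length space; combined with the Benjamini–Finucane–Tessera theorem (subsequential limits are tori), this yields: if X_i are compact length spaces with |π₁(X_i)| = n_i → ∞, then diam(X̃_i)/diam(X_i) = o(n_i^p) for every p > 0. -/

import Mathlib

open Set Filter

/-- A length space. -/
def IsLengthSpace (X : Type*) [PseudoEMetricSpace X] : Prop :=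
  ∀ x y : X, edist x y =
    ⨅ (γ : ℝ → X) (_ : ContinuousOn γ (Icc 0 1) ∧ γ 0 = x ∧ γ 1 = y),
      eVariationOn γ (Icc 0 1)

/-- The covering map preserves lengths of curves. -/
def IsLiftedMetric {X Xt : Type*} [PseudoEMetricSpace X] [PseudoEMetricSpace Xt]
    (ρ : Xt → X) : Prop :=
  ∀ γ : ℝ → Xt, ContinuousOn γ (Icc 0 1) →
    eVariationOn (ρ ∘ γ) (Icc 0 1) = eVariationOn γ (Icc 0 1)

namespace DR
open Matrix

lemma simdiag {ι : Type*} [Fintype ι] [DecidableEq ι] (A B : Matrix ι ι ℝ)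
    (hB : B.PosDef) (hA : A.IsHermitian) :
    ∃ (R : Matrix ι ι ℝ) (ν : ι → ℝ), Rᵀ * B * R = 1 ∧ Rᵀ * A * R = diagonal ν := by
  have hBh := hB.isHermitian
  set U : Matrix ι ι ℝ := (hBh.eigenvectorUnitary : Matrix ι ι ℝ) with hU
  have hUU : Uᵀ * U = 1 := by
    have := (Matrix.mem_unitaryGroup_iff'.1 hBh.eigenvectorUnitary.2)
    simpa [star_eq_conjTranspose, conjTranspose_eq_transpose_of_trivial] using this
  have hspec : B = U * diagonal hBh.eigenvalues * Uᵀ := by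
    have := hBh.spectral_theorem
    rw [Unitary.conjStarAlgAut_apply] at this
    simpa [star_eq_conjTranspose, conjTranspose_eq_transpose_of_trivial, Function.comp_def] using this
  set β := hBh.eigenvalues with hβ
  have hpos : ∀ i, 0 < β i := fun i => hB.eigenvalues_pos i
  set S : Matrix ι ι ℝ := diagonal (fun i => (Real.sqrt (β i))⁻¹) with hS
  have hST : Sᵀ = S := by simp [hS]
  have hSBS : S * diagonal β * S = 1 := by
    rw [hS, diagonal_mul_diagonal, diagonal_mul_diagonal, ← diagonal_one]
    congr 1; ext i
    have h1 : Real.sqrt (β i) ≠ 0 := (Real.sqrt_pos.2 (hpos i)).ne'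
    have h2 := Real.mul_self_sqrt (hpos i).le
    field_simp
    nlinarith
  set R1 := U * S with hR1
  have h1 : R1ᵀ * B * R1 = 1 := by
    rw [hR1, transpose_mul, hST, hspec]
    calc S * Uᵀ * (U * diagonal β * Uᵀ) * (U * S)
        = S * (Uᵀ * U) * diagonal β * (Uᵀ * U) * S := by simp only [Matrix.mul_assoc]
      _ = 1 := by rw [hUU]; simpa using hSBS
  have hA1 : (R1ᵀ * A * R1).IsHermitian := by
    unfold IsHermitian at *
    rw [conjTranspose_eq_transpose_of_trivial] at *
    simp [transpose_mul, hA, Matrix.mul_assoc]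
  set V : Matrix ι ι ℝ := (hA1.eigenvectorUnitary : Matrix ι ι ℝ) with hV
  have hVV : Vᵀ * V = 1 := by
    have := (Matrix.mem_unitaryGroup_iff'.1 hA1.eigenvectorUnitary.2)
    simpa [star_eq_conjTranspose, conjTranspose_eq_transpose_of_trivial] using this
  have hspec2 : R1ᵀ * A * R1 = V * diagonal hA1.eigenvalues * Vᵀ := by
    have := hA1.spectral_theorem
    rw [Unitary.conjStarAlgAut_apply] at this
    simpa [star_eq_conjTranspose, conjTranspose_eq_transpose_of_trivial, Function.comp_def] using this
  generalize hA1.eigenvalues = μ at hspec2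
  refine ⟨R1 * V, μ, ?_, ?_⟩
  · calc (R1 * V)ᵀ * B * (R1 * V) = Vᵀ * (R1ᵀ * B * R1) * V := by
          simp only [transpose_mul, Matrix.mul_assoc]
      _ = 1 := by rw [h1]; simpa using hVV
  · calc (R1 * V)ᵀ * A * (R1 * V) = Vᵀ * (R1ᵀ * A * R1) * V := by
          simp only [transpose_mul, Matrix.mul_assoc]
      _ = (Vᵀ * V) * diagonal μ * (Vᵀ * V) := by
          rw [hspec2]; simp only [Matrix.mul_assoc]
      _ = _ := by rw [hVV]; simp

/-- quadratic form -/
def qf {ι : Type*} [Fintype ι] (A : Matrix ι ι ℝ) (c : ι → ℝ) : ℝ := c ⬝ᵥ (A *ᵥ c)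

lemma qf_congr {ι : Type*} [Fintype ι] (A R : Matrix ι ι ℝ) (c : ι → ℝ) :
    qf (Rᵀ * A * R) c = qf A (R *ᵥ c) := by
  unfold qf
  rw [← Matrix.mulVec_mulVec, ← Matrix.mulVec_mulVec, Matrix.dotProduct_mulVec, Matrix.vecMul_transpose]

lemma qf_diag {ι : Type*} [Fintype ι] [DecidableEq ι] (ν c : ι → ℝ) :
    qf (diagonal ν) c = ∑ i, ν i * c i ^ 2 := by
  unfold qf dotProduct
  refine Finset.sum_congr rfl fun i _ => ?_
  rw [mulVec_diagonal]; ring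

lemma det_simdiag {ι : Type*} [Fintype ι] [DecidableEq ι] {A B R : Matrix ι ι ℝ} {ν : ι → ℝ}
    (h1 : Rᵀ * B * R = 1) (h2 : Rᵀ * A * R = diagonal ν) : A.det = (∏ i, ν i) * B.det := by
  have e1 := congrArg det h1
  have e2 := congrArg det h2
  simp only [det_mul, det_transpose, det_one, det_diagonal] at e1 e2
  have : R.det ≠ 0 := by intro h; simp [h] at e1
  rw [← e2]
  linear_combination -A.det * e1

lemma qf_single {ι : Type*} [Fintype ι] [DecidableEq ι] (ν : ι → ℝ) (i : ι) :
    qf (diagonal ν) (Pi.single i 1) = ν i := by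
  rw [qf_diag, Finset.sum_eq_single i]
  · simp
  · intro j _ hj; simp [hj]
  · simp

/-- codimension drop -/
lemma det_drop {ι : Type*} [Fintype ι] [DecidableEq ι] {τ : Type*} [Fintype τ]
    (A B : Matrix ι ι ℝ) (hA : A.PosDef) (hB : B.PosDef) (hAB : ∀ c, qf A c ≤ qf B c)
    (ℓ : (ι → ℝ) →ₗ[ℝ] (τ → ℝ)) (κ : ℝ) (hκ : 0 < κ) (hκ1 : κ ≤ 1) (N : ℕ)
    (hτ : Fintype.card τ ≤ N)
    (h : ∀ c, ℓ c = 0 → qf A c ≤ κ * qf B c) :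
    A.det ≤ κ ^ (Fintype.card ι - N) * B.det := by
  obtain ⟨R, ν, h1, h2⟩ := simdiag A B hB hA.isHermitian
  rw [det_simdiag h1 h2]
  have hBd := hB.det_pos
  refine mul_le_mul_of_nonneg_right ?_ hBd.le
  have hq1 : ∀ c, qf B (R *ᵥ c) = ∑ i, c i ^ 2 := by
    intro c; rw [← qf_congr, h1, ← diagonal_one, qf_diag]; simp
  have hq2 : ∀ c, qf A (R *ᵥ c) = ∑ i, ν i * c i ^ 2 := by
    intro c; rw [← qf_congr, h2, qf_diag]
  have hν1 : ∀ i, ν i ≤ 1 := by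
    intro i
    have := hAB (R *ᵥ Pi.single i 1)
    rw [hq1, ← qf_congr, h2, qf_single] at this
    rw [Finset.sum_eq_single i] at this
    · simpa using this
    · intro j _ hj; simp [hj]
    · simp
  have hν0 : ∀ i, 0 ≤ ν i := by
    intro i
    have := hA.posSemidef.dotProduct_mulVec_nonneg (R *ᵥ Pi.single i 1)
    have h3 : 0 ≤ qf A (R *ᵥ Pi.single i 1) := by simpa [qf] using this
    rwa [← qf_congr, h2, qf_single] at h3
  set s := Finset.univ.filter (fun i => κ < ν i) with hs
  have hcard : s.card ≤ N := by
    by_contra hcon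
    push Not at hcon
    -- a nonzero vector supported on s
    let E : (s → ℝ) →ₗ[ℝ] (ι → ℝ) := LinearMap.pi (fun i => if hi : i ∈ s then LinearMap.proj ⟨i, hi⟩ else 0)
    let F : (s → ℝ) →ₗ[ℝ] (τ → ℝ) := ℓ ∘ₗ (Matrix.mulVecLin R) ∘ₗ E
    have hlt : Module.finrank ℝ (τ → ℝ) < Module.finrank ℝ (s → ℝ) := by
      simp; omega
    have hker := LinearMap.ker_ne_bot_of_finrank_lt (f := F) hlt
    obtain ⟨v, hv, hv0⟩ := Submodule.exists_mem_ne_zero_of_ne_bot hker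
    have hF : ℓ (R *ᵥ (E v)) = 0 := hv
    have h5 := h _ hF
    rw [hq1, hq2, Finset.mul_sum] at h5
    have hE : ∀ i, i ∉ s → E v i = 0 := by intro i hi; simp [E, hi]
    have hE' : ∀ i (hi : i ∈ s), E v i = v ⟨i, hi⟩ := by intro i hi; simp [E, hi]
    have : ∃ i, v i ≠ 0 := by
      by_contra hc; push Not at hc; exact hv0 (funext hc)
    obtain ⟨⟨j, hj⟩, hvj⟩ := this
    have : ∑ i, κ * E v i ^ 2 < ∑ i, ν i * E v i ^ 2 := by
      apply Finset.sum_lt_sum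
      · intro i _
        by_cases hi : i ∈ s
        · have : κ < ν i := by simpa [hs] using hi
          nlinarith [sq_nonneg (E v i)]
        · simp [hE i hi]
      · refine ⟨j, Finset.mem_univ _, ?_⟩
        have h6 : κ < ν j := by simpa [hs] using hj
        have h7 : 0 < E v j ^ 2 := by rw [hE' j hj]; positivity
        nlinarith
    linarith
  calc ∏ i, ν i ≤ ∏ i, (if i ∈ s then 1 else κ) := by
        apply Finset.prod_le_prod
        · intro i _; exact hν0 i
        · intro i _
          split_ifs with hi
          · exact hν1 i
          · simpa [hs] using hi
    _ = κ ^ (Finset.univ.filter (fun i => i ∉ s)).card := by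
        rw [Finset.prod_ite]; simp
    _ ≤ κ ^ (Fintype.card ι - N) := by
        apply pow_le_pow_of_le_one hκ.le hκ1
        have : (Finset.univ.filter (fun i => i ∉ s)).card = Fintype.card ι - s.card := by
          rw [← Finset.card_compl]; congr 1; ext i; simp
        omega

/-- comparison from determinants -/
lemma qf_le_of_det {ι : Type*} [Fintype ι] [DecidableEq ι]
    (A B : Matrix ι ι ℝ) (hA : A.PosDef) (hB : B.PosDef) (hBA : ∀ c, qf B c ≤ qf A c)
    (C : ℝ) (h : A.det ≤ C * B.det) (c : ι → ℝ) : qf A c ≤ C * qf B c := by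
  obtain ⟨R, ν, h1, h2⟩ := simdiag A B hB hA.isHermitian
  rw [det_simdiag h1 h2] at h
  have hC : ∏ i, ν i ≤ C := le_of_mul_le_mul_right h hB.det_pos
  have hq1 : ∀ c, qf B (R *ᵥ c) = ∑ i, c i ^ 2 := by
    intro c; rw [← qf_congr, h1, ← diagonal_one, qf_diag]; simp
  have hq2 : ∀ c, qf A (R *ᵥ c) = ∑ i, ν i * c i ^ 2 := by
    intro c; rw [← qf_congr, h2, qf_diag]
  have hν1 : ∀ i, 1 ≤ ν i := by
    intro i
    have := hBA (R *ᵥ Pi.single i 1)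
    rw [hq1, ← qf_congr, h2, qf_single] at this
    rw [Finset.sum_eq_single i] at this
    · simpa using this
    · intro j _ hj; simp [hj]
    · simp
  have hνC : ∀ i, ν i ≤ C := by
    intro i
    refine le_trans ?_ hC
    rw [← Finset.mul_prod_erase _ _ (Finset.mem_univ i)]
    have : 1 ≤ ∏ x ∈ Finset.univ.erase i, ν x := by
      calc (1:ℝ) = ∏ x ∈ Finset.univ.erase i, (1:ℝ) := by simp
        _ ≤ _ := Finset.prod_le_prod (fun j _ => zero_le_one) (fun j _ => hν1 j)
    nlinarith [hν1 i]
  have hdet : IsUnit R.det := by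
    have e1 := congrArg det h1
    simp only [det_mul, det_transpose, det_one] at e1
    refine isUnit_iff_ne_zero.2 ?_
    intro h; simp [h] at e1
  obtain ⟨v, rfl⟩ : ∃ v, R *ᵥ v = c := ⟨R⁻¹ *ᵥ c, by
    rw [Matrix.mulVec_mulVec, Matrix.mul_nonsing_inv _ hdet, Matrix.one_mulVec]⟩
  rw [hq1, hq2, Finset.mul_sum]
  exact Finset.sum_le_sum fun i _ => mul_le_mul_of_nonneg_right (hνC i) (sq_nonneg _)

lemma det_mono {ι : Type*} [Fintype ι] [DecidableEq ι]
    (A B : Matrix ι ι ℝ) (hA : A.PosDef) (hB : B.PosDef) (hAB : ∀ c, qf A c ≤ qf B c) :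
    A.det ≤ B.det := by
  have := det_drop (τ := Empty) A B hA hB hAB 0 1 one_pos le_rfl 0 (by simp) (by
    intro c _; simpa using hAB c)
  simpa using this

end DR

namespace DR

structure WLen {G : Type*} [Group G] (len : G → ℕ) : Prop where
  one : len 1 = 0
  eq_one : ∀ x, len x = 0 → x = 1
  inv : ∀ x, len x⁻¹ = len x
  mul : ∀ x y, len (x * y) ≤ len x + len y
  geo : ∀ x t, len x ≤ t + 1 → ∃ y s, x = y * s ∧ len y ≤ t ∧ len s ≤ 1

/-- ball -/
noncomputable def Bl {G : Type*} [Fintype G] (len : G → ℕ) (t : ℕ) : Finset G :=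
  Finset.univ.filter (fun x => len x ≤ t)

@[simp] lemma mem_Bl {G : Type*} [Fintype G] {len : G → ℕ} {t : ℕ} {x : G} :
    x ∈ Bl len t ↔ len x ≤ t := by simp [Bl]

lemma Bl_mono {G : Type*} [Fintype G] {len : G → ℕ} {s t : ℕ} (h : s ≤ t) :
    Bl len s ⊆ Bl len t := fun x hx => by
  rw [mem_Bl] at *; omega

namespace WLen
variable {G : Type*} [Group G] {len : G → ℕ}

lemma split (hl : WLen len) (s t : ℕ) : ∀ x, len x ≤ s + t →
    ∃ y z, x = y * z ∧ len y ≤ s ∧ len z ≤ t := by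
  induction t with
  | zero => intro x hx; exact ⟨x, 1, by simp, hx, by simp [hl.one]⟩
  | succ t ih =>
    intro x hx
    obtain ⟨y, u, rfl, hy, hu⟩ := hl.geo x (s + t) hx
    obtain ⟨a, b, rfl, ha, hb⟩ := ih y hy
    exact ⟨a, b * u, by group, ha, (hl.mul _ _).trans (by omega)⟩

lemma path (hl : WLen len) (m : ℕ) : ∀ v, len v ≤ m → ∃ p : ℕ → G, p 0 = 1 ∧ p m = v ∧
    (∀ j < m, len ((p j)⁻¹ * p (j+1)) ≤ 1) ∧ ∀ j ≤ m, len (p j) ≤ j := by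
  induction m with
  | zero =>
    intro v hv
    refine ⟨fun _ => v, ?_, rfl, by simp, ?_⟩
    · exact hl.eq_one v (by omega)
    · intro j hj; simp; omega
  | succ m ih =>
    intro v hv
    obtain ⟨y, u, rfl, hy, hu⟩ := hl.geo v m hv
    obtain ⟨p, h0, h1, h2, h3⟩ := ih y hy
    refine ⟨fun j => if j ≤ m then p j else y * u, by simp [h0], by simp, ?_, ?_⟩
    · intro j hj
      rcases Nat.lt_or_ge j m with h | h
      · simp [h.le, Nat.succ_le_of_lt h, h2 j h]
      · obtain rfl : j = m := by omega
        simp [h1, hu]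
    · intro j hj
      by_cases h : j ≤ m
      · simp [h, h3 j h]
      · obtain rfl : j = m + 1 := by omega
        simp; exact hv

lemma card_pos [Fintype G] (hl : WLen len) (t : ℕ) : 0 < (Bl len t).card :=
  Finset.card_pos.2 ⟨1, by simp [hl.one]⟩

end WLen

/-- rescaled length -/
def rl {G : Type*} (r : ℕ) (len : G → ℕ) (x : G) : ℕ := (len x + (r - 1)) / r

lemma rl_le {G : Type*} {r : ℕ} (hr : 0 < r) {len : G → ℕ} {x : G} {t : ℕ} :
    rl r len x ≤ t ↔ len x ≤ r * t := by
  unfold rl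
  rw [← Nat.lt_succ_iff, Nat.div_lt_iff_lt_mul hr, Nat.succ_mul, mul_comm t r]
  omega

lemma Bl_rl {G : Type*} [Fintype G] {r : ℕ} (hr : 0 < r) {len : G → ℕ} (t : ℕ) :
    Bl (rl r len) t = Bl len (r * t) := by
  ext x; rw [mem_Bl, mem_Bl, rl_le hr]

lemma WLen.rescale {G : Type*} [Group G] {len : G → ℕ} (hl : WLen len) {r : ℕ} (hr : 0 < r) :
    WLen (rl r len) where
  one := by
    have : rl r len 1 ≤ 0 := (rl_le hr).2 (by simp [hl.one])
    omega
  eq_one x hx := hl.eq_one x (by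
    have := (rl_le (x := x) (t := 0) (len := len) hr).1 (by omega)
    omega)
  inv x := by simp [rl, hl.inv]
  mul x y := by
    rw [rl_le hr, Nat.mul_add]
    have h1 := (rl_le (x := x) (len := len) hr).1 le_rfl
    have h2 := (rl_le (x := y) (len := len) hr).1 le_rfl
    exact (hl.mul x y).trans (by omega)
  geo x t hx := by
    rw [rl_le hr, Nat.mul_add] at hx
    obtain ⟨y, z, h, hy, hz⟩ := hl.split _ _ x hx
    exact ⟨y, z, h, (rl_le hr).2 hy, (rl_le hr).2 hz⟩

open Pointwise in
lemma exists_wlen {G : Type*} [Group G] (S : Set G) (h1 : (1:G) ∈ S)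
    (hinv : ∀ x ∈ S, x⁻¹ ∈ S) (hgen : Subgroup.closure S = ⊤) :
    ∃ len : G → ℕ, WLen len ∧ (∀ x, len x ≤ 1 ↔ x ∈ S) ∧ ∀ x t, len x ≤ t ↔ x ∈ S ^ t := by
  classical
  have hSinv : S⁻¹ = S := by
    ext x; rw [Set.mem_inv]
    exact ⟨fun h => by simpa using hinv _ h, fun h => hinv _ h⟩
  have hmono : ∀ {a b : ℕ}, a ≤ b → S ^ a ⊆ S ^ b := fun h => Set.pow_subset_pow_right h1 h
  have hex : ∀ x : G, ∃ k, x ∈ S ^ k := by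
    intro x
    have hx : x ∈ Subgroup.closure S := by rw [hgen]; trivial
    induction hx using Subgroup.closure_induction with
    | mem x hx => exact ⟨1, by simpa using hx⟩
    | one => exact ⟨0, by simp⟩
    | mul x y _ _ hx hy =>
      obtain ⟨a, ha⟩ := hx; obtain ⟨b, hb⟩ := hy
      exact ⟨a + b, by rw [pow_add]; exact Set.mul_mem_mul ha hb⟩
    | inv x _ hx =>
      obtain ⟨a, ha⟩ := hx
      refine ⟨a, ?_⟩
      have : x⁻¹ ∈ (S ^ a)⁻¹ := by simpa using ha
      rwa [← inv_pow, hSinv] at this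
  have key : ∀ x t, Nat.find (hex x) ≤ t ↔ x ∈ S ^ t := by
    intro x t
    constructor
    · intro h; exact hmono h (Nat.find_spec (hex x))
    · intro h; exact Nat.find_min' _ h
  refine ⟨fun x => Nat.find (hex x), ⟨?_, ?_, ?_, ?_, ?_⟩, ?_, key⟩
  · have := (key 1 0).2 (by simp); omega
  · intro x hx
    have := (key x 0).1 hx.le
    simpa using this
  · intro x
    have h : ∀ y, Nat.find (hex y⁻¹) ≤ Nat.find (hex y) := by
      intro y
      rw [key]
      have : y⁻¹ ∈ (S ^ Nat.find (hex y))⁻¹ := by simpa using Nat.find_spec (hex y)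
      rwa [← inv_pow, hSinv] at this
    have h2 := h x⁻¹
    simp only [inv_inv] at h2
    exact le_antisymm (h x) h2
  · intro x y
    rw [key, pow_add]
    exact Set.mul_mem_mul (Nat.find_spec (hex x)) (Nat.find_spec (hex y))
  · intro x t hx
    rw [key, pow_succ] at hx
    obtain ⟨y, hy, s, hs, rfl⟩ := Set.mem_mul.1 hx
    exact ⟨y, s, rfl, (key _ _).2 hy, (key _ _).2 (by simpa using hs)⟩
  · intro x; simpa using key x 1

/-- pigeonhole over scales -/
lemma pg (F : ℕ → ℝ) (H c : ℝ) (s m : ℕ) (hs : 0 < s) (hF : Monotone F) (h0 : ∀ i, 0 ≤ F i)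
    (hH : ∀ i, F i ≤ H) :
    ((Finset.range m).filter (fun i => s * c < F (i + s) - F i)).card * c ≤ H := by
  have tele : ∀ m, ∑ i ∈ Finset.range m, (F (i + s) - F i)
      = ∑ i ∈ Finset.range s, F (m + i) - ∑ i ∈ Finset.range s, F i := by
    intro m
    induction m with
    | zero => simp
    | succ m ih =>
      rw [Finset.sum_range_succ, ih]
      have h1 := Finset.sum_range_succ (fun i => F (m + i)) s
      have h2 := Finset.sum_range_succ' (fun i => F (m + i)) s
      have h3 : ∑ i ∈ Finset.range s, F (m + 1 + i) = ∑ i ∈ Finset.range s, F (m + (i + 1)) :=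
        Finset.sum_congr rfl fun i _ => by congr 1; ring
      rw [h3]
      simp only [add_zero] at h2
      linarith
  have hb : ∑ i ∈ Finset.range m, (F (i + s) - F i) ≤ s * H := by
    rw [tele]
    have h1 : ∑ i ∈ Finset.range s, F (m + i) ≤ s * H := by
      have := Finset.sum_le_card_nsmul (Finset.range s) (fun i => F (m + i)) H (fun i _ => hH _)
      simpa using this
    have h2 : 0 ≤ ∑ i ∈ Finset.range s, F i := Finset.sum_nonneg fun i _ => h0 i
    linarith
  set T := (Finset.range m).filter (fun i => s * c < F (i + s) - F i) with hT
  have h1 : T.card * (s * c) ≤ ∑ i ∈ T, (F (i + s) - F i) := by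
    have := Finset.card_nsmul_le_sum T (fun i => F (i + s) - F i) (s * c) (fun i hi => by
      have := (Finset.mem_filter.1 hi).2; exact this.le)
    simpa using this
  have h2 : ∑ i ∈ T, (F (i + s) - F i) ≤ ∑ i ∈ Finset.range m, (F (i + s) - F i) :=
    Finset.sum_le_sum_of_subset_of_nonneg (Finset.filter_subset _ _) (fun i _ _ => by
      have := hF (Nat.le_add_right i s); linarith)
  have hs' : (0:ℝ) < s := by exact_mod_cast hs
  have : (s:ℝ) * (T.card * c) ≤ s * H := by nlinarith
  exact le_of_mul_le_mul_left this hs'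

end DR

namespace DR
set_option linter.unusedSectionVars false
variable {G : Type*} [Group G] [Fintype G] {len : G → ℕ}

/-- local energy -/
noncomputable def En (len : G → ℕ) (f : G → ℝ) (x : G) : ℝ := ∑ u ∈ Bl len 3, (f x - f (x * u)) ^ 2

lemma En_nonneg (f : G → ℝ) (x : G) : 0 ≤ En len f x := Finset.sum_nonneg fun _ _ => sq_nonneg _

/-- eigenfunctions -/
noncomputable def Wsp (len : G → ℕ) (γ : ℝ) : Submodule ℝ (G → ℝ) where
  carrier := {f | ∀ x, ∑ u ∈ Bl len 3, (f x - f (x * u)) = γ * (Bl len 3).card * f x}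
  add_mem' := by
    intro f g hf hg x
    have h1 := hf x; have h2 := hg x
    simp only [Pi.add_apply]
    rw [mul_add, ← h1, ← h2, ← Finset.sum_add_distrib]
    exact Finset.sum_congr rfl fun u _ => by ring
  zero_mem' := by intro x; simp
  smul_mem' := by
    intro c f hf x
    have h1 := hf x
    simp only [Pi.smul_apply, smul_eq_mul]
    rw [mul_left_comm, ← h1, Finset.mul_sum]
    exact Finset.sum_congr rfl fun u _ => by ring

lemma mem_Wsp {γ : ℝ} {f : G → ℝ} : f ∈ Wsp len γ ↔
    ∀ x, ∑ u ∈ Bl len 3, (f x - f (x * u)) = γ * (Bl len 3).card * f x := Iff.rfl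

/-- left translate -/
def tr (h : G) (f : G → ℝ) : G → ℝ := fun x => f (h * x)

lemma tr_mem {γ : ℝ} {f : G → ℝ} (hf : f ∈ Wsp len γ) (h : G) : tr h f ∈ Wsp len γ := by
  intro x
  have := hf (h * x)
  simpa [tr, mul_assoc] using this

/-- local mass -/
noncomputable def Qm (len : G → ℕ) (t : ℕ) (f : G → ℝ) : ℝ := ∑ x ∈ Bl len t, f x ^ 2

/-- total mass -/
def nm (f : G → ℝ) : ℝ := ∑ x, f x ^ 2

lemma Qm_nonneg (t : ℕ) (f : G → ℝ) : 0 ≤ Qm len t f := Finset.sum_nonneg fun _ _ => sq_nonneg _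
lemma nm_nonneg (f : G → ℝ) : 0 ≤ nm f := Finset.sum_nonneg fun _ _ => sq_nonneg _
lemma Qm_mono {s t : ℕ} (h : s ≤ t) (f : G → ℝ) : Qm len s f ≤ Qm len t f :=
  Finset.sum_le_sum_of_subset_of_nonneg (Bl_mono h) fun _ _ _ => sq_nonneg _
lemma Qm_le_nm (t : ℕ) (f : G → ℝ) : Qm len t f ≤ nm f :=
  Finset.sum_le_sum_of_subset_of_nonneg (Finset.subset_univ _) fun _ _ _ => sq_nonneg _

lemma nm_tr (h : G) (f : G → ℝ) : nm (tr h f) = nm f := by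
  unfold nm tr
  exact Equiv.sum_comp (Equiv.mulLeft h) (fun x => f x ^ 2)

lemma sum_mul_right (u : G) (F : G → ℝ) : ∑ x, F (x * u) = ∑ x, F x :=
  Equiv.sum_comp (Equiv.mulRight u) F

lemma sum_Bl_inv (hl : WLen len) (t : ℕ) (F : G → ℝ) :
    ∑ u ∈ Bl len t, F u⁻¹ = ∑ u ∈ Bl len t, F u := by
  apply Finset.sum_nbij' (fun u => u⁻¹) (fun u => u⁻¹) <;> simp [hl.inv]

/-- symmetry of the edge sum -/
lemma edge_symm (hl : WLen len) (t : ℕ) (Φ : G → G → ℝ) :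
    ∑ x, ∑ u ∈ Bl len t, Φ x (x * u) = ∑ x, ∑ u ∈ Bl len t, Φ (x * u) x := by
  rw [Finset.sum_comm]
  rw [Finset.sum_comm (f := fun x u => Φ (x * u) x)]
  rw [← sum_Bl_inv hl]
  refine Finset.sum_congr rfl fun u _ => ?_
  rw [← sum_mul_right u]
  simp

lemma sum_En (hl : WLen len) {γ : ℝ} {f : G → ℝ} (hf : f ∈ Wsp len γ) :
    ∑ x, En len f x = 2 * γ * (Bl len 3).card * nm f := by
  have h1 : ∑ x, En len f x = ∑ x, ∑ u ∈ Bl len 3, f x * (f x - f (x * u))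
      + ∑ x, ∑ u ∈ Bl len 3, f (x * u) * (f (x * u) - f x) := by
    rw [← Finset.sum_add_distrib]
    refine Finset.sum_congr rfl fun x _ => ?_
    unfold En
    rw [← Finset.sum_add_distrib]
    exact Finset.sum_congr rfl fun u _ => by ring
  rw [h1, ← edge_symm hl 3 (fun x y => f x * (f x - f y))]
  have h2 : ∑ x, ∑ u ∈ Bl len 3, f x * (f x - f (x * u)) = γ * (Bl len 3).card * nm f := by
    unfold nm
    rw [Finset.mul_sum]
    refine Finset.sum_congr rfl fun x _ => ?_
    rw [← Finset.mul_sum, hf x]; ring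
  rw [h2]; ring

lemma pointwise (hl : WLen len) (f : G → ℝ) (x s : G) (hs : len s ≤ 1) :
    (Bl len 1).card * (f x - f (x * s)) ^ 2 ≤ 2 * En len f x + 2 * En len f (x * s) := by
  classical
  have h1 : ∑ v ∈ Bl len 1, (f x - f (x * v)) ^ 2 ≤ En len f x :=
    Finset.sum_le_sum_of_subset_of_nonneg (Bl_mono (by norm_num)) fun _ _ _ => sq_nonneg _
  have h2 : ∑ v ∈ Bl len 1, (f (x * s) - f (x * v)) ^ 2 ≤ En len f (x * s) := by
    have e : ∑ v ∈ Bl len 1, (f (x * s) - f (x * v)) ^ 2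
        = ∑ w ∈ (Bl len 1).image (fun v => s⁻¹ * v), (f (x * s) - f (x * s * w)) ^ 2 := by
      classical
      rw [Finset.sum_image (fun a _ b _ h => mul_left_cancel h)]
      exact Finset.sum_congr rfl fun v _ => by group
    rw [e]
    refine Finset.sum_le_sum_of_subset_of_nonneg ?_ fun _ _ _ => sq_nonneg _
    intro w hw
    obtain ⟨v, hv, rfl⟩ := Finset.mem_image.1 hw
    rw [mem_Bl] at *
    have := hl.mul s⁻¹ v
    rw [hl.inv] at this; omega
  calc (Bl len 1).card * (f x - f (x * s)) ^ 2
      = ∑ v ∈ Bl len 1, (f x - f (x * s)) ^ 2 := by simp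
    _ ≤ ∑ v ∈ Bl len 1, (2 * (f x - f (x * v)) ^ 2 + 2 * (f (x * s) - f (x * v)) ^ 2) := by
        refine Finset.sum_le_sum fun v _ => ?_
        nlinarith [sq_nonneg ((f x - f (x * v)) + (f (x * s) - f (x * v)))]
    _ ≤ _ := by
        rw [Finset.sum_add_distrib, ← Finset.mul_sum, ← Finset.mul_sum]; linarith

lemma path_sum (hl : WLen len) (f : G → ℝ) (m : ℕ) (v : G) (hv : len v ≤ m)
    (A A' : Finset G) (hA : ∀ x ∈ A, ∀ w, len w ≤ m → x * w ∈ A') :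
    (Bl len 1).card * ∑ x ∈ A, (f x - f (x * v)) ^ 2 ≤ 4 * m ^ 2 * ∑ x ∈ A', En len f x := by
  classical
  obtain ⟨p, h0, h1, h2, h3⟩ := hl.path m v hv
  have hshift : ∀ j ≤ m, ∑ x ∈ A, En len f (x * p j) ≤ ∑ x ∈ A', En len f x := by
    intro j hj
    have e : ∑ x ∈ A, En len f (x * p j) = ∑ y ∈ A.image (fun x => x * p j), En len f y :=
      (Finset.sum_image (fun a _ b _ h => mul_right_cancel h)).symm
    rw [e]
    refine Finset.sum_le_sum_of_subset_of_nonneg ?_ fun _ _ _ => En_nonneg _ _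
    intro y hy
    obtain ⟨x, hx, rfl⟩ := Finset.mem_image.1 hy
    exact hA x hx _ ((h3 j hj).trans hj)
  have htel : ∀ x, f x - f (x * v) = ∑ j ∈ Finset.range m, (f (x * p j) - f (x * p (j+1))) := by
    intro x
    rw [Finset.sum_range_sub' (fun j => f (x * p j)), h0, h1]; simp
  have hx : ∀ x, (Bl len 1).card * (f x - f (x * v)) ^ 2 ≤
      m * ∑ j ∈ Finset.range m, (2 * En len f (x * p j) + 2 * En len f (x * p (j+1))) := by
    intro x
    have hc : (f x - f (x * v)) ^ 2 ≤ m * ∑ j ∈ Finset.range m, (f (x * p j) - f (x * p (j+1))) ^ 2 := by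
      rw [htel]
      have := sq_sum_le_card_mul_sum_sq (s := Finset.range m) (f := fun j => f (x * p j) - f (x * p (j+1)))
      simpa using this
    calc (Bl len 1).card * (f x - f (x * v)) ^ 2
        ≤ (Bl len 1).card * (m * ∑ j ∈ Finset.range m, (f (x * p j) - f (x * p (j+1))) ^ 2) := by gcongr
      _ = m * ∑ j ∈ Finset.range m, (Bl len 1).card * (f (x * p j) - f (x * p (j+1))) ^ 2 := by
          rw [← Finset.mul_sum]; ring
      _ ≤ _ := by
          refine mul_le_mul_of_nonneg_left (Finset.sum_le_sum fun j hj => ?_) (Nat.cast_nonneg _)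
          have := pointwise hl f (x * p j) ((p j)⁻¹ * p (j+1)) (h2 j (Finset.mem_range.1 hj))
          simpa [mul_assoc] using this
  rw [Finset.mul_sum]
  calc ∑ x ∈ A, (Bl len 1).card * (f x - f (x * v)) ^ 2
      ≤ ∑ x ∈ A, m * ∑ j ∈ Finset.range m, (2 * En len f (x * p j) + 2 * En len f (x * p (j+1))) :=
        Finset.sum_le_sum fun x _ => hx x
    _ = m * ∑ j ∈ Finset.range m, (2 * ∑ x ∈ A, En len f (x * p j) + 2 * ∑ x ∈ A, En len f (x * p (j+1))) := by
        rw [← Finset.mul_sum, Finset.sum_comm]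
        congr 1
        refine Finset.sum_congr rfl fun j _ => ?_
        rw [Finset.sum_add_distrib, Finset.mul_sum, Finset.mul_sum]
    _ ≤ m * ∑ j ∈ Finset.range m, (4 * ∑ x ∈ A', En len f x) := by
        refine mul_le_mul_of_nonneg_left (Finset.sum_le_sum fun j hj => ?_) (Nat.cast_nonneg _)
        have hj' := Finset.mem_range.1 hj
        have := hshift j hj'.le
        have := hshift (j+1) hj'
        linarith
    _ = _ := by simp; ring

lemma global_shift (hl : WLen len) {γ : ℝ} {f : G → ℝ} (hf : f ∈ Wsp len γ) (m : ℕ) (v : G)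
    (hv : len v ≤ m) :
    (Bl len 1).card * ∑ x, (f x - f (x * v)) ^ 2 ≤ 8 * m ^ 2 * γ * (Bl len 3).card * nm f := by
  have := path_sum hl f m v hv Finset.univ Finset.univ (by simp)
  rw [sum_En hl hf] at this
  linarith

/-- cutoff -/
def cut (len : G → ℕ) (T : ℕ) (x : G) : ℝ := ((min T (2 * T - len x) : ℕ) : ℝ)

lemma cut_lip (hl : WLen len) (T : ℕ) (x u : G) (hu : len u ≤ 3) :
    (cut len T x - cut len T (x * u)) ^ 2 ≤ 9 := by
  have h1 := hl.mul x u
  have h2 := hl.mul (x * u) u⁻¹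
  rw [hl.inv, mul_inv_cancel_right] at h2
  have h3 : cut len T x ≤ cut len T (x * u) + 3 := by
    unfold cut; norm_cast; omega
  have h4 : cut len T (x * u) ≤ cut len T x + 3 := by
    unfold cut; norm_cast; omega
  nlinarith

lemma caccioppoli (hl : WLen len) {γ : ℝ} {f : G → ℝ} (hf : f ∈ Wsp len γ)
    (t : ℕ) (hγ : 0 ≤ γ) :
    ((t + 3 : ℕ):ℝ) ^ 2 * ∑ x ∈ Bl len t, En len f x
      ≤ (Bl len 3).card * (2 * γ * ((t + 3 : ℕ):ℝ) ^ 2 + 9) * Qm len (2 * t + 9) f := by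
  set T := t + 3 with hT
  set φ := cut len T with hφ
  have hφT : ∀ x, φ x ≤ T := fun x => by simp only [hφ, cut]; norm_cast; omega
  have hφ0 : ∀ x, 0 ≤ φ x := fun x => by simp only [hφ, cut]; positivity
  have hφ1 : ∀ x, len x ≤ T → φ x = T := fun x hx => by simp only [hφ, cut]; norm_cast; omega
  have hφ2 : ∀ x, 2 * T ≤ len x → φ x = 0 := fun x hx => by simp only [hφ, cut]; norm_cast; omega
  have hS : ∑ x, ∑ u ∈ Bl len 3, (φ x * f x - φ (x * u) * f (x * u)) ^ 2
      ≤ 2 * γ * (Bl len 3).card * ∑ x, φ x ^ 2 * f x ^ 2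
        + ∑ x, ∑ u ∈ Bl len 3, f x ^ 2 * (φ x - φ (x * u)) ^ 2 := by
    have e1 : ∑ x, ∑ u ∈ Bl len 3, φ x ^ 2 * f x * (f x - f (x * u))
        = γ * (Bl len 3).card * ∑ x, φ x ^ 2 * f x ^ 2 := by
      rw [Finset.mul_sum]
      refine Finset.sum_congr rfl fun x _ => ?_
      rw [← Finset.mul_sum, hf x]; ring
    have e2 := edge_symm hl 3 (fun x y => φ x ^ 2 * f x * (f x - f y))
    have e3 := edge_symm hl 3 (fun x y => f x ^ 2 * (φ x - φ y) ^ 2)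
    have e4 : ∑ x, ∑ u ∈ Bl len 3, (φ x * f x - φ (x * u) * f (x * u)) ^ 2 ≤
       ∑ x, ∑ u ∈ Bl len 3, (φ x ^ 2 * f x * (f x - f (x * u))
        + φ (x * u) ^ 2 * f (x * u) * (f (x * u) - f x)
        + (1/2) * (f x ^ 2 * (φ x - φ (x * u)) ^ 2)
        + (1/2) * (f (x * u) ^ 2 * (φ (x * u) - φ x) ^ 2)) := by
      refine Finset.sum_le_sum fun x _ => Finset.sum_le_sum fun u _ => ?_
      nlinarith [mul_nonneg (sq_nonneg (f x - f (x * u))) (sq_nonneg (φ x - φ (x * u)))]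
    simp only [Finset.sum_add_distrib, ← Finset.mul_sum] at e4
    simp only [← Finset.mul_sum] at e1 e2 e3 ⊢
    linarith
  have h1 : (T:ℝ) ^ 2 * ∑ x ∈ Bl len t, En len f x
      ≤ ∑ x, ∑ u ∈ Bl len 3, (φ x * f x - φ (x * u) * f (x * u)) ^ 2 := by
    rw [Finset.mul_sum]
    calc _ = ∑ x ∈ Bl len t, ∑ u ∈ Bl len 3, (φ x * f x - φ (x * u) * f (x * u)) ^ 2 := by
          refine Finset.sum_congr rfl fun x hx => ?_
          unfold En
          rw [Finset.mul_sum]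
          refine Finset.sum_congr rfl fun u hu => ?_
          rw [mem_Bl] at hx hu
          have := hl.mul x u
          rw [hφ1 x (by omega), hφ1 (x * u) (by omega)]; ring
      _ ≤ _ := Finset.sum_le_sum_of_subset_of_nonneg (Finset.subset_univ _)
          fun _ _ _ => Finset.sum_nonneg fun _ _ => sq_nonneg _
  have h2 : ∑ x, φ x ^ 2 * f x ^ 2 ≤ (T:ℝ) ^ 2 * Qm len (2 * t + 9) f := by
    unfold Qm
    rw [Finset.mul_sum, ← Finset.sum_subset (Finset.subset_univ (Bl len (2 * t + 9)))]
    · refine Finset.sum_le_sum fun x _ => ?_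
      have := hφT x; have := hφ0 x
      gcongr
    · intro x _ hx
      rw [mem_Bl] at hx
      rw [hφ2 x (by omega)]; ring
  have h3 : ∑ x, ∑ u ∈ Bl len 3, f x ^ 2 * (φ x - φ (x * u)) ^ 2
      ≤ (Bl len 3).card * 9 * Qm len (2 * t + 9) f := by
    unfold Qm
    rw [Finset.mul_sum, ← Finset.sum_subset (Finset.subset_univ (Bl len (2 * t + 9)))]
    · refine Finset.sum_le_sum fun x _ => ?_
      calc _ ≤ ∑ u ∈ Bl len 3, 9 * f x ^ 2 := by
            refine Finset.sum_le_sum fun u hu => ?_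
            rw [mul_comm]
            gcongr
            exact cut_lip hl T x u (mem_Bl.1 hu)
        _ = _ := by simp; ring
    · intro x _ hx
      rw [mem_Bl] at hx
      refine Finset.sum_eq_zero fun u hu => ?_
      rw [mem_Bl] at hu
      have h2 := hl.mul (x * u) u⁻¹
      rw [hl.inv, mul_inv_cancel_right] at h2
      rw [hφ2 x (by omega), hφ2 (x * u) (by omega)]; ring
  have h4 : 2 * γ * (Bl len 3).card * ∑ x, φ x ^ 2 * f x ^ 2
      ≤ 2 * γ * (Bl len 3).card * ((T:ℝ) ^ 2 * Qm len (2 * t + 9) f) := by gcongr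
  linarith

/-- translated ball -/
noncomputable def Bt (len : G → ℕ) (y : G) (t : ℕ) : Finset G :=
  Finset.univ.filter (fun x => len (y⁻¹ * x) ≤ t)

@[simp] lemma mem_Bt {y x : G} {t : ℕ} : x ∈ Bt len y t ↔ len (y⁻¹ * x) ≤ t := by simp [Bt]

lemma card_Bt (y : G) (t : ℕ) : (Bt len y t).card = (Bl len t).card := by
  apply Finset.card_nbij' (fun x => y⁻¹ * x) (fun x => y * x) <;> simp [Set.MapsTo, Set.LeftInvOn]

lemma poincare (hl : WLen len) (f : G → ℝ) (y : G) (τ : ℕ) (h0 : ∑ x ∈ Bt len y τ, f x = 0) :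
    (Bl len 1).card * ((Bl len τ).card * ∑ x ∈ Bt len y τ, f x ^ 2)
      ≤ (Bl len (2 * τ)).card * (8 * τ ^ 2 * ∑ x ∈ Bt len y (3 * τ), En len f x) := by
  classical
  set A := Bt len y τ with hA
  have h1 : ∑ x ∈ A, ∑ x' ∈ A, (f x - f x') ^ 2 = 2 * (A.card * ∑ x ∈ A, f x ^ 2) := by
    have : ∀ x x', (f x - f x') ^ 2 = f x ^ 2 + f x' ^ 2 - 2 * (f x * f x') := by intros; ring
    simp only [this, Finset.sum_sub_distrib, Finset.sum_add_distrib, ← Finset.mul_sum, h0]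
    simp; rw [← Finset.mul_sum]; ring
  have h2 : ∑ x ∈ A, ∑ x' ∈ A, (f x - f x') ^ 2
      ≤ ∑ x ∈ A, ∑ v ∈ Bl len (2 * τ), (f x - f (x * v)) ^ 2 := by
    refine Finset.sum_le_sum fun x hx => ?_
    have : ∑ x' ∈ A, (f x - f x') ^ 2 = ∑ v ∈ A.image (fun x' => x⁻¹ * x'), (f x - f (x * v)) ^ 2 := by
      rw [Finset.sum_image (fun a _ b _ h => mul_left_cancel h)]
      exact Finset.sum_congr rfl fun v _ => by group
    rw [this]
    refine Finset.sum_le_sum_of_subset_of_nonneg ?_ fun _ _ _ => sq_nonneg _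
    intro v hv
    obtain ⟨x', hx', rfl⟩ := Finset.mem_image.1 hv
    rw [hA, mem_Bt] at hx hx'
    rw [mem_Bl]
    have h := hl.mul (y⁻¹ * x)⁻¹ (y⁻¹ * x')
    rw [hl.inv] at h
    have e : (y⁻¹ * x)⁻¹ * (y⁻¹ * x') = x⁻¹ * x' := by group
    rw [e] at h; omega
  have h3 : (Bl len 1).card * ∑ x ∈ A, ∑ v ∈ Bl len (2 * τ), (f x - f (x * v)) ^ 2
      ≤ (Bl len (2 * τ)).card * (16 * τ ^ 2 * ∑ x ∈ Bt len y (3 * τ), En len f x) := by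
    rw [Finset.sum_comm, Finset.mul_sum]
    calc _ ≤ ∑ v ∈ Bl len (2 * τ), (16 * τ ^ 2 * ∑ x ∈ Bt len y (3 * τ), En len f x) := by
          refine Finset.sum_le_sum fun v hv => ?_
          have := path_sum hl f (2 * τ) v (mem_Bl.1 hv) A (Bt len y (3 * τ)) (by
            intro x hx w hw
            rw [hA, mem_Bt] at hx
            rw [mem_Bt, ← mul_assoc]
            have := hl.mul (y⁻¹ * x) w
            omega)
          push_cast at this
          linarith
      _ = _ := by simp
  have h4 : (Bl len 1).card * ∑ x ∈ A, ∑ x' ∈ A, (f x - f x') ^ 2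
    ≤ (Bl len 1).card * ∑ x ∈ A, ∑ v ∈ Bl len (2 * τ), (f x - f (x * v)) ^ 2 := by gcongr
  rw [h1] at h4
  rw [hA, card_Bt] at h4
  linarith

lemma cover (hl : WLen len) (t σ : ℕ) : ∃ Y : Finset G, Y ⊆ Bl len t ∧
    (∀ x ∈ Bl len t, ∃ y ∈ Y, x ∈ Bt len y (2 * σ)) ∧
    (Y : Set G).PairwiseDisjoint (fun y => Bt len y σ) := by
  classical
  set F : Finset (Finset G) := (Bl len t).powerset.filter (fun Y => (Y : Set G).PairwiseDisjoint (fun y => Bt len y σ)) with hF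
  obtain ⟨Y, hY, hmax⟩ := Finset.exists_max_image F Finset.card ⟨∅, by simp [hF]⟩
  rw [hF, Finset.mem_filter, Finset.mem_powerset] at hY
  refine ⟨Y, hY.1, ?_, hY.2⟩
  intro x hx
  by_contra hcon
  push Not at hcon
  have hxY : x ∉ Y := fun h => hcon x h (by simp [hl.one])
  have := hmax (insert x Y) (by
    rw [hF, Finset.mem_filter, Finset.mem_powerset]
    refine ⟨Finset.insert_subset hx hY.1, ?_⟩
    rw [Finset.coe_insert, Set.pairwiseDisjoint_insert]
    refine ⟨hY.2, fun y hy _ => ?_⟩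
    rw [Finset.disjoint_left]
    intro z hz1 hz2
    apply hcon y hy
    rw [mem_Bt] at *
    have h := hl.mul (y⁻¹ * z) (x⁻¹ * z)⁻¹
    rw [hl.inv] at h
    have e : (y⁻¹ * z) * (x⁻¹ * z)⁻¹ = y⁻¹ * x := by group
    rw [e] at h; omega)
  rw [Finset.card_insert_of_notMem hxY] at this
  omega

lemma count_disj (hl : WLen len) (Y : Finset G) (σ T : ℕ) (x : G)
    (hd : (Y : Set G).PairwiseDisjoint (fun y => Bt len y σ))
    (hY : ∀ y ∈ Y, len (x⁻¹ * y) ≤ T) : Y.card * (Bl len σ).card ≤ (Bl len (T + σ)).card := by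
  classical
  have h1 : (Y.biUnion (fun y => Bt len y σ)).card = Y.card * (Bl len σ).card := by
    rw [Finset.card_biUnion hd]; simp [card_Bt]
  rw [← h1, ← card_Bt x (T + σ)]
  apply Finset.card_le_card
  intro z hz
  obtain ⟨y, hy, hz⟩ := Finset.mem_biUnion.1 hz
  rw [mem_Bt] at *
  have h := hl.mul (x⁻¹ * y) (y⁻¹ * z)
  have e : (x⁻¹ * y) * (y⁻¹ * z) = x⁻¹ * z := by group
  have := hY y hy
  rw [e] at h; omega

lemma sum_biUnion_le {α β : Type*} [DecidableEq β] (Y : Finset α) (A : α → Finset β) (F : β → ℝ)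
    (hF : ∀ x, 0 ≤ F x) : ∑ x ∈ Y.biUnion A, F x ≤ ∑ y ∈ Y, ∑ x ∈ A y, F x := by
  classical
  induction Y using Finset.induction_on with
  | empty => simp
  | insert a s ha ih =>
    rw [Finset.biUnion_insert, Finset.sum_insert ha]
    have := Finset.sum_union_inter (s₁ := A a) (s₂ := s.biUnion A) (f := F)
    have h2 : 0 ≤ ∑ x ∈ A a ∩ s.biUnion A, F x := Finset.sum_nonneg fun x _ => hF x
    linarith

lemma good_scale (hl : WLen len) {γ : ℝ} (hγ : 0 ≤ γ) (t σ : ℕ) (K K0 : ℝ) (N : ℕ)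
    (hσt : 8 * σ ≤ t) (ht : 3 ≤ t)
    (hK : ((Bl len 3).card : ℝ) ≤ K * (Bl len 1).card)
    (hK0 : ((Bl len (8 * σ)).card : ℝ) ≤ K0 * (Bl len σ).card)
    (hN : (Bl len (8 * t)).card ≤ N * (Bl len σ).card)
    (hγt : 2 * γ * t ^ 2 ≤ 1) :
    ∃ Y : Finset G, Y.card ≤ N ∧ ∀ f ∈ Wsp len γ, (∀ y ∈ Y, ∑ x ∈ Bt len y (2 * σ), f x = 0) →
      (t:ℝ) ^ 2 * Qm len t f ≤ 320 * K * K0 ^ 2 * σ ^ 2 * Qm len (8 * t) f := by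
  classical
  obtain ⟨Y, hYt, hcov, hdis⟩ := cover hl t σ
  have hσpos : (0:ℝ) < (Bl len σ).card := by exact_mod_cast hl.card_pos σ
  have h1pos : (0:ℝ) < (Bl len 1).card := by exact_mod_cast hl.card_pos 1
  have hK0' : 0 ≤ K0 := by
    by_contra h
    push Not at h
    have : (0:ℝ) ≤ (Bl len (8 * σ)).card := Nat.cast_nonneg _
    nlinarith
  refine ⟨Y, ?_, ?_⟩
  · have := count_disj hl Y σ t 1 hdis (fun y hy => by simpa using hYt hy)
    have h2 : (Bl len (t + σ)).card ≤ (Bl len (8 * t)).card := Finset.card_le_card (Bl_mono (by omega))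
    exact Nat.le_of_mul_le_mul_right (this.trans (h2.trans hN)) (hl.card_pos σ)
  · intro f hf h0
    have hA : ∀ y ∈ Y, (Bl len 1).card * ∑ x ∈ Bt len y (2 * σ), f x ^ 2
        ≤ 32 * σ ^ 2 * K0 * ∑ x ∈ Bt len y (6 * σ), En len f x := by
      intro y hy
      have hp := poincare hl f y (2 * σ) (h0 y hy)
      have e : 3 * (2 * σ) = 6 * σ := by ring
      rw [e] at hp
      push_cast at hp
      have hE : 0 ≤ ∑ x ∈ Bt len y (6 * σ), En len f x := Finset.sum_nonneg fun _ _ => En_nonneg _ _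
      have c1 : ((Bl len (2 * (2 * σ))).card : ℝ) ≤ K0 * (Bl len (2 * σ)).card := by
        calc ((Bl len (2 * (2 * σ))).card : ℝ) ≤ (Bl len (8 * σ)).card := by
              exact_mod_cast Finset.card_le_card (Bl_mono (by omega))
          _ ≤ K0 * (Bl len σ).card := hK0
          _ ≤ _ := by
              gcongr
              exact Bl_mono (by omega)
      have c2 : (0:ℝ) < (Bl len (2 * σ)).card := by exact_mod_cast hl.card_pos _
      have : (Bl len (2 * σ)).card * ((Bl len 1).card * ∑ x ∈ Bt len y (2 * σ), f x ^ 2)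
        ≤ (Bl len (2 * σ)).card * (32 * σ ^ 2 * K0 * ∑ x ∈ Bt len y (6 * σ), En len f x) := by
        calc _ ≤ (Bl len (2 * (2 * σ))).card * (8 * (2 * σ) ^ 2 * ∑ x ∈ Bt len y (6 * σ), En len f x) := by linarith
          _ ≤ (K0 * (Bl len (2 * σ)).card) * (8 * (2 * σ) ^ 2 * ∑ x ∈ Bt len y (6 * σ), En len f x) := by
              gcongr
          _ = _ := by ring
      exact le_of_mul_le_mul_left this c2
    have hQ : Qm len t f ≤ ∑ y ∈ Y, ∑ x ∈ Bt len y (2 * σ), f x ^ 2 := by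
      unfold Qm
      calc _ ≤ ∑ x ∈ Y.biUnion (fun y => Bt len y (2 * σ)), f x ^ 2 := by
            refine Finset.sum_le_sum_of_subset_of_nonneg ?_ fun _ _ _ => sq_nonneg _
            intro x hx
            obtain ⟨y, hy, h⟩ := hcov x hx
            exact Finset.mem_biUnion.2 ⟨y, hy, h⟩
        _ ≤ _ := sum_biUnion_le _ _ _ (fun _ => sq_nonneg _)
    have hO : ∑ y ∈ Y, ∑ x ∈ Bt len y (6 * σ), En len f x ≤ K0 * ∑ x ∈ Bl len (t + 6 * σ), En len f x := by
      have e : ∀ y ∈ Y, ∑ x ∈ Bt len y (6 * σ), En len f x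
          = ∑ x ∈ Bl len (t + 6 * σ), if x ∈ Bt len y (6 * σ) then En len f x else 0 := by
        intro y hy
        rw [← Finset.sum_filter]
        refine Finset.sum_congr ?_ fun _ _ => rfl
        ext x
        simp only [mem_Bt, mem_Bl, Finset.mem_filter]
        refine ⟨fun h => ⟨?_, h⟩, fun h => h.2⟩
        have h1 := hl.mul y (y⁻¹ * x)
        have h2 := mem_Bl.1 (hYt hy)
        rw [mul_inv_cancel_left] at h1; omega
      rw [Finset.sum_congr rfl e, Finset.sum_comm, Finset.mul_sum]
      refine Finset.sum_le_sum fun x _ => ?_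
      rw [← Finset.sum_filter, Finset.sum_const, nsmul_eq_mul]
      refine mul_le_mul_of_nonneg_right ?_ (En_nonneg _ _)
      have := count_disj hl (Y.filter (fun y => x ∈ Bt len y (6 * σ))) σ (6 * σ) x
        (hdis.subset (by intro y hy; exact (Finset.mem_filter.1 hy).1)) (by
          intro y hy
          have := (Finset.mem_filter.1 hy).2
          rw [mem_Bt, ← hl.inv] at this
          have e : (y⁻¹ * x)⁻¹ = x⁻¹ * y := by group
          rwa [e] at this)
      have h2 : (Bl len (6 * σ + σ)).card ≤ (Bl len (8 * σ)).card := Finset.card_le_card (Bl_mono (by omega))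
      have h3 : ((Y.filter (fun y => x ∈ Bt len y (6 * σ))).card : ℝ) * (Bl len σ).card ≤ K0 * (Bl len σ).card := by
        refine le_trans ?_ hK0
        exact_mod_cast this.trans h2
      exact le_of_mul_le_mul_right h3 hσpos
    have hC : (t:ℝ) ^ 2 * ∑ x ∈ Bl len (t + 6 * σ), En len f x ≤ 10 * (Bl len 3).card * Qm len (8 * t) f := by
      have hc := caccioppoli hl hf (t + 6 * σ) hγ
      have hm : Qm len (2 * (t + 6 * σ) + 9) f ≤ Qm len (8 * t) f := Qm_mono (by omega) f
      have hQ0 := Qm_nonneg (len := len) (8 * t) f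
      set T : ℝ := ((t + 6 * σ + 3 : ℕ):ℝ) with hT
      have hTt : (t:ℝ) ≤ T := by rw [hT]; norm_cast; omega
      have ht0 : (0:ℝ) < t := by norm_cast; omega
      have hE0 : 0 ≤ ∑ x ∈ Bl len (t + 6 * σ), En len f x := Finset.sum_nonneg fun _ _ => En_nonneg _ _
      have hb0 : (0:ℝ) ≤ (Bl len 3).card := Nat.cast_nonneg _
      have s1 : T ^ 2 * ∑ x ∈ Bl len (t + 6 * σ), En len f x
          ≤ (Bl len 3).card * (2 * γ * T ^ 2 + 9) * Qm len (8 * t) f := by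
        refine hc.trans ?_
        gcongr
      have hT2 : (0:ℝ) < T ^ 2 := by positivity
      have s2 : (t:ℝ)^2 * (2 * γ * T ^ 2 + 9) ≤ 10 * T ^ 2 := by
        have : (t:ℝ)^2 ≤ T ^ 2 := by gcongr
        nlinarith
      refine le_of_mul_le_mul_left ?_ hT2
      calc T ^ 2 * ((t:ℝ) ^ 2 * ∑ x ∈ Bl len (t + 6 * σ), En len f x)
          = (t:ℝ)^2 * (T ^ 2 * ∑ x ∈ Bl len (t + 6 * σ), En len f x) := by ring
        _ ≤ (t:ℝ)^2 * ((Bl len 3).card * (2 * γ * T ^ 2 + 9) * Qm len (8 * t) f) := by gcongr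
        _ = ((t:ℝ)^2 * (2 * γ * T ^ 2 + 9)) * ((Bl len 3).card * Qm len (8 * t) f) := by ring
        _ ≤ (10 * T ^ 2) * ((Bl len 3).card * Qm len (8 * t) f) := by gcongr
        _ = _ := by ring
    have hB : (Bl len 1).card * Qm len t f ≤ 32 * σ ^ 2 * K0 * (K0 * ∑ x ∈ Bl len (t + 6 * σ), En len f x) := by
      calc _ ≤ (Bl len 1).card * ∑ y ∈ Y, ∑ x ∈ Bt len y (2 * σ), f x ^ 2 := by gcongr
        _ ≤ ∑ y ∈ Y, 32 * σ ^ 2 * K0 * ∑ x ∈ Bt len y (6 * σ), En len f x := by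
            rw [Finset.mul_sum]; exact Finset.sum_le_sum hA
        _ = 32 * σ ^ 2 * K0 * ∑ y ∈ Y, ∑ x ∈ Bt len y (6 * σ), En len f x := by rw [Finset.mul_sum]
        _ ≤ _ := by gcongr
    refine le_of_mul_le_mul_left ?_ h1pos
    calc (Bl len 1).card * ((t:ℝ) ^ 2 * Qm len t f) = (t:ℝ)^2 * ((Bl len 1).card * Qm len t f) := by ring
      _ ≤ (t:ℝ)^2 * (32 * σ ^ 2 * K0 * (K0 * ∑ x ∈ Bl len (t + 6 * σ), En len f x)) := by gcongr
      _ = 32 * σ ^ 2 * K0 ^ 2 * ((t:ℝ)^2 * ∑ x ∈ Bl len (t + 6 * σ), En len f x) := by ring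
      _ ≤ 32 * σ ^ 2 * K0 ^ 2 * (10 * (Bl len 3).card * Qm len (8 * t) f) := by gcongr
      _ = 320 * σ ^ 2 * K0 ^ 2 * Qm len (8 * t) f * (Bl len 3).card := by ring
      _ ≤ 320 * σ ^ 2 * K0 ^ 2 * Qm len (8 * t) f * (K * (Bl len 1).card) := by
          have := Qm_nonneg (len := len) (8 * t) f
          gcongr
      _ = _ := by ring

end DR

namespace DR
set_option linter.unusedSectionVars false
open Matrix

lemma spec {ι : Type*} [Fintype ι] [DecidableEq ι] (A : Matrix ι ι ℝ) (hA : A.IsHermitian) :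
    ∃ (V : Matrix ι ι ℝ) (μ : ι → ℝ), Vᵀ * V = 1 ∧ V * Vᵀ = 1 ∧ A = V * diagonal μ * Vᵀ := by
  set V : Matrix ι ι ℝ := (hA.eigenvectorUnitary : Matrix ι ι ℝ) with hV
  have hVV : Vᵀ * V = 1 := by
    have := (Matrix.mem_unitaryGroup_iff'.1 hA.eigenvectorUnitary.2)
    simpa [star_eq_conjTranspose, conjTranspose_eq_transpose_of_trivial] using this
  have hspec2 : A = V * diagonal hA.eigenvalues * Vᵀ := by
    have := hA.spectral_theorem
    rw [Unitary.conjStarAlgAut_apply] at this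
    simpa [star_eq_conjTranspose, conjTranspose_eq_transpose_of_trivial, Function.comp_def] using this
  exact ⟨V, hA.eigenvalues, hVV, mul_eq_one_comm.1 hVV, hspec2⟩

lemma qf_one {ι : Type*} [Fintype ι] [DecidableEq ι] (c : ι → ℝ) :
    qf (1 : Matrix ι ι ℝ) c = ∑ i, c i ^ 2 := by
  rw [← diagonal_one, qf_diag]; simp

variable {G : Type*} [Group G] [Fintype G] {len : G → ℕ}

open Classical in
/-- Laplacian -/
noncomputable def Lap (len : G → ℕ) : Matrix G G ℝ := fun x y =>
  (if x = y then ((Bl len 3).card : ℝ) else 0) - (if x⁻¹ * y ∈ Bl len 3 then 1 else 0)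

lemma Lap_mulVec (f : G → ℝ) (x : G) :
    (Lap len *ᵥ f) x = ∑ u ∈ Bl len 3, (f x - f (x * u)) := by
  classical
  simp only [Lap, mulVec, dotProduct, sub_mul, Finset.sum_sub_distrib, ite_mul, zero_mul, one_mul]
  congr 1
  · simp
  · rw [← Finset.sum_filter]
    apply Finset.sum_nbij' (fun y => x⁻¹ * y) (fun u => x * u) <;> simp

lemma Lap_herm (hl : WLen len) : (Lap len).IsHermitian := by
  classical
  ext x y
  simp only [Matrix.conjTranspose_apply, Lap, star_trivial, mem_Bl]
  have : len (y⁻¹ * x) = len (x⁻¹ * y) := by rw [← hl.inv]; simp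
  rw [this]
  simp [eq_comm]

lemma qf_Lap (hl : WLen len) (f : G → ℝ) : 2 * qf (Lap len) f = ∑ x, En len f x := by
  have h1 : ∑ x, En len f x = ∑ x, ∑ u ∈ Bl len 3, f x * (f x - f (x * u))
      + ∑ x, ∑ u ∈ Bl len 3, f (x * u) * (f (x * u) - f x) := by
    rw [← Finset.sum_add_distrib]
    refine Finset.sum_congr rfl fun x _ => ?_
    unfold En
    rw [← Finset.sum_add_distrib]
    exact Finset.sum_congr rfl fun u _ => by ring
  rw [h1, ← edge_symm hl 3 (fun x y => f x * (f x - f y))]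
  have h2 : qf (Lap len) f = ∑ x, ∑ u ∈ Bl len 3, f x * (f x - f (x * u)) := by
    unfold qf dotProduct
    refine Finset.sum_congr rfl fun x _ => ?_
    rw [Lap_mulVec, Finset.mul_sum]
  rw [h2]; ring

lemma sum_zero_of_mem {γ : ℝ} (hγ : γ ≠ 0) (hl : WLen len) {f : G → ℝ} (hf : f ∈ Wsp len γ) :
    ∑ x, f x = 0 := by
  have h : ∑ x, ∑ u ∈ Bl len 3, (f x - f (x * u)) = 0 := by
    rw [Finset.sum_comm]
    refine Finset.sum_eq_zero fun u _ => ?_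
    rw [Finset.sum_sub_distrib, sum_mul_right, sub_self]
  rw [Finset.sum_congr rfl (fun x _ => hf x), ← Finset.mul_sum] at h
  have h3 : ((Bl len 3).card : ℝ) ≠ 0 := by exact_mod_cast (hl.card_pos 3).ne'
  simpa [hγ, h3] using h

lemma const_of_En (hl : WLen len) (f : G → ℝ) (h : ∑ x, En len f x = 0) (x : G) : f x = f 1 := by
  have := path_sum hl f (len x) x le_rfl Finset.univ Finset.univ (by simp)
  rw [h, mul_zero] at this
  have h1 : (0:ℝ) < (Bl len 1).card := by exact_mod_cast hl.card_pos 1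
  have h2 : (f 1 - f (1 * x)) ^ 2 ≤ ∑ z, (f z - f (z * x)) ^ 2 :=
    Finset.single_le_sum (f := fun z => (f z - f (z * x)) ^ 2) (fun _ _ => sq_nonneg _) (Finset.mem_univ 1)
  have h3 : (f 1 - f x) ^ 2 ≤ 0 := by
    rw [one_mul] at h2
    by_contra hc
    push Not at hc
    nlinarith
  have := pow_eq_zero_iff (n := 2) (by norm_num) |>.1 (le_antisymm h3 (sq_nonneg _))
  linarith

lemma eig_of_test (hl : WLen len) (g : G → ℝ) (hg0 : ∑ x, g x = 0) (hg : 0 < nm g) (β : ℝ)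
    (hβ : ∑ x, En len g x ≤ 2 * β * (Bl len 3).card * nm g) :
    ∃ γ f, f ∈ Wsp len γ ∧ f ≠ 0 ∧ 0 < γ ∧ γ ≤ β := by
  classical
  obtain ⟨V, μ, h1, h2, h3⟩ := spec (Lap len) (Lap_herm hl)
  have hb : (0:ℝ) < (Bl len 3).card := by exact_mod_cast hl.card_pos 3
  have hcol : ∀ i, (fun x => V x i) ∈ Wsp len (μ i / (Bl len 3).card) := by
    intro i x
    refine (Lap_mulVec (len := len) (fun x => V x i) x).symm.trans ?_
    have e : Lap len * V = V * diagonal μ := by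
      rw [h3, Matrix.mul_assoc, h1, Matrix.mul_one]
    have := congrFun (congrFun e x) i
    rw [Matrix.mul_diagonal] at this
    have h : (Lap len *ᵥ fun x => V x i) x = (Lap len * V) x i := rfl
    rw [h, this]; field_simp
  have hne : ∀ i, (fun x => V x i) ≠ 0 := by
    intro i h
    have := congrFun (congrFun h1 i) i
    simp only [Matrix.mul_apply, transpose_apply, one_apply_eq] at this
    have h' : ∀ x, V x i = 0 := fun x => congrFun h x
    simp [h'] at this
  have hμ0 : ∀ i, 0 ≤ μ i := by
    intro i
    have hE := sum_En hl (hcol i)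
    have h0 : 0 ≤ ∑ x, En len (fun x => V x i) x := Finset.sum_nonneg fun _ _ => En_nonneg _ _
    have hn : 0 < nm (fun x => V x i) := by
      have := congrFun (congrFun h1 i) i
      simp only [Matrix.mul_apply, transpose_apply, one_apply_eq] at this
      unfold nm
      simp only [pow_two, this]; norm_num
    rw [hE] at h0
    have e : 2 * (μ i / (Bl len 3).card) * (Bl len 3).card * nm (fun x => V x i) = 2 * μ i * nm (fun x => V x i) := by
      field_simp
    rw [e] at h0
    by_contra hc
    push Not at hc
    nlinarith
  set c := Vᵀ *ᵥ g with hc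
  have hq : qf (Lap len) g = ∑ i, μ i * c i ^ 2 := by
    have := qf_congr (diagonal μ) Vᵀ g
    rw [transpose_transpose, ← h3, qf_diag] at this
    exact this
  have hn : nm g = ∑ i, c i ^ 2 := by
    have := qf_congr 1 Vᵀ g
    rw [transpose_transpose, Matrix.mul_one, h2, qf_one, qf_one] at this
    exact this
  by_contra hcon
  push Not at hcon
  have hbig : ∀ i, c i ≠ 0 → β * (Bl len 3).card < μ i := by
    intro i hci
    rcases (hμ0 i).lt_or_eq with hpos | hz
    · have := hcon _ _ (hcol i) (hne i) (div_pos hpos hb)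
      rwa [lt_div_iff₀ hb] at this
    · exfalso
      apply hci
      have hE := sum_En hl (hcol i)
      rw [← hz] at hE
      have hconst := const_of_En hl _ (by simpa using hE)
      rw [hc]
      simp only [mulVec, dotProduct, transpose_apply]
      rw [Finset.sum_congr rfl (fun x _ => by rw [hconst x]), ← Finset.mul_sum, hg0, mul_zero]
  have hlt : ∑ i, (β * (Bl len 3).card) * c i ^ 2 < ∑ i, μ i * c i ^ 2 := by
    obtain ⟨j, hj⟩ : ∃ j, c j ≠ 0 := by
      by_contra hz; push Not at hz
      rw [hn] at hg; simp [hz] at hg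
    apply Finset.sum_lt_sum
    · intro i _
      by_cases hi : c i = 0
      · simp [hi]
      · have := hbig i hi
        gcongr
    · refine ⟨j, Finset.mem_univ _, ?_⟩
      have := hbig j hj
      have h5 : 0 < c j ^ 2 := by positivity
      gcongr
  rw [← hq, ← Finset.mul_sum, ← hn] at hlt
  have := qf_Lap hl g
  linarith

lemma eig_exists (hl : WLen len) (s : ℕ) (hs : 1 ≤ s) (y : G) (hy : 16 * s ≤ len y) (K' : ℝ)
    (hK' : ((Bl len (64 * s)).card : ℝ) ≤ K' * (Bl len s).card) :
    ∃ γ f, f ∈ Wsp len γ ∧ f ≠ 0 ∧ 0 < γ ∧ γ ≤ K' / s ^ 2 := by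
  classical
  set t := 8 * s with ht
  set ψ : G → ℝ := fun x => ((t - len x : ℕ) : ℝ) with hψ
  set g : G → ℝ := fun x => ψ x - tr y⁻¹ ψ x with hg
  have hb : (0:ℝ) < (Bl len 3).card := by exact_mod_cast hl.card_pos 3
  have hsc : (0:ℝ) < (Bl len s).card := by exact_mod_cast hl.card_pos s
  have hs0 : (0:ℝ) < s := by exact_mod_cast hs
  have hK0 : 0 ≤ K' := by
    by_contra h
    push Not at h
    have : (0:ℝ) ≤ (Bl len (64 * s)).card := Nat.cast_nonneg _
    nlinarith
  have htr : ∀ F : G → ℝ, ∑ x, F (y⁻¹ * x) = ∑ x, F x := fun F =>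
    Equiv.sum_comp (Equiv.mulLeft y⁻¹) F
  have hg0 : ∑ x, g x = 0 := by
    simp only [hg, tr, Finset.sum_sub_distrib]
    rw [htr ψ, sub_self]
  have hE1 : ∀ x, En len ψ x ≤ if x ∈ Bl len (64 * s) then 9 * ((Bl len 3).card : ℝ) else 0 := by
    intro x
    unfold En
    split_ifs with hx
    · calc _ ≤ ∑ u ∈ Bl len 3, (9:ℝ) := by
            refine Finset.sum_le_sum fun u hu => ?_
            rw [mem_Bl] at hu
            have h1 := hl.mul x u
            have h2 := hl.mul (x * u) u⁻¹
            rw [hl.inv, mul_inv_cancel_right] at h2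
            have h3 : ψ x ≤ ψ (x * u) + 3 := by simp only [hψ]; norm_cast; omega
            have h4 : ψ (x * u) ≤ ψ x + 3 := by simp only [hψ]; norm_cast; omega
            nlinarith
        _ = _ := by simp; ring
    · refine le_of_eq (Finset.sum_eq_zero fun u hu => ?_)
      rw [mem_Bl] at hu hx
      have h2 := hl.mul (x * u) u⁻¹
      rw [hl.inv, mul_inv_cancel_right] at h2
      have h3 : ψ x = 0 := by simp only [hψ]; norm_cast; omega
      have h4 : ψ (x * u) = 0 := by simp only [hψ]; norm_cast; omega
      rw [h3, h4]; ring
  have hE2 : ∑ x, En len ψ x ≤ 9 * (Bl len 3).card * (Bl len (64 * s)).card := by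
    calc _ ≤ ∑ x, if x ∈ Bl len (64 * s) then 9 * ((Bl len 3).card : ℝ) else 0 :=
          Finset.sum_le_sum fun x _ => hE1 x
      _ = _ := by rw [Finset.sum_ite_mem, Finset.univ_inter, Finset.sum_const, nsmul_eq_mul]; ring
  have hE3 : ∑ x, En len g x ≤ 36 * (Bl len 3).card * (Bl len (64 * s)).card := by
    have : ∀ x, En len g x ≤ 2 * En len ψ x + 2 * En len ψ (y⁻¹ * x) := by
      intro x
      unfold En
      rw [Finset.mul_sum, Finset.mul_sum, ← Finset.sum_add_distrib]
      refine Finset.sum_le_sum fun u _ => ?_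
      simp only [hg, tr, mul_assoc]
      nlinarith [sq_nonneg ((ψ x - ψ (x * u)) + (ψ (y⁻¹ * x) - ψ (y⁻¹ * (x * u))))]
    have h2 := Finset.sum_le_sum (s := Finset.univ) fun x _ => this x
    rw [Finset.sum_add_distrib, ← Finset.mul_sum, ← Finset.mul_sum, htr (fun x => En len ψ x)] at h2
    linarith
  have hnm : 98 * (s:ℝ) ^ 2 * (Bl len s).card ≤ nm g := by
    have e : ∀ x, g x ^ 2 = ψ x ^ 2 + ψ (y⁻¹ * x) ^ 2 := by
      intro x
      have : ψ x * ψ (y⁻¹ * x) = 0 := by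
        simp only [hψ]
        norm_cast
        have h := hl.mul x (y⁻¹ * x)⁻¹
        have e : x * (y⁻¹ * x)⁻¹ = y := by group
        rw [e, hl.inv] at h
        rcases le_total t (len x) with h1 | h1
        · rw [Nat.sub_eq_zero_of_le h1, zero_mul]
        · rw [Nat.sub_eq_zero_of_le (show t ≤ len (y⁻¹ * x) by omega), mul_zero]
      simp only [hg, tr]
      nlinarith
    unfold nm
    simp only [e]
    rw [Finset.sum_add_distrib, htr (fun x => ψ x ^ 2)]
    have : ∑ x ∈ Bl len s, (7 * (s:ℝ)) ^ 2 ≤ ∑ x, ψ x ^ 2 := by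
      calc _ ≤ ∑ x ∈ Bl len s, ψ x ^ 2 := by
            refine Finset.sum_le_sum fun x hx => ?_
            rw [mem_Bl] at hx
            have : (7 * (s:ℝ)) ≤ ψ x := by simp only [hψ]; norm_cast; omega
            gcongr
        _ ≤ _ := Finset.sum_le_sum_of_subset_of_nonneg (Finset.subset_univ _) fun _ _ _ => sq_nonneg _
    simp at this
    nlinarith
  apply eig_of_test hl g hg0 (lt_of_lt_of_le (by positivity) hnm)
  calc ∑ x, En len g x ≤ 36 * (Bl len 3).card * (Bl len (64 * s)).card := hE3
    _ ≤ 36 * (Bl len 3).card * (K' * (Bl len s).card) := by gcongr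
    _ ≤ 2 * (K' / s ^ 2) * (Bl len 3).card * (98 * (s:ℝ) ^ 2 * (Bl len s).card) := by
        have e : 2 * (K' / s ^ 2) * (Bl len 3).card * (98 * (s:ℝ) ^ 2 * (Bl len s).card)
          = 196 * (K' * ((Bl len 3).card * (Bl len s).card)) := by field_simp; ring
        rw [e]
        have : 0 ≤ K' * ((Bl len 3).card * (Bl len s).card) := by positivity
        nlinarith
    _ ≤ _ := by gcongr

/-- logarithmic growth -/
noncomputable def lg (len : G → ℕ) (i : ℕ) : ℝ := Real.logb 8 (Bl len (8 ^ i)).card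

lemma lg_mono (hl : WLen len) : Monotone (lg len) := by
  intro i j h
  unfold lg
  have h1 : (0:ℝ) < (Bl len (8 ^ i)).card := by exact_mod_cast hl.card_pos _
  have h2 : (Bl len (8 ^ i)).card ≤ (Bl len (8 ^ j)).card :=
    Finset.card_le_card (Bl_mono (Nat.pow_le_pow_right (by norm_num) h))
  exact Real.logb_le_logb_of_le (by norm_num) h1 (by exact_mod_cast h2)

lemma lg_nonneg (hl : WLen len) (i : ℕ) : 0 ≤ lg len i := by
  unfold lg
  apply Real.logb_nonneg (by norm_num)
  exact_mod_cast hl.card_pos _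

lemma lg_le (hl : WLen len) (H : ℕ) (hH : Fintype.card G ≤ 8 ^ H) (i : ℕ) : lg len i ≤ H := by
  unfold lg
  have h1 : (0:ℝ) < (Bl len (8 ^ i)).card := by exact_mod_cast hl.card_pos _
  rw [Real.logb_le_iff_le_rpow (by norm_num) h1, Real.rpow_natCast]
  exact_mod_cast (Finset.card_le_univ _).trans hH

lemma card_of_lg (hl : WLen len) (i j c : ℕ) (h : lg len j - lg len i ≤ c) :
    ((Bl len (8 ^ j)).card : ℝ) ≤ (8:ℝ) ^ c * (Bl len (8 ^ i)).card := by
  unfold lg at h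
  have h1 : (0:ℝ) < (Bl len (8 ^ i)).card := by exact_mod_cast hl.card_pos _
  have h2 : (0:ℝ) < (Bl len (8 ^ j)).card := by exact_mod_cast hl.card_pos _
  rw [← Real.logb_div h2.ne' h1.ne', Real.logb_le_iff_le_rpow (by norm_num) (by positivity),
    Real.rpow_natCast, div_le_iff₀ h1] at h
  exact h

lemma pg_exists (F : ℕ → ℝ) (H c : ℝ) (s m : ℕ) (hs : 0 < s) (hF : Monotone F) (h0 : ∀ i, 0 ≤ F i)
    (hH : ∀ i, F i ≤ H) (h : H < m * c) : ∃ i < m, F (i + s) - F i ≤ s * c := by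
  by_contra hcon
  push Not at hcon
  have := pg F H c s m hs hF h0 hH
  rw [Finset.filter_true_of_mem (fun i hi => hcon i (Finset.mem_range.1 hi)), Finset.card_range] at this
  linarith

theorem EF (d p : ℕ) (hp : 8 * d + 2 ≤ p) (hl : WLen len) (hy : ∃ y, 8 ^ (4 * p) ≤ len y)
    (hn : Fintype.card G ≤ 8 ^ (4 * d * p)) :
    ∃ r, 0 < r ∧ ((Bl (rl r len) 3).card : ℝ) ≤ (8:ℝ) ^ (4 * d + 1) * (Bl (rl r len) 1).card ∧
      ∃ γ f, f ∈ Wsp (rl r len) γ ∧ f ≠ 0 ∧ 0 < γ ∧ γ * 8 ^ p ≤ 1 := by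
  obtain ⟨y, hy⟩ := hy
  obtain ⟨i, hi, hi2⟩ := pg_exists (lg len) (4 * d * p : ℕ) (4 * d + 1) 1 p one_pos (lg_mono hl)
    (lg_nonneg hl) (lg_le hl _ hn) (by push_cast; have : (0:ℝ) < p := by norm_cast; omega
                                       nlinarith)
  obtain ⟨k, hk, hk2⟩ := pg_exists (fun k => lg len (2 * p + k)) (4 * d * p : ℕ) (4 * d + 1) 2 p two_pos
    (fun a b h => lg_mono hl (by omega))
    (fun _ => lg_nonneg hl _) (fun _ => lg_le hl _ hn _) (by
      push_cast; have : (0:ℝ) < p := by norm_cast; omega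
      nlinarith)
  have c1 := card_of_lg hl i (i + 1) (4 * d + 1) (by push_cast at *; linarith)
  have c2 := card_of_lg hl (2 * p + k) (2 * p + k + 2) (2 * (4 * d + 1)) (by
    push_cast at *
    have e : 2 * p + (k + 2) = 2 * p + k + 2 := by ring
    rw [e] at hk2; linarith)
  have hr : 0 < 8 ^ i := by positivity
  refine ⟨8 ^ i, hr, ?_, ?_⟩
  · rw [Bl_rl hr, Bl_rl hr, mul_one]
    refine le_trans ?_ c1
    exact_mod_cast Finset.card_le_card (Bl_mono (by rw [pow_succ]; omega))
  · have e1 : 8 ^ i * 8 ^ (2 * p + k - i) = 8 ^ (2 * p + k) := by rw [← pow_add]; congr 1; omega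
    obtain ⟨γ, f, h1, h2, h3, h4⟩ := eig_exists (hl.rescale hr) (8 ^ (2 * p + k - i)) (Nat.one_le_pow _ _ (by norm_num))
      y (by
        by_contra hcon
        have h5 : rl (8 ^ i) len y ≤ 16 * 8 ^ (2 * p + k - i) := by omega
        rw [rl_le hr] at h5
        have h6 : 8 ^ i * (16 * 8 ^ (2 * p + k - i)) = 16 * 8 ^ (2 * p + k) := by rw [← e1]; ring
        have h7 : 8 ^ (2 * p + k + 2) ≤ 8 ^ (4 * p) := Nat.pow_le_pow_right (by norm_num) (by omega)
        have h8 : 0 < 8 ^ (2 * p + k) := by positivity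
        rw [pow_add] at h7
        omega) ((8:ℝ) ^ (2 * (4 * d + 1))) (by
        rw [Bl_rl hr, Bl_rl hr, e1]
        have : 8 ^ i * (64 * 8 ^ (2 * p + k - i)) = 8 ^ (2 * p + k + 2) := by
          rw [pow_add, ← e1]; ring
        rw [this]
        exact c2)
    refine ⟨γ, f, h1, h2, h3, ?_⟩
    push_cast at h4
    rw [le_div_iff₀ (by positivity), ← pow_mul] at h4
    have h9 : (8:ℝ) ^ (2 * (4 * d + 1)) * 8 ^ p ≤ 8 ^ ((2 * p + k - i) * 2) := by
      rw [← pow_add]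
      exact pow_le_pow_right₀ (by norm_num) (by omega)
    have h10 : (0:ℝ) < 8 ^ ((2 * p + k - i) * 2) := by positivity
    have h11 : (0:ℝ) < 8 ^ p := by positivity
    have : γ * 8 ^ p * 8 ^ ((2 * p + k - i) * 2) ≤ 1 * 8 ^ ((2 * p + k - i) * 2) := by nlinarith
    exact le_of_mul_le_mul_right this h10

end DR

namespace DR
set_option linter.unusedSectionVars false
open Matrix

lemma posDef_of_qf {ι : Type*} [Fintype ι] {A : Matrix ι ι ℝ} (hA : A.IsHermitian)
    (h : ∀ c, c ≠ 0 → 0 < qf A c) : A.PosDef :=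
  Matrix.PosDef.of_dotProduct_mulVec_pos hA (fun {x} hx => by simpa [qf] using h x hx)

lemma sumsq_pos {ι : Type*} [Fintype ι] {c : ι → ℝ} (hc : c ≠ 0) : 0 < ∑ i, c i ^ 2 := by
  obtain ⟨j, hj⟩ : ∃ j, c j ≠ 0 := by
    by_contra hz; push Not at hz; exact hc (funext hz)
  exact Finset.sum_pos' (fun i _ => sq_nonneg _) ⟨j, Finset.mem_univ _, by positivity⟩

lemma qf_smul_one {ι : Type*} [Fintype ι] [DecidableEq ι] (ξ : ℝ) (c : ι → ℝ) :
    qf (diagonal (fun _ : ι => ξ)) c = ξ * ∑ i, c i ^ 2 := by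
  rw [qf_diag, Finset.mul_sum]

lemma det_chain {ι α : Type*} [Fintype ι] [DecidableEq ι] (A : ℕ → Matrix ι ι ℝ) (m N : ℕ)
    (ξ κ : ℝ) (hξ : 0 < ξ) (hκ : 0 < κ) (hκ1 : κ ≤ 1)
    (hherm : ∀ i, (A i).IsHermitian)
    (h0 : ∀ c, ξ * ∑ i, c i ^ 2 ≤ qf (A 0) c) (hmono : ∀ i c, qf (A i) c ≤ qf (A (i+1)) c)
    (h1 : ∀ c, qf (A m) c ≤ ∑ i, c i ^ 2) (T : Finset ℕ) (hT : T ⊆ Finset.range m)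
    (hgood : ∀ i ∈ T, ∃ (Y : Finset α) (ℓ : (ι → ℝ) →ₗ[ℝ] (Y → ℝ)), Y.card ≤ N ∧
      ∀ c, ℓ c = 0 → qf (A i) c ≤ κ * qf (A (i+1)) c) :
    ξ ^ Fintype.card ι ≤ κ ^ ((Fintype.card ι - N) * T.card) := by
  have hge : ∀ i c, ξ * ∑ j, c j ^ 2 ≤ qf (A i) c := by
    intro i c
    induction i with
    | zero => exact h0 c
    | succ i ih => exact ih.trans (hmono i c)
  have hpd : ∀ i, (A i).PosDef := fun i => posDef_of_qf (hherm i) fun c hc => by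
    have := hge i c; have := sumsq_pos hc
    have : 0 < ξ * ∑ j, c j ^ 2 := by positivity
    linarith [hge i c]
  have hxi : (diagonal (fun _ : ι => ξ)).PosDef := posDef_of_qf (by
      simp [IsHermitian, Matrix.diagonal_conjTranspose]) fun c hc => by
    rw [qf_smul_one]; have := sumsq_pos hc; positivity
  have hone : (1 : Matrix ι ι ℝ).PosDef := Matrix.PosDef.one
  have hstart : ξ ^ Fintype.card ι ≤ (A 0).det := by
    have := det_mono _ _ hxi (hpd 0) (fun c => by rw [qf_smul_one]; exact h0 c)
    simpa [det_diagonal] using this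
  have hend : (A m).det ≤ 1 := by
    have := det_mono _ _ (hpd m) hone (fun c => by rw [qf_one]; exact h1 c)
    simpa using this
  have hind : ∀ j, ξ ^ Fintype.card ι ≤
      κ ^ ((Fintype.card ι - N) * (T.filter (· < j)).card) * (A j).det := by
    intro j
    induction j with
    | zero => simpa using hstart
    | succ j ih =>
      by_cases hj : j ∈ T
      · have hc : (T.filter (· < j + 1)).card = (T.filter (· < j)).card + 1 := by
          rw [← Finset.card_insert_of_notMem (a := j) (by simp)]
          congr 1
          ext a; simp only [Finset.mem_filter, Finset.mem_insert]
          constructor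
          · rintro ⟨h1, h2⟩
            rcases Nat.lt_succ_iff_lt_or_eq.1 h2 with h | h
            · exact Or.inr ⟨h1, h⟩
            · exact Or.inl h
          · rintro (rfl | ⟨h1, h2⟩)
            · exact ⟨hj, by omega⟩
            · exact ⟨h1, by omega⟩
        obtain ⟨Y, ℓ, hY, hℓ⟩ := hgood j hj
        have := det_drop (A j) (A (j+1)) (hpd _) (hpd _) (hmono j) ℓ κ hκ hκ1 N (by simpa using hY) hℓ
        rw [hc, mul_add, mul_one, pow_add, mul_assoc]
        exact ih.trans (by gcongr)
      · have hc : T.filter (· < j + 1) = T.filter (· < j) := by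
          ext a; simp only [Finset.mem_filter]
          constructor
          · rintro ⟨h1, h2⟩
            refine ⟨h1, ?_⟩
            rcases Nat.lt_succ_iff_lt_or_eq.1 h2 with h | h
            · exact h
            · exact absurd (h ▸ h1) hj
          · rintro ⟨h1, h2⟩
            exact ⟨h1, by omega⟩
        rw [hc]
        have := det_mono (A j) (A (j+1)) (hpd _) (hpd _) (hmono j)
        exact ih.trans (by gcongr)
  have hfin := hind m
  have : T.filter (· < m) = T := Finset.filter_true_of_mem fun i hi => Finset.mem_range.1 (hT hi)
  rw [this] at hfin
  refine hfin.trans ?_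
  have h3 : 0 ≤ κ ^ ((Fintype.card ι - N) * T.card) := by positivity
  nlinarith

variable {G : Type*} [Group G] [Fintype G] {len : G → ℕ}

/-- Gram matrix -/
noncomputable def Gm {ι : Type*} (len : G → ℕ) (u : ι → G → ℝ) (t : ℕ) : Matrix ι ι ℝ :=
  fun i j => ∑ x ∈ Bl len t, u i x * u j x

/-- linear combination -/
noncomputable def cb {ι : Type*} [Fintype ι] (u : ι → G → ℝ) (c : ι → ℝ) : G → ℝ := fun x => ∑ i, c i * u i x

lemma Gm_herm {ι : Type*} (u : ι → G → ℝ) (t : ℕ) : (Gm len u t).IsHermitian := by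
  ext i j
  simp only [Matrix.conjTranspose_apply, Gm, star_trivial]
  exact Finset.sum_congr rfl fun x _ => mul_comm _ _

lemma qf_Gm {ι : Type*} [Fintype ι] (u : ι → G → ℝ) (t : ℕ) (c : ι → ℝ) :
    qf (Gm len u t) c = Qm len t (cb u c) := by
  simp only [qf, dotProduct, mulVec, Gm, Qm, cb]
  simp only [Finset.sum_mul, Finset.mul_sum, pow_two]
  rw [Finset.sum_comm]
  conv_lhs => enter [2, i]; rw [Finset.sum_comm]
  rw [Finset.sum_comm]
  refine Finset.sum_congr rfl fun x _ => ?_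
  rw [Finset.sum_comm]
  refine Finset.sum_congr rfl fun i _ => Finset.sum_congr rfl fun j _ => by ring

lemma cb_mem {ι : Type*} [Fintype ι] {γ : ℝ} {u : ι → G → ℝ} (hu : ∀ i, u i ∈ Wsp len γ) (c : ι → ℝ) :
    cb u c ∈ Wsp len γ := by
  have : cb u c = ∑ i, c i • u i := by ext x; simp [cb]
  rw [this]
  exact Submodule.sum_mem _ fun i _ => Submodule.smul_mem _ _ (hu i)

/-- functional of averages -/
noncomputable def avl {ι : Type*} [Fintype ι] (len : G → ℕ) (u : ι → G → ℝ) (Y : Finset G) (τ : ℕ) :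
    (ι → ℝ) →ₗ[ℝ] (Y → ℝ) where
  toFun c y := ∑ x ∈ Bt len y τ, cb u c x
  map_add' c c' := by
    ext y; simp [cb, add_mul, Finset.sum_add_distrib]
  map_smul' a c := by
    ext y; simp [cb, Finset.mul_sum, mul_assoc]

/-- orthonormal family -/
def ON {ι : Type*} [Fintype ι] (u : ι → G → ℝ) : Prop := ∀ c, nm (cb u c) = ∑ i, c i ^ 2

lemma rank_bound (hl : WLen len) {γ : ℝ} (hγ : 0 ≤ γ) (i0 m a κ0 k1 : ℕ) (T : Finset ℕ) (hT : T ⊆ Finset.range m)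
    (hK : ((Bl len 3).card : ℝ) ≤ 8 ^ k1 * (Bl len 1).card)
    (ha : 1 ≤ a) (hi0 : a ≤ i0) (hγm : 2 * γ * 64 ^ (i0 + m) ≤ 1)
    (hgood : ∀ i ∈ T, ((Bl len (8 ^ (i0 + i - a + 1))).card : ℝ) ≤ 8 ^ κ0 * (Bl len (8 ^ (i0 + i - a))).card ∧
      ((Bl len (8 ^ (i0 + i + 1))).card : ℝ) ≤ 8 ^ (κ0 * (a + 1)) * (Bl len (8 ^ (i0 + i - a))).card)
    (hak : 3 + k1 + 2 * κ0 ≤ a)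
    {ι : Type*} [Fintype ι] (hι : Fintype.card ι = 2 * 8 ^ (κ0 * (a + 1)))
    (u : ι → G → ℝ) (hu : ∀ i, u i ∈ Wsp len γ) (hon : ON u) (ξ : ℝ) (hξ : 0 < ξ)
    (h0 : ∀ c, ξ * ∑ i, c i ^ 2 ≤ Qm len (8 ^ i0) (cb u c)) :
    ξ ^ 2 ≤ (1 / 8 ^ a) ^ T.card := by
  classical
  set N := 8 ^ (κ0 * (a + 1)) with hN
  have key := det_chain (α := G) (fun i => Gm len u (8 ^ (i0 + i))) m N ξ (1 / 8 ^ a) hξ (by positivity)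
    (by rw [div_le_one (by positivity)]; exact one_le_pow₀ (by norm_num)) (fun i => Gm_herm _ _)
    (fun c => by simpa [qf_Gm] using h0 c)
    (fun i c => by
      rw [qf_Gm, qf_Gm]; exact Qm_mono (Nat.pow_le_pow_right (by norm_num) (by omega)) _)
    (fun c => by rw [qf_Gm, ← hon]; exact Qm_le_nm _ _) T hT (by
      intro i hi
      have him := Finset.mem_range.1 (hT hi)
      obtain ⟨g1, g2⟩ := hgood i hi
      have e8 : 8 * 8 ^ (i0 + i - a) = 8 ^ (i0 + i - a + 1) := by rw [pow_succ]; ring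
      have e8' : 8 * 8 ^ (i0 + i) = 8 ^ (i0 + i + 1) := by rw [pow_succ]; ring
      obtain ⟨Y, hY, hYf⟩ := good_scale hl hγ (8 ^ (i0 + i)) (8 ^ (i0 + i - a)) (8 ^ k1) (8 ^ κ0) N
        (by rw [e8]; exact Nat.pow_le_pow_right (by norm_num) (by omega))
        (by
          have : 8 ^ 1 ≤ 8 ^ (i0 + i) := Nat.pow_le_pow_right (by norm_num) (by omega)
          omega) hK (by rw [e8]; exact g1) (by rw [e8']; rw [hN]; exact_mod_cast g2) (by
          push_cast
          rw [← pow_mul, mul_comm (i0 + i) 2, pow_mul]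
          norm_num
          refine le_trans ?_ hγm
          have : (64:ℝ) ^ (i0 + i) ≤ 64 ^ (i0 + m) := pow_le_pow_right₀ (by norm_num) (by omega)
          gcongr)
      refine ⟨Y, avl len u Y (2 * 8 ^ (i0 + i - a)), hY, ?_⟩
      intro c hc
      simp only [qf_Gm]
      have h := hYf (cb u c) (cb_mem hu c) (fun y hy => congrFun hc ⟨y, hy⟩)
      rw [e8'] at h
      push_cast at h
      have hQ := Qm_nonneg (len := len) (8 ^ (i0 + i + 1)) (cb u c)
      have eS : (8:ℝ) ^ (i0 + i) = 8 ^ a * 8 ^ (i0 + i - a) := by rw [← pow_add]; congr 1; omega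
      set σ : ℝ := (8:ℝ) ^ (i0 + i - a) with hσ
      have hσ0 : 0 < σ := by positivity
      rw [eS] at h
      have h320 : (320:ℝ) * 8 ^ k1 * (8 ^ κ0) ^ 2 ≤ 8 ^ a := by
        calc (320:ℝ) * 8 ^ k1 * (8 ^ κ0) ^ 2 ≤ 8 ^ 3 * 8 ^ k1 * (8 ^ κ0) ^ 2 := by gcongr; norm_num
          _ = 8 ^ (3 + k1 + 2 * κ0) := by rw [← pow_mul, ← pow_add, ← pow_add]; congr 1; ring
          _ ≤ 8 ^ a := pow_le_pow_right₀ (by norm_num) hak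
      have ha0 : (0:ℝ) < 8 ^ a := by positivity
      have h2 : (8 ^ a * σ) ^ 2 * Qm len (8 ^ (i0 + i)) (cb u c) ≤ 8 ^ a * σ ^ 2 * Qm len (8 ^ (i0 + i + 1)) (cb u c) :=
        h.trans (by gcongr)
      have h3 : (8 ^ a * σ ^ 2) * (8 ^ a * Qm len (8 ^ (i0 + i)) (cb u c)) ≤ (8 ^ a * σ ^ 2) * Qm len (8 ^ (i0 + i + 1)) (cb u c) := by
        linarith
      have h4 := le_of_mul_le_mul_left h3 (by positivity)
      have : i0 + (i + 1) = i0 + i + 1 := by ring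
      rw [this, one_div, ← div_eq_inv_mul, le_div_iff₀ ha0]
      linarith)
  rw [hι] at key
  have e : (2 * N - N) * T.card = T.card * N := by rw [mul_comm]; congr 1; omega
  rw [e, pow_mul, pow_mul] at key
  exact le_of_pow_le_pow_left₀ (by positivity) (by positivity) key

end DR

namespace DR
set_option linter.unusedSectionVars false
open Matrix

variable {G : Type*} [Group G] [Fintype G] {len : G → ℕ}

lemma onb_exists (W : Submodule ℝ (G → ℝ)) : ∃ (k : ℕ) (u : Fin k → G → ℝ), k ≤ Fintype.card G ∧
    (∀ i, u i ∈ W) ∧ ON u ∧ ∀ f ∈ W, ∃ c, f = cb u c := by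
  classical
  let e : (EuclideanSpace ℝ G) ≃ₗ[ℝ] (G → ℝ) := WithLp.linearEquiv 2 ℝ (G → ℝ)
  let W' : Submodule ℝ (EuclideanSpace ℝ G) := W.comap e.toLinearMap
  let b := stdOrthonormalBasis ℝ W'
  refine ⟨Module.finrank ℝ W', fun i => e (b i), ?_, fun i => (b i).2, ?_, ?_⟩
  · have := Submodule.finrank_le W'
    simpa using this
  · intro c
    have h1 : cb (fun i => e (b i)) c = e ((∑ i, c i • b i : W') : EuclideanSpace ℝ G) := by
      ext x
      simp [cb, map_sum]
    have h2 : ∀ v : EuclideanSpace ℝ G, nm (e v) = ‖v‖ ^ 2 := by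
      intro v
      rw [EuclideanSpace.norm_sq_eq]
      simp [nm, e]
    rw [h1, h2]
    have h3 : ‖((∑ i, c i • b i : W') : EuclideanSpace ℝ G)‖ = ‖(∑ i, c i • b i : W')‖ := rfl
    rw [h3]
    have h4 := b.orthonormal.sum_inner_products_le (x := (∑ i, c i • b i : W')) (s := Finset.univ)
    have h5 : ‖(∑ i, c i • b i : W')‖ ^ 2 = ∑ i, c i * c i := by
      rw [← real_inner_self_eq_norm_sq, b.orthonormal.inner_sum]
      simp
    rw [h5]
    exact Finset.sum_congr rfl fun i _ => by ring
  · intro f hf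
    let v : W' := ⟨e.symm f, by simpa [W'] using hf⟩
    refine ⟨fun i => b.repr v i, ?_⟩
    have h := b.sum_repr v
    have h1 : cb (fun i => e (b i)) (fun i => b.repr v i) = e ((∑ i, b.repr v i • b i : W') : EuclideanSpace ℝ G) := by
      ext x
      simp [cb, map_sum]
    rw [h1, h]
    simp [v]

lemma cb_mulVec {ι κ : Type*} [Fintype ι] [Fintype κ] (u : ι → G → ℝ) (V : Matrix ι κ ℝ) (c : κ → ℝ) :
    cb (fun j => cb u (fun i => V i j)) c = cb u (V *ᵥ c) := by
  ext x
  simp only [cb, mulVec, dotProduct, Finset.sum_mul, Finset.mul_sum]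
  rw [Finset.sum_comm]
  exact Finset.sum_congr rfl fun i _ => Finset.sum_congr rfl fun j _ => by ring

/-- orthonormal basis of the eigenspace diagonalising `Qm len t` -/
lemma diag_exists (len : G → ℕ) (γ : ℝ) (t : ℕ) : ∃ (k : ℕ) (u : Fin k → G → ℝ) (μ : Fin k → ℝ), k ≤ Fintype.card G ∧
    (∀ i, u i ∈ Wsp len γ) ∧ ON u ∧ (∀ f ∈ Wsp len γ, ∃ c, f = cb u c) ∧
    ∀ c, Qm len t (cb u c) = ∑ i, μ i * c i ^ 2 := by
  classical
  obtain ⟨k, u, hk, hu, hon, hsp⟩ := onb_exists (Wsp len γ)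
  obtain ⟨V, μ, h1, h2, h3⟩ := spec (Gm len u t) (Gm_herm u t)
  refine ⟨k, fun j => cb u (fun i => V i j), μ, hk, fun i => cb_mem hu _, ?_, ?_, ?_⟩
  · intro c
    rw [cb_mulVec, hon]
    have := qf_congr 1 V c
    rw [Matrix.mul_one, h1, qf_one, qf_one] at this
    exact this.symm
  · intro f hf
    obtain ⟨c, rfl⟩ := hsp f hf
    refine ⟨Vᵀ *ᵥ c, ?_⟩
    rw [cb_mulVec, mulVec_mulVec, h2, one_mulVec]
  · intro c
    rw [cb_mulVec, ← qf_Gm, h3, ← qf_congr]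
    have : Vᵀ * (V * diagonal μ * Vᵀ) * V = diagonal μ := by
      calc _ = (Vᵀ * V) * diagonal μ * (Vᵀ * V) := by simp only [Matrix.mul_assoc]
        _ = _ := by rw [h1]; simp
    rw [this, qf_diag]

/-- few large eigenvalues -/
def FewBig (len : G → ℕ) (γ ξ : ℝ) (t M : ℕ) : Prop :=
  ∀ (k : ℕ) (u : Fin k → G → ℝ) (μ : Fin k → ℝ), (∀ i, u i ∈ Wsp len γ) → ON u →
    (∀ c, Qm len t (cb u c) = ∑ i, μ i * c i ^ 2) → (Finset.univ.filter fun i => ξ < μ i).card ≤ M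

lemma fewBig_mono {γ ξ : ℝ} {s t M : ℕ} (hst : s ≤ t)
    (H : ∀ (u : Fin M → G → ℝ), (∀ i, u i ∈ Wsp len γ) → ON u →
      ¬ ∀ c, ξ * ∑ i, c i ^ 2 ≤ Qm len t (cb u c)) : FewBig len γ ξ s M := by
  classical
  intro k u μ hu hon hd
  by_contra hcon
  push Not at hcon
  obtain ⟨S, hS, hcard⟩ := Finset.exists_subset_card_eq hcon.le
  let e : Fin M ≃ S := (Fintype.equivFinOfCardEq (by simpa using hcard)).symm
  have hext : ∀ c : Fin M → ℝ, cb (fun j => u (e j)) c =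
      cb u (fun i => if h : i ∈ S then c (e.symm ⟨i, h⟩) else 0) := by
    intro c
    ext x
    simp only [cb]
    rw [← Finset.sum_subset (Finset.subset_univ S) (fun i _ hi => by simp [hi])]
    rw [← Finset.sum_coe_sort S]
    rw [← e.sum_comp]
    exact Finset.sum_congr rfl fun i _ => by simp
  have hsum : ∀ (c : Fin M → ℝ) (w : Fin k → ℝ),
      ∑ i, w i * (if h : i ∈ S then c (e.symm ⟨i, h⟩) else 0) ^ 2 = ∑ j, w (e j) * c j ^ 2 := by
    intro c w
    rw [← Finset.sum_subset (Finset.subset_univ S) (fun i _ hi => by simp [hi])]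
    rw [← Finset.sum_coe_sort S]
    rw [← e.sum_comp]
    exact Finset.sum_congr rfl fun i _ => by simp
  refine H (fun j => u (e j)) (fun j => hu _) ?_ ?_
  · intro c
    rw [hext, hon]
    simpa using hsum c (fun _ => 1)
  · intro c
    refine le_trans ?_ (Qm_mono hst _)
    rw [hext, hd, hsum, Finset.mul_sum]
    refine Finset.sum_le_sum fun j _ => ?_
    have := (Finset.mem_filter.1 (hS (e j).2)).2
    have h2 := sq_nonneg (c j)
    nlinarith

/-- doubling of the quadratic form at some scale -/
lemma form_doubling (hl : WLen len) {γ ξ η : ℝ} (M j0 Q : ℕ) (hη : 0 < η) (hη1 : η ≤ 1) (hξ : 0 ≤ ξ)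
    (hfew : ∀ j ≤ j0 + Q, FewBig len γ ξ (8 ^ j) M) (hkξ : Fintype.card G * ξ ≤ η)
    (c : ℝ) (hc : M * Real.log (2 / η) + 1 < Q * c) :
    ∃ j, j0 ≤ j ∧ j < j0 + Q ∧ ∀ f ∈ Wsp len γ,
      Qm len (8 * 8 ^ j) f + η * nm f ≤ Real.exp c * (Qm len (8 ^ j) f + η * nm f) := by
  classical
  obtain ⟨k, u, hk, hu, hon, hsp⟩ := onb_exists (Wsp len γ)
  let A : ℕ → Matrix (Fin k) (Fin k) ℝ := fun j => Gm len u (8 ^ j) + Matrix.diagonal (fun _ => η)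
  have hA : ∀ j c, qf (A j) c = Qm len (8 ^ j) (cb u c) + η * nm (cb u c) := by
    intro j c
    have : qf (A j) c = qf (Gm len u (8 ^ j)) c + qf (Matrix.diagonal (fun _ => η)) c := by
      simp [A, qf, add_mulVec]
    rw [this, qf_Gm, qf_smul_one, hon]
  have hherm : ∀ j, (A j).IsHermitian := fun j =>
    (Gm_herm u _).add (by simp [IsHermitian, Matrix.diagonal_conjTranspose])
  have hpd : ∀ j, (A j).PosDef := fun j => posDef_of_qf (hherm j) fun c hc => by
    rw [hA, hon]
    have := sumsq_pos hc
    have := Qm_nonneg (len := len) (8 ^ j) (cb u c)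
    positivity
  have hxi : (Matrix.diagonal (fun _ : Fin k => η)).PosDef := posDef_of_qf (by
      simp [IsHermitian, Matrix.diagonal_conjTranspose]) fun c hc => by
    rw [qf_smul_one]; have := sumsq_pos hc; positivity
  have hlow : ∀ j, η ^ k ≤ (A j).det := by
    intro j
    have := det_mono _ _ hxi (hpd j) (fun c => by
      rw [qf_smul_one, hA, hon]; linarith [Qm_nonneg (len := len) (8 ^ j) (cb u c)])
    simpa [det_diagonal] using this
  have hup : ∀ j ≤ j0 + Q, (A j).det ≤ η ^ k * ((2 / η) ^ M * Real.exp 1) := by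
    intro j hj
    obtain ⟨V, μ, h1, h2, h3⟩ := spec (Gm len u (8 ^ j)) (Gm_herm u _)
    have hdiag : ∀ c, Qm len (8 ^ j) (cb (fun j => cb u (fun i => V i j)) c) = ∑ i, μ i * c i ^ 2 := by
      intro c
      rw [cb_mulVec, ← qf_Gm, h3, ← qf_congr]
      have : Vᵀ * (V * diagonal μ * Vᵀ) * V = diagonal μ := by
        calc _ = (Vᵀ * V) * diagonal μ * (Vᵀ * V) := by simp only [Matrix.mul_assoc]
          _ = _ := by rw [h1]; simp
      rw [this, qf_diag]
    have hon' : ON (fun j => cb u (fun i => V i j)) := by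
      intro c
      rw [cb_mulVec, hon]
      have := qf_congr 1 V c
      rw [Matrix.mul_one, h1, qf_one, qf_one] at this
      exact this.symm
    have hcard := hfew j hj k _ μ (fun i => cb_mem hu _) hon' hdiag
    have hdet : (A j).det = ∏ i, (μ i + η) := by
      have : A j = V * Matrix.diagonal (fun i => μ i + η) * Vᵀ := by
        have e1 : Matrix.diagonal (fun i => μ i + η) = diagonal μ + Matrix.diagonal (fun _ => η) := by
          simp
        have e2 : (Matrix.diagonal (fun _ : Fin k => η)) = η • (1 : Matrix (Fin k) (Fin k) ℝ) := by
          ext i j; simp [Matrix.one_apply, diagonal_apply]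
        simp only [A]
        rw [e1, Matrix.mul_add, Matrix.add_mul, ← h3, e2]
        congr 1
        rw [Matrix.mul_smul, Matrix.smul_mul, Matrix.mul_one, h2]
      rw [this, det_mul, det_mul, mul_right_comm, ← det_mul, h2, det_one, one_mul, det_diagonal]
    have hμ : ∀ i, 0 ≤ μ i ∧ μ i ≤ 1 := by
      intro i
      have h4 := hdiag (Pi.single i 1)
      have h5 := hon' (Pi.single i 1)
      have e1 : ∀ w : Fin k → ℝ, ∑ j, w j * (Pi.single i (1:ℝ) : Fin k → ℝ) j ^ 2 = w i := by
        intro w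
        rw [Finset.sum_eq_single i]
        · simp
        · intro b _ hb; simp [hb]
        · simp
      rw [e1] at h4
      have e2 := e1 (fun _ => 1)
      simp only [one_mul] at e2
      rw [e2] at h5
      rw [← h4]
      refine ⟨Qm_nonneg _ _, (Qm_le_nm _ _).trans h5.le⟩
    rw [hdet]
    have hfac : ∀ i, μ i + η ≤ η * ((if ξ < μ i then 2 / η else 1) * Real.exp (ξ / η)) := by
      intro i
      have he : 1 + ξ / η ≤ Real.exp (ξ / η) := by linarith [Real.add_one_le_exp (ξ / η)]
      have he0 : 0 ≤ ξ / η := by positivity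
      split_ifs with h
      · have : η * (2 / η * Real.exp (ξ / η)) = 2 * Real.exp (ξ / η) := by field_simp
        rw [this]
        linarith [(hμ i).2]
      · have e3 : η * (ξ / η) = ξ := by field_simp
        have : η * (1 + ξ / η) ≤ η * Real.exp (ξ / η) := by gcongr
        push Not at h
        rw [one_mul]; linarith
    calc ∏ i, (μ i + η) ≤ ∏ i : Fin k, (η * ((if ξ < μ i then 2 / η else 1) * Real.exp (ξ / η))) :=
          Finset.prod_le_prod (fun i _ => by linarith [(hμ i).1]) (fun i _ => hfac i)
      _ = η ^ k * ((2 / η) ^ (Finset.univ.filter fun i => ξ < μ i).card * Real.exp (ξ / η) ^ k) := by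
          rw [Finset.prod_mul_distrib, Finset.prod_mul_distrib, Finset.prod_ite]
          simp [div_pow]
      _ ≤ _ := by
          have h2η : 1 ≤ 2 / η := by rw [le_div_iff₀ hη]; linarith
          gcongr
          · rw [← Real.exp_nat_mul]
            refine Real.exp_le_exp.2 ?_
            rw [← mul_div_assoc, div_le_one hη]
            refine le_trans ?_ hkξ
            gcongr
  have hmono : ∀ i j, i ≤ j → (A i).det ≤ (A j).det := fun i j hij =>
    det_mono _ _ (hpd i) (hpd j) fun c => by
      rw [hA, hA]; gcongr; exact Qm_mono (Nat.pow_le_pow_right (by norm_num) hij) _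
  have hηk : 0 < η ^ k := by positivity
  let F : ℕ → ℝ := fun i => Real.log ((A (min (j0 + i) (j0 + Q))).det / η ^ k)
  have hF0 : ∀ i, 0 ≤ F i := fun i => Real.log_nonneg (by rw [le_div_iff₀ hηk, one_mul]; exact hlow _)
  have hFm : Monotone F := by
    intro a b hab
    refine Real.log_le_log (div_pos (hpd _).det_pos hηk) ?_
    gcongr
    exact hmono _ _ (by omega)
  have hFH : ∀ i, F i ≤ M * Real.log (2 / η) + 1 := by
    intro i
    have h := hup (min (j0 + i) (j0 + Q)) (by omega)
    have h' : (A (min (j0 + i) (j0 + Q))).det / η ^ k ≤ (2 / η) ^ M * Real.exp 1 := by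
      rw [div_le_iff₀ hηk]; linarith
    refine (Real.log_le_log (div_pos (hpd _).det_pos hηk) h').trans ?_
    rw [Real.log_mul (by positivity) (by positivity), Real.log_pow, Real.log_exp]
  obtain ⟨i, hi, hic⟩ := pg_exists F (M * Real.log (2 / η) + 1) c 1 Q one_pos hFm hF0 hFH hc
  refine ⟨j0 + i, by omega, by omega, ?_⟩
  intro f hf
  obtain ⟨e, rfl⟩ := hsp f hf
  have e1 : min (j0 + i) (j0 + Q) = j0 + i := by omega
  have e2 : min (j0 + (i + 1)) (j0 + Q) = j0 + i + 1 := by omega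
  simp only [F, e1, e2, Nat.cast_one, one_mul] at hic
  rw [Real.log_div (hpd _).det_pos.ne' hηk.ne', Real.log_div (hpd _).det_pos.ne' hηk.ne'] at hic
  have hdet : (A (j0 + i + 1)).det ≤ Real.exp c * (A (j0 + i)).det := by
    have h3 : Real.log (A (j0 + i + 1)).det ≤ c + Real.log (A (j0 + i)).det := by linarith
    have := Real.exp_le_exp.2 h3
    rwa [Real.exp_add, Real.exp_log (hpd _).det_pos, Real.exp_log (hpd _).det_pos] at this
  have := qf_le_of_det (A (j0 + i + 1)) (A (j0 + i)) (hpd _) (hpd _) (fun c => by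
    rw [hA, hA]; gcongr; exact Qm_mono (Nat.pow_le_pow_right (by norm_num) (by omega)) _) _ hdet e
  rw [hA, hA, pow_succ'] at this
  exact this

end DR

namespace DR
set_option linter.unusedSectionVars false
open Matrix

variable {G : Type*} [Group G] [Fintype G] {len : G → ℕ}

lemma Qm_tr_le (hl : WLen len) (x : G) (s t T : ℕ) (hx : len x ≤ s) (hT : s + t ≤ T) (f : G → ℝ) :
    Qm len t (tr x f) ≤ Qm len T f := by
  classical
  have : Qm len t (tr x f) = ∑ w ∈ (Bl len t).image (fun w => x * w), f w ^ 2 := by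
    rw [Finset.sum_image (fun a _ b _ h => mul_left_cancel h)]; rfl
  rw [this]
  refine Finset.sum_le_sum_of_subset_of_nonneg ?_ fun _ _ _ => sq_nonneg _
  intro w hw
  obtain ⟨v, hv, rfl⟩ := Finset.mem_image.1 hw
  rw [mem_Bl] at hv ⊢
  have := hl.mul x v
  omega

lemma Qm_add_le (t : ℕ) (f g : G → ℝ) : Qm len t (f + g) ≤ 2 * Qm len t f + 2 * Qm len t g := by
  simp only [Qm, Finset.mul_sum, ← Finset.sum_add_distrib]
  refine Finset.sum_le_sum fun x _ => ?_
  simp only [Pi.add_apply]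
  nlinarith [sq_nonneg (f x - g x)]

lemma Qm_sub_le (t : ℕ) (f g : G → ℝ) : Qm len t (f - g) ≤ 2 * Qm len t f + 2 * Qm len t g := by
  simp only [Qm, Finset.mul_sum, ← Finset.sum_add_distrib]
  refine Finset.sum_le_sum fun x _ => ?_
  simp only [Pi.sub_apply]
  nlinarith [sq_nonneg (f x + g x)]

lemma nm_sub_le (f g : G → ℝ) : nm (f - g) ≤ 2 * nm f + 2 * nm g := by
  simp only [nm, Finset.mul_sum, ← Finset.sum_add_distrib]
  refine Finset.sum_le_sum fun x _ => ?_
  simp only [Pi.sub_apply]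
  nlinarith [sq_nonneg (f x + g x)]

/-- doubling of the form at scale `ρ` -/
def Dbl (len : G → ℕ) (γ η C : ℝ) (ρ : ℕ) : Prop := ∀ f ∈ Wsp len γ,
  Qm len (8 * ρ) f + η * nm f ≤ C * (Qm len ρ f + η * nm f)

lemma pigeon (hl : WLen len) {γ ξ η C δ : ℝ} {ρ M s : ℕ} (hC : 1 ≤ C) (hη : 0 < η) (hξ : 0 ≤ ξ)
    (hδ : 0 < δ) (hM : 1 ≤ M) (hξδ : ξ ≤ δ ^ 2 * η) (hs : C * M ^ 2 ≤ δ ^ 2 * s ^ 2)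
    (hD : Dbl len γ η C ρ) (hfew : FewBig len γ ξ (2 * ρ) M)
    (g : ℕ → G) (hg : ∀ i ≤ (2 * s + 1) ^ (M * M), len (g i) ≤ ρ) :
    ∃ i j, i < j ∧ j ≤ (2 * s + 1) ^ (M * M) ∧ ∀ f ∈ Wsp len γ,
      Qm len ρ (tr ((g i)⁻¹ * g j) f - f) ≤ 20 * C ^ 2 * δ ^ 2 * (Qm len ρ f + η * nm f) := by
  classical
  obtain ⟨k, u, μ, hk, hu, hon, hsp, hdiag⟩ := diag_exists len γ (2 * ρ)
  have hcard := hfew k u μ hu hon hdiag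
  set I := Finset.univ.filter fun i => ξ < μ i with hI
  have hM0 : (0:ℝ) < M := by exact_mod_cast hM
  have esing : ∀ (a : Fin k) (w : Fin k → ℝ), ∑ j, w j * (Pi.single a (1:ℝ) : Fin k → ℝ) j ^ 2 = w a := by
    intro a w
    rw [Finset.sum_eq_single a]
    · simp
    · intro b _ hb; simp [hb]
    · simp
  have hcbs : ∀ a, cb u (Pi.single a 1) = u a := by
    intro a; ext x; simp only [cb]
    rw [Finset.sum_eq_single a]
    · simp
    · intro b _ hb; simp [hb]
    · simp
  have hQu : ∀ a, Qm len (2 * ρ) (u a) = μ a := fun a => by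
    rw [← hcbs a, hdiag, esing]
  have hnu : ∀ a, nm (u a) = 1 := fun a => by
    rw [← hcbs a, hon]
    have := esing a (fun _ => 1)
    simpa using this
  have hμ0 : ∀ a, 0 ≤ μ a := fun a => by rw [← hQu]; exact Qm_nonneg _ _
  have hX : ∀ (x : G) (a : Fin k), ∃ c, tr x (u a) = cb u c := fun x a => hsp _ (tr_mem (hu a) x)
  choose X hX using hX
  have htr : ∀ x c, tr x (cb u c) = cb u (fun b => ∑ a, c a * X x a b) := by
    intro x c
    ext w
    have h1 : ∀ a, u a (x * w) = cb u (X x a) w := fun a => congrFun (hX x a) w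
    simp only [tr, cb] at h1 ⊢
    simp only [h1, Finset.mul_sum, Finset.sum_mul]
    rw [Finset.sum_comm]
    exact Finset.sum_congr rfl fun i _ => Finset.sum_congr rfl fun j _ => by ring
  have hμη : ∀ a, 0 < μ a + η := fun a => by linarith [hμ0 a]
  have hXb : ∀ x, len x ≤ ρ → ∀ a b, μ b * X x a b ^ 2 ≤ C * (μ a + η) := by
    intro x hx a b
    calc μ b * X x a b ^ 2 ≤ ∑ b, μ b * X x a b ^ 2 :=
          Finset.single_le_sum (f := fun b => μ b * X x a b ^ 2)
            (fun b _ => mul_nonneg (hμ0 b) (sq_nonneg _)) (Finset.mem_univ b)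
      _ = Qm len (2 * ρ) (tr x (u a)) := by rw [hX, hdiag]
      _ ≤ Qm len (8 * ρ) (u a) := Qm_tr_le hl x ρ _ _ hx (by omega) _
      _ ≤ Qm len (8 * ρ) (u a) + η * nm (u a) := by rw [hnu]; linarith
      _ ≤ C * (Qm len ρ (u a) + η * nm (u a)) := hD _ (hu a)
      _ ≤ C * (μ a + η) := by
          rw [hnu, mul_one, ← hQu a]; gcongr; exact Qm_mono (by omega) _
  let q : G → Fin k → Fin k → ℝ := fun x a b => Real.sqrt (μ b) * X x a b / Real.sqrt (μ a + η) * (M / δ)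
  have hq2 : ∀ x, len x ≤ ρ → ∀ a b, |q x a b| ≤ s := by
    intro x hx a b
    refine abs_le_of_sq_le_sq ?_ (by positivity)
    have h1 : q x a b ^ 2 = (μ b * X x a b ^ 2) / (μ a + η) * (M ^ 2 / δ ^ 2) := by
      simp only [q, mul_pow, div_pow]
      rw [Real.sq_sqrt (hμ0 b), Real.sq_sqrt (hμη a).le]
    rw [h1]
    have h2 : (μ b * X x a b ^ 2) / (μ a + η) ≤ C := by
      rw [div_le_iff₀ (hμη a)]; exact hXb x hx a b
    calc _ ≤ C * (M ^ 2 / δ ^ 2) := by gcongr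
      _ ≤ s ^ 2 := by rw [← mul_div_assoc, div_le_iff₀ (by positivity)]; linarith
  let P : Finset (I × I → ℤ) := Fintype.piFinset fun _ => Finset.Icc (-(s:ℤ)) s
  have hPc : P.card ≤ (2 * s + 1) ^ (M * M) := by
    simp only [P, Fintype.card_piFinset, Int.card_Icc, Finset.prod_const, Finset.card_univ,
      Fintype.card_prod, Fintype.card_coe]
    have : ((s:ℤ) + 1 - -(s:ℤ)).toNat = 2 * s + 1 := by omega
    rw [this]
    exact Nat.pow_le_pow_right (by omega) (Nat.mul_le_mul hcard hcard)
  let cl : ℕ → (I × I → ℤ) := fun i ab => ⌊q (g i) ab.1 ab.2⌋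
  have hmaps : ∀ i ∈ Finset.range ((2 * s + 1) ^ (M * M) + 1), cl i ∈ P := by
    intro i hi
    rw [Finset.mem_range, Nat.lt_succ_iff] at hi
    simp only [P, Fintype.mem_piFinset, Finset.mem_Icc, cl]
    intro ab
    have := abs_le.1 (hq2 _ (hg i hi) ab.1 ab.2)
    constructor
    · rw [Int.le_floor]; push_cast; exact this.1
    · have h1 := Int.floor_le (q (g i) ab.1 ab.2)
      have : ((⌊q (g i) ab.1 ab.2⌋ : ℤ) : ℝ) ≤ (s : ℤ) := by push_cast; linarith [this.2]
      exact_mod_cast this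
  obtain ⟨i, hi, j, hj, hij, heq⟩ := Finset.exists_ne_map_eq_of_card_lt_of_maps_to
    (by rw [Finset.card_range]; omega) hmaps
  have key : ∀ i j, i < (2 * s + 1) ^ (M * M) + 1 → j < (2 * s + 1) ^ (M * M) + 1 → cl i = cl j →
      ∀ f ∈ Wsp len γ,
      Qm len ρ (tr ((g i)⁻¹ * g j) f - f) ≤ 20 * C ^ 2 * δ ^ 2 * (Qm len ρ f + η * nm f) := by
    intro i j hi hj heq
    set x := g i
    set y := g j
    have hx : len x ≤ ρ := hg i (by omega)
    have hy : len y ≤ ρ := hg j (by omega)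
    have hdiff : ∀ a ∈ I, ∀ b ∈ I, μ b * (X x a b - X y a b) ^ 2 ≤ (δ / M) ^ 2 * (μ a + η) := by
      intro a ha b hb
      have h1 : ⌊q x a b⌋ = ⌊q y a b⌋ := congrFun heq (⟨a, ha⟩, ⟨b, hb⟩)
      have h2 : |q x a b - q y a b| < 1 := Int.abs_sub_lt_one_of_floor_eq_floor h1
      have h3 : q x a b - q y a b = Real.sqrt (μ b) * (X x a b - X y a b) / Real.sqrt (μ a + η) * (M / δ) := by
        simp only [q]; ring
      have h4 : (q x a b - q y a b) ^ 2 ≤ 1 := by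
        rw [← sq_abs]; have := abs_nonneg (q x a b - q y a b); nlinarith
      rw [h3] at h4
      simp only [mul_pow, div_pow] at h4
      rw [Real.sq_sqrt (hμ0 b), Real.sq_sqrt (hμη a).le, div_mul_div_comm, div_le_one (by have := hμη a; positivity)] at h4
      rw [div_pow, div_mul_eq_mul_div, le_div_iff₀ (by positivity)]
      linarith
    have hclose : ∀ f ∈ Wsp len γ, Qm len ρ (tr x f - tr y f) ≤
        20 * δ ^ 2 * (Qm len (2 * ρ) f + η * nm f) := by
      intro f hf
      obtain ⟨c, rfl⟩ := hsp f hf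
      set f := cb u c with hfdef
      let c1 : Fin k → ℝ := fun a => if a ∈ I then c a else 0
      let c2 : Fin k → ℝ := fun a => if a ∈ I then 0 else c a
      have hsplit : f = cb u c1 + cb u c2 := by
        ext w; simp only [hfdef, cb, Pi.add_apply, c1, c2, ← Finset.sum_add_distrib]
        refine Finset.sum_congr rfl fun a _ => ?_
        split_ifs <;> ring
      have hn : nm f = ∑ a, c a ^ 2 := hon c
      have hn1 : nm (cb u c1) ≤ nm f := by
        rw [hon, hn]; refine Finset.sum_le_sum fun a _ => ?_
        simp only [c1]; split_ifs <;> nlinarith [sq_nonneg (c a)]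
      have hnf : 0 ≤ nm f := nm_nonneg f
      have hc2 : Qm len (2 * ρ) (cb u c2) ≤ ξ * nm f := by
        rw [hdiag, hn, Finset.mul_sum]
        refine Finset.sum_le_sum fun a _ => ?_
        simp only [c2]
        split_ifs with h
        · have := sq_nonneg (c a); simp; positivity
        · have : μ a ≤ ξ := by
            by_contra h'; exact h (by simp [hI]; linarith)
          gcongr
      have hp2 : Qm len ρ (tr x (cb u c2) - tr y (cb u c2)) ≤ 4 * (ξ * nm f) := by
        have h1 := Qm_sub_le (len := len) ρ (tr x (cb u c2)) (tr y (cb u c2))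
        have h2 := Qm_tr_le hl x ρ ρ (2 * ρ) hx (by omega) (cb u c2)
        have h3 := Qm_tr_le hl y ρ ρ (2 * ρ) hy (by omega) (cb u c2)
        linarith
      let e : Fin k → ℝ := fun b => ∑ a, c1 a * (X x a b - X y a b)
      have he : tr x (cb u c1) - tr y (cb u c1) = cb u e := by
        rw [htr, htr]; ext w
        simp only [cb, Pi.sub_apply, e, ← Finset.sum_sub_distrib]
        refine Finset.sum_congr rfl fun b _ => ?_
        rw [← sub_mul, ← Finset.sum_sub_distrib]
        congr 1
        exact Finset.sum_congr rfl fun a _ => by ring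
      have hp1 : Qm len (2 * ρ) (cb u e) ≤ 4 * (ξ * nm f) + δ ^ 2 * (Qm len (2 * ρ) f + η * nm f) := by
        rw [hdiag e, ← Finset.sum_add_sum_compl I, add_comm]
        refine add_le_add ?_ ?_
        · calc ∑ b ∈ Iᶜ, μ b * e b ^ 2 ≤ ∑ b ∈ Iᶜ, ξ * e b ^ 2 := by
                refine Finset.sum_le_sum fun b hb => ?_
                have : μ b ≤ ξ := by
                  by_contra h'; exact (Finset.mem_compl.1 hb) (by simp [hI]; linarith)
                gcongr
            _ ≤ ∑ b, ξ * e b ^ 2 := Finset.sum_le_sum_of_subset_of_nonneg (Finset.subset_univ _)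
                (fun b _ _ => by positivity)
            _ = ξ * nm (tr x (cb u c1) - tr y (cb u c1)) := by rw [he, hon, Finset.mul_sum]
            _ ≤ ξ * (4 * nm f) := by
                gcongr
                have h1 := nm_sub_le (tr x (cb u c1)) (tr y (cb u c1))
                rw [nm_tr, nm_tr] at h1
                linarith
            _ = _ := by ring
        · have hb : ∀ b ∈ I, μ b * e b ^ 2 ≤ (δ ^ 2 / M) * (Qm len (2 * ρ) f + η * nm f) := by
            intro b hb
            have e1 : e b = ∑ a ∈ I, c a * (X x a b - X y a b) := by
              simp only [e, c1]
              rw [← Finset.sum_subset (Finset.subset_univ I) (fun i _ hi => by simp [hi])]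
              exact Finset.sum_congr rfl fun a ha => by simp [ha]
            have e2 : e b ^ 2 ≤ M * ∑ a ∈ I, (c a * (X x a b - X y a b)) ^ 2 := by
              rw [e1]
              refine (sq_sum_le_card_mul_sum_sq (s := I) (f := fun a => c a * (X x a b - X y a b))).trans ?_
              gcongr
            calc μ b * e b ^ 2 ≤ μ b * (M * ∑ a ∈ I, (c a * (X x a b - X y a b)) ^ 2) := by
                  have := hμ0 b; gcongr
              _ = M * ∑ a ∈ I, c a ^ 2 * (μ b * (X x a b - X y a b) ^ 2) := by
                  rw [mul_left_comm, Finset.mul_sum]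
                  congr 1
                  exact Finset.sum_congr rfl fun a _ => by ring
              _ ≤ M * ∑ a ∈ I, c a ^ 2 * ((δ / M) ^ 2 * (μ a + η)) := by
                  refine mul_le_mul_of_nonneg_left (Finset.sum_le_sum fun a ha => ?_) hM0.le
                  exact mul_le_mul_of_nonneg_left (hdiff a ha b hb) (sq_nonneg _)
              _ ≤ M * ∑ a, c a ^ 2 * ((δ / M) ^ 2 * (μ a + η)) := by
                  refine mul_le_mul_of_nonneg_left ?_ hM0.le
                  refine Finset.sum_le_sum_of_subset_of_nonneg (Finset.subset_univ _) fun a _ _ => ?_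
                  have := (hμη a).le
                  positivity
              _ = _ := by
                  rw [hdiag c, hn, Finset.mul_sum, Finset.mul_sum (a := η), ← Finset.sum_add_distrib, Finset.mul_sum]
                  refine Finset.sum_congr rfl fun a _ => ?_
                  field_simp
          have hpos : 0 ≤ (δ ^ 2 / M) * (Qm len (2 * ρ) f + η * nm f) := by
            have := Qm_nonneg (len := len) (2 * ρ) f
            positivity
          calc ∑ b ∈ I, μ b * e b ^ 2 ≤ I.card • ((δ ^ 2 / M) * (Qm len (2 * ρ) f + η * nm f)) :=
                Finset.sum_le_card_nsmul _ _ _ hb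
            _ ≤ M * ((δ ^ 2 / M) * (Qm len (2 * ρ) f + η * nm f)) := by
                rw [nsmul_eq_mul]; gcongr
            _ = _ := by field_simp
      have hsum : tr x f - tr y f = cb u e + (tr x (cb u c2) - tr y (cb u c2)) := by
        rw [← he]
        conv_lhs => rw [hsplit]
        ext w; simp only [tr, Pi.add_apply, Pi.sub_apply]; ring
      rw [hsum]
      have h1 := Qm_add_le (len := len) ρ (cb u e) (tr x (cb u c2) - tr y (cb u c2))
      have h2 := Qm_mono (len := len) (show ρ ≤ 2 * ρ by omega) (cb u e)
      have h3 : ξ * nm f ≤ δ ^ 2 * (η * nm f) := by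
        rw [← mul_assoc]; gcongr
      have h4 : 0 ≤ δ ^ 2 * Qm len (2 * ρ) f := mul_nonneg (by positivity) (Qm_nonneg _ _)
      have h5 : 0 ≤ δ ^ 2 * (η * nm f) := by positivity
      linarith
    intro f hf
    have h1 := hclose (tr x⁻¹ f) (tr_mem hf _)
    have e1 : tr x (tr x⁻¹ f) = f := by ext w; simp [tr]
    have e2 : tr y (tr x⁻¹ f) = tr (x⁻¹ * y) f := by ext w; simp [tr, mul_assoc]
    have e3 : Qm len ρ (tr (x⁻¹ * y) f - f) = Qm len ρ (f - tr (x⁻¹ * y) f) := by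
      simp only [Qm, Pi.sub_apply]; exact Finset.sum_congr rfl fun w _ => by ring
    rw [e1, e2, nm_tr] at h1
    rw [e3]
    refine h1.trans ?_
    have h2 := Qm_tr_le hl x⁻¹ ρ (2 * ρ) (8 * ρ) (by rw [hl.inv]; exact hx) (by omega) f
    have h3 := hD f hf
    have h4 : 0 ≤ Qm len ρ f + η * nm f :=
      add_nonneg (Qm_nonneg _ _) (mul_nonneg hη.le (nm_nonneg _))
    calc 20 * δ ^ 2 * (Qm len (2 * ρ) (tr x⁻¹ f) + η * nm f)
        ≤ 20 * δ ^ 2 * (C * (Qm len ρ f + η * nm f)) := by gcongr; linarith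
      _ ≤ 20 * δ ^ 2 * (C ^ 2 * (Qm len ρ f + η * nm f)) := by
          gcongr; nlinarith
      _ = _ := by ring
  rw [Finset.mem_range] at hi hj
  rcases lt_or_gt_of_ne hij with h | h
  · exact ⟨i, j, h, by omega, key i j hi hj heq⟩
  · exact ⟨j, i, h, by omega, key j i hj hi heq.symm⟩

end DR

namespace DR
set_option linter.unusedSectionVars false

variable {G : Type*} [Group G] [Fintype G] {len : G → ℕ}

/-- coset covering -/
lemma coset_cover (hl : WLen len) (J : ℕ) (S : Set G)
    (hS : ∀ g : ℕ → G, (∀ i ≤ J, len (g i) ≤ i) → ∃ i j, i < j ∧ j ≤ J ∧ (g i)⁻¹ * g j ∈ S) (x : G) :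
    ∃ y, len y ≤ J ∧ y⁻¹ * x ∈ Subgroup.closure (S ∩ {h | len h ≤ 2 * J}) := by
  suffices H : ∀ ℓ x, len x = ℓ → ∃ y, len y ≤ J ∧ y⁻¹ * x ∈ Subgroup.closure (S ∩ {h | len h ≤ 2 * J}) from
    H _ x rfl
  intro ℓ
  induction ℓ using Nat.strong_induction_on with
  | _ ℓ ih =>
    intro x hx
    by_cases hJ : ℓ ≤ J
    · exact ⟨x, by omega, by simp⟩
    push Not at hJ
    have h1 : ∀ i, ∃ s, i ≤ J → len s ≤ i ∧ len (x * s⁻¹) ≤ ℓ - i := by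
      intro i
      by_cases hi : i ≤ J
      · obtain ⟨a, b, hab, ha, hb⟩ := hl.split (ℓ - i) i x (by omega)
        refine ⟨b, fun _ => ⟨hb, ?_⟩⟩
        rw [hab]; simpa using ha
      · exact ⟨1, fun h => absurd h hi⟩
    choose s hs using h1
    obtain ⟨i, j, hij, hj, hm⟩ := hS s (fun i hi => (hs i hi).1)
    have hlen : len (x * (s j)⁻¹ * s i) < ℓ := by
      have := hl.mul (x * (s j)⁻¹) (s i)
      have := (hs j hj).2
      have := (hs i (by omega)).1
      omega
    obtain ⟨y, hy, hyc⟩ := ih _ hlen _ rfl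
    refine ⟨y, hy, ?_⟩
    have hU : (s i)⁻¹ * s j ∈ Subgroup.closure (S ∩ {h | len h ≤ 2 * J}) := by
      refine Subgroup.subset_closure ⟨hm, ?_⟩
      have := hl.mul (s i)⁻¹ (s j)
      rw [hl.inv] at this
      have := (hs j hj).1
      have := (hs i (by omega)).1
      simp only [mem_ofPred_eq]; omega
    have := Subgroup.mul_mem _ hyc hU
    simpa [mul_assoc] using this

/-- `z` is `(α,β)`-small -/
def Sm (len : G → ℕ) (γ : ℝ) (ρ : ℕ) (α β : ℝ) (z : G) : Prop := ∀ f ∈ Wsp len γ,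
  Qm len ρ (tr z f - f) ≤ α * Qm len ρ f + β * nm f

lemma Sm_comm (hl : WLen len) {γ η C α β ε : ℝ} {ρ : ℕ} (hD : Dbl len γ η C ρ) (hC : 1 ≤ C) (hη : 0 ≤ η)
    (hα0 : 0 ≤ α) (hα : α ≤ 1) (hβ : 0 ≤ β) (hε0 : 0 ≤ ε) (hε : ε ≤ 1) {z u : G}
    (hz : Sm len γ ρ α β z) (hu : Sm len γ ρ ε (ε * η) u) (hlen : len z + len u ≤ 7 * ρ) :
    Sm len γ ρ (4 * C * ε * α) (10 * β + 14 * C * η) (z⁻¹ * u⁻¹ * z * u) := by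
  intro f hf
  set F := tr (z⁻¹ * u⁻¹) f with hF
  have hFW : F ∈ Wsp len γ := tr_mem hf _
  have hFn : nm F = nm f := nm_tr _ _
  have hn := nm_nonneg f
  have hz' : tr z F - F ∈ Wsp len γ := Submodule.sub_mem _ (tr_mem hFW _) hFW
  have hu' : tr u F - F ∈ Wsp len γ := Submodule.sub_mem _ (tr_mem hFW _) hFW
  have heq : tr (z⁻¹ * u⁻¹ * z * u) f - f =
      (tr u (tr z F - F) - (tr z F - F)) - (tr z (tr u F - F) - (tr u F - F)) := by
    ext w
    simp only [tr, hF, Pi.sub_apply]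
    have e1 : z⁻¹ * u⁻¹ * (z * (u * w)) = z⁻¹ * u⁻¹ * z * u * w := by group
    have e2 : z⁻¹ * u⁻¹ * (u * (z * w)) = w := by group
    rw [e1, e2]; ring
  have hQF : Qm len ρ F + η * nm f ≤ C * (Qm len ρ f + η * nm f) := by
    refine le_trans ?_ (hD f hf)
    have := Qm_tr_le hl (z⁻¹ * u⁻¹) (7 * ρ) ρ (8 * ρ) (by
      have := hl.mul z⁻¹ u⁻¹; rw [hl.inv, hl.inv] at this; omega) (by omega) f
    linarith
  have h1 := hu _ hz'
  have h2 := hz _ hu'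
  have h3 := hz _ hFW
  have h4 := hu _ hFW
  have n1 : nm (tr z F - F) ≤ 4 * nm f := by
    have := nm_sub_le (tr z F) F; rw [nm_tr] at this; linarith
  have n2 : nm (tr u F - F) ≤ 4 * nm f := by
    have := nm_sub_le (tr u F) F; rw [nm_tr] at this; linarith
  rw [heq]
  have h0 := Qm_sub_le (len := len) ρ (tr u (tr z F - F) - (tr z F - F)) (tr z (tr u F - F) - (tr u F - F))
  rw [hFn] at h3 h4
  have hq := Qm_nonneg (len := len) ρ f
  have hqF := Qm_nonneg (len := len) ρ F
  have b1 : Qm len ρ (tr u (tr z F - F) - (tr z F - F)) ≤ ε * (α * Qm len ρ F + β * nm f) + ε * η * (4 * nm f) :=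
    h1.trans (by gcongr)
  have b2 : Qm len ρ (tr z (tr u F - F) - (tr u F - F)) ≤ α * (ε * Qm len ρ F + ε * η * nm f) + β * (4 * nm f) :=
    h2.trans (by gcongr)
  have b3 : ε * α * Qm len ρ F ≤ ε * α * (C * (Qm len ρ f + η * nm f)) := by
    gcongr; have : 0 ≤ η * nm f := by positivity
    linarith
  have p1 : ε * α ≤ 1 := mul_le_one₀ hε hα0 hα
  have c1 : ε * (β * nm f) ≤ β * nm f := by
    have : 0 ≤ β * nm f := by positivity
    nlinarith
  have hην : 0 ≤ η * nm f := by positivity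
  have c2 : ε * (η * nm f) ≤ η * nm f := by nlinarith
  have c3 : ε * α * (η * nm f) ≤ η * nm f := by nlinarith
  have c4 : ε * α * (C * (η * nm f)) ≤ C * (η * nm f) := by
    have : 0 ≤ C * (η * nm f) := by positivity
    nlinarith
  have c5 : η * nm f ≤ C * (η * nm f) := by nlinarith
  nlinarith

/-- iterated commutators -/
inductive IC (U : Set G) : ℕ → G → Prop
  | base (u : G) : u ∈ U → IC U 0 u
  | step (j : ℕ) (z u : G) : IC U j z → u ∈ U → IC U (j + 1) (z⁻¹ * u⁻¹ * z * u)

lemma IC_small (hl : WLen len) {γ η C ε : ℝ} {ρ J m : ℕ} (hD : Dbl len γ η C ρ) (hC : 1 ≤ C) (hη : 0 ≤ η)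
    (hε0 : 0 ≤ ε) (hε : 4 * C * ε ≤ 1) (hJ : 4 ^ m * (2 * J) ≤ ρ) (U : Set G)
    (hU : ∀ u ∈ U, Sm len γ ρ ε (ε * η) u ∧ len u ≤ 2 * J) (j : ℕ) (hj : j ≤ m) (z : G) (hz : IC U j z) :
    Sm len γ ρ ((4 * C * ε) ^ j) ((24 * C) ^ j * η) z ∧ len z ≤ 4 ^ j * (2 * J) := by
  have hε1 : ε ≤ 1 := by nlinarith
  have h4C : 0 ≤ 4 * C * ε := by positivity
  induction hz with
  | base u hu =>
    refine ⟨?_, by simpa using (hU u hu).2⟩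
    intro f hf
    have := (hU u hu).1 f hf
    have hq := Qm_nonneg (len := len) ρ f
    have hn := nm_nonneg f
    simp only [pow_zero, one_mul]
    have h1 : ε * η * nm f ≤ η * nm f := by
      have : 0 ≤ η * nm f := by positivity
      nlinarith
    nlinarith
  | step j z u hz hu ih =>
    obtain ⟨h1, h2⟩ := ih (by omega)
    obtain ⟨hu1, hu2⟩ := hU u hu
    have hpow : 4 ^ j * (2 * J) ≤ ρ := le_trans (Nat.mul_le_mul_right _ (Nat.pow_le_pow_right (by norm_num) (by omega))) hJ
    have hJJ : 2 * J ≤ 4 ^ j * (2 * J) := Nat.le_mul_of_pos_left _ (by positivity)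
    refine ⟨?_, ?_⟩
    · have h3 := Sm_comm hl hD hC hη (by positivity) (pow_le_one₀ h4C hε) (by positivity) hε0 hε1 h1 hu1 (by omega)
      intro f hf
      refine (h3 f hf).trans ?_
      have hn := nm_nonneg f
      rw [pow_succ' (4 * C * ε), pow_succ' (24 * C)]
      have h5 : 1 ≤ (24 * C) ^ j := one_le_pow₀ (by linarith)
      have h6 : 10 * ((24 * C) ^ j * η) + 14 * C * η ≤ 24 * C * (24 * C) ^ j * η := by
        have a1 : 10 * ((24 * C) ^ j * η) ≤ 10 * C * ((24 * C) ^ j * η) := by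
          have : 0 ≤ (24 * C) ^ j * η := by positivity
          nlinarith
        have a2 : 14 * C * η ≤ 14 * C * ((24 * C) ^ j * η) := by
          have : η ≤ (24 * C) ^ j * η := by nlinarith
          gcongr
        linarith
      have := mul_le_mul_of_nonneg_right h6 hn
      linarith
    · have a1 := hl.mul (z⁻¹ * u⁻¹ * z) u
      have a2 := hl.mul (z⁻¹ * u⁻¹) z
      have a3 := hl.mul z⁻¹ u⁻¹
      rw [hl.inv, hl.inv] at a3
      rw [pow_succ, mul_right_comm]
      omega

/-- the kernel of the action on the eigenspace -/
def Ker (len : G → ℕ) (γ : ℝ) : Subgroup G where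
  carrier := {k | ∀ f ∈ Wsp len γ, ∀ x, f (k * x) = f x}
  mul_mem' := by
    intro a b ha hb f hf x
    rw [mul_assoc, ha f hf, hb f hf]
  one_mem' := by intro f _ x; simp
  inv_mem' := by
    intro a ha f hf x
    have := ha f hf (a⁻¹ * x)
    rw [← this]; simp

lemma mem_Ker {γ : ℝ} {k : G} : k ∈ Ker len γ ↔ ∀ f ∈ Wsp len γ, ∀ x, f (k * x) = f x := Iff.rfl

instance Ker_normal {γ : ℝ} : (Ker len γ).Normal := by
  constructor
  intro k hk g f hf x
  have := hk (tr g f) (tr_mem hf g) (g⁻¹ * x)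
  simpa [tr, mul_assoc] using this

lemma wlen_lt_card (hl : WLen len) (x : G) : len x < Fintype.card G := by
  have h : ∀ t, t ≤ len x → ∃ y, len y = t := by
    intro t ht
    obtain ⟨a, b, hab, ha, hb⟩ := hl.split t (len x - t) x (by omega)
    have := hl.mul a b
    rw [← hab] at this
    exact ⟨a, by omega⟩
  choose! p hp using h
  have : (Finset.range (len x + 1)).card ≤ (Finset.univ : Finset G).card :=
    Finset.card_le_card_of_injOn p (fun _ _ => Finset.mem_coe.2 (Finset.mem_univ _)) (by
      intro a ha b hb hab
      simp only [Finset.coe_range, Set.mem_Iio] at ha hb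
      rw [← hp a (by omega), ← hp b (by omega), hab])
  simpa using this

/-- subadditive functions on a closure -/
lemma subadd_closure (S : Set G) (hinv : ∀ s ∈ S, s⁻¹ ∈ S) (R : G → ℝ → Prop) (θ : ℝ) (hθ : 0 ≤ θ) (h1 : R 1 0)
    (hmono : ∀ g c d, c ≤ d → R g c → R g d)
    (hmul : ∀ a b c d, R a c → R b d → R (a * b) (c + d)) (hS : ∀ s ∈ S, R s θ) :
    ∀ h ∈ Subgroup.closure S, R h (Fintype.card G * θ) := by
  classical
  let H := Subgroup.closure S
  let T : Set H := {x | (x : G) ∈ S ∨ x = 1}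
  obtain ⟨l, hl, hl1, -⟩ := exists_wlen T (Or.inr rfl) (by
      rintro x (hx | hx)
      · left; exact hinv _ hx
      · right; simp [hx]) (by
      rw [eq_top_iff]
      rintro ⟨x, hx⟩ -
      induction hx using Subgroup.closure_induction with
      | mem x hx => exact Subgroup.subset_closure (Or.inl hx)
      | one => exact Subgroup.one_mem _
      | mul x y hx hy h1 h2 => exact Subgroup.mul_mem _ h1 h2
      | inv x hx h1 => exact Subgroup.inv_mem _ h1)
  have key : ∀ t (x : H), l x ≤ t → R x (t * θ) := by
    intro t
    induction t with
    | zero =>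
      intro x hx
      have : x = 1 := hl.eq_one _ (by omega)
      subst this; simpa using h1
    | succ t ih =>
      intro x hx
      obtain ⟨a, b, hab, ha, hb⟩ := hl.split t 1 x hx
      have h2 := ih a ha
      have h3 : R b θ := by
        rcases (hl1 b).1 hb with h | h
        · exact hS _ h
        · subst h; exact hmono _ _ _ hθ h1
      have := hmul a b _ _ h2 h3
      rw [hab]; push_cast
      rwa [add_mul, one_mul]
  intro h hh
  have h2 := key _ ⟨h, hh⟩ le_rfl
  have h3 := wlen_lt_card hl ⟨h, hh⟩
  have h4 : Fintype.card H ≤ Fintype.card G := Fintype.card_subtype_le _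
  refine hmono _ _ _ ?_ h2
  gcongr
  omega

lemma halving (H : ℕ → Subgroup G) (hH : ∀ j, H (j+1) ≤ H j) (ρ : ℕ) (hρ : Fintype.card G < 2 ^ ρ) :
    ∃ j < ρ, H (j+1) = H j := by
  classical
  by_contra hcon
  push Not at hcon
  have key : ∀ j ≤ ρ, 2 ^ j * Nat.card (H j) ≤ Fintype.card G := by
    intro j
    induction j with
    | zero =>
      intro _
      rw [← Nat.card_eq_fintype_card]
      simpa using Subgroup.card_le_card_group (H 0)
    | succ j ih =>
      intro hj
      have h1 := ih (by omega)
      have h2 := Subgroup.card_dvd_of_le (hH j)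
      obtain ⟨c, hc⟩ := h2
      have hpos : 0 < Nat.card (H j) := Nat.card_pos
      have hc2 : 2 ≤ c := by
        by_contra h
        have hc1 : c = 0 ∨ c = 1 := by omega
        rcases hc1 with rfl | rfl
        · omega
        · exact hcon j (by omega) (Subgroup.eq_of_le_of_card_ge (hH j) (by omega))
      calc 2 ^ (j+1) * Nat.card (H (j+1)) = 2 ^ j * (Nat.card (H (j+1)) * 2) := by ring
        _ ≤ 2 ^ j * (Nat.card (H (j+1)) * c) := by gcongr
        _ = 2 ^ j * Nat.card (H j) := by rw [hc]
        _ ≤ _ := h1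
  have h1 := key ρ le_rfl
  have h2 : 0 < Nat.card (H ρ) := Nat.card_pos
  have : 2 ^ ρ ≤ 2 ^ ρ * Nat.card (H ρ) := Nat.le_mul_of_pos_right _ h2
  omega

lemma nss (hl : WLen len) {γ : ℝ} {ρ : ℕ} (hn : 2 ≤ Fintype.card G) (hρ : Fintype.card G < 2 ^ ρ) (z : G)
    (hz : ∀ f ∈ Wsp len γ, ∀ x, len x ≤ ρ → |f (z * x) - f x| ≤ 1 / (Fintype.card G : ℝ) ^ 2 * √(nm f)) :
    z ∈ Ker len γ := by
  classical
  set n := Fintype.card G with hnn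
  have hn0 : (0:ℝ) < n := by positivity
  set θ : ℝ := 1 / (n : ℝ) ^ 2 with hθ
  have hθ0 : 0 ≤ θ := by positivity
  let Z : ℕ → Set G := fun j => {z | ∀ f ∈ Wsp len γ, ∀ x, len x ≤ j → |f (z * x) - f x| ≤ θ * √(nm f)}
  have hZ1 : ∀ j, Z (j+1) ⊆ Z j := fun j z hz f hf x hx => hz f hf x (by omega)
  have hZinv : ∀ j, ∀ s ∈ Z j, s⁻¹ ∈ Z j := by
    intro j s hs f hf x hx
    have := hs (tr s⁻¹ f) (tr_mem hf _) x hx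
    rw [nm_tr] at this
    simp only [tr, inv_mul_cancel_left] at this
    rwa [abs_sub_comm]
  have hZconj : ∀ j, ∀ s, len s ≤ 1 → ∀ w ∈ Z (j+1), s⁻¹ * w * s ∈ Z j := by
    intro j s hs w hw f hf x hx
    have := hw (tr s⁻¹ f) (tr_mem hf _) (s * x) (by have := hl.mul s x; omega)
    rw [nm_tr] at this
    simpa [tr, mul_assoc] using this
  obtain ⟨j, hj, hHj⟩ := halving (fun j => Subgroup.closure (Z j)) (fun j => Subgroup.closure_mono (hZ1 j)) ρ hρ
  set H := Subgroup.closure (Z j) with hH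
  have hconj1 : ∀ s, len s ≤ 1 → ∀ h ∈ H, s⁻¹ * h * s ∈ H := by
    intro s hs h hh
    rw [← hHj] at hh
    induction hh using Subgroup.closure_induction with
    | mem x hx => exact Subgroup.subset_closure (hZconj j s hs x hx)
    | one => simp
    | mul x y _ _ h1 h2 =>
      have := H.mul_mem h1 h2
      simpa [mul_assoc] using this
    | inv x _ h1 =>
      have := H.inv_mem h1
      simpa [mul_assoc] using this
  have hconj : ∀ t g, len g ≤ t → ∀ h ∈ H, g⁻¹ * h * g ∈ H := by
    intro t
    induction t with
    | zero =>
      intro g hg h hh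
      rw [hl.eq_one g (by omega)]; simpa
    | succ t ih =>
      intro g hg h hh
      obtain ⟨y, s, rfl, hy, hs⟩ := hl.geo g t hg
      have := hconj1 s hs _ (ih y hy h hh)
      simpa [mul_assoc] using this
  have hbound1 : ∀ h ∈ H, ∀ f ∈ Wsp len γ, |f h - f 1| ≤ 1 / n * √(nm f) := by
    intro h hh f hf
    have := subadd_closure (Z j) (hZinv j) (fun g c => ∀ f ∈ Wsp len γ, |f g - f 1| ≤ c * √(nm f)) θ hθ0
      (by intro f _; simp)
      (fun g c d hcd h f hf => (h f hf).trans (by gcongr))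
      (fun a b c d h1 h2 f hf => by
        have e1 := h1 f hf
        have e2 := h2 (tr a f) (tr_mem hf _)
        rw [nm_tr] at e2
        simp only [tr, mul_one] at e2
        have := abs_sub_le (f (a * b)) (f a) (f 1)
        linarith)
      (fun s hs f hf => by simpa using hs f hf 1 (by simp [hl.one])) h hh f hf
    have e : n * θ = 1 / n := by rw [hθ]; field_simp
    rwa [e] at this
  have hbound : ∀ h ∈ H, ∀ f ∈ Wsp len γ, ∀ x, |f (h * x) - f x| ≤ 1 / n * √(nm f) := by
    intro h hh f hf x
    have := hbound1 _ (hconj (len x) x le_rfl h hh) (tr x f) (tr_mem hf _)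
    rw [nm_tr] at this
    simpa [tr, mul_assoc] using this
  have hinv : ∀ h ∈ H, ∀ f ∈ Wsp len γ, ∀ x, f (h * x) = f x := by
    intro h0 hh0 f hf
    have hc : (0:ℝ) < Fintype.card H := by exact_mod_cast Fintype.card_pos
    let fb : G → ℝ := (1 / (Fintype.card H : ℝ)) • ∑ h : H, tr (h : G) f
    have hfbval : ∀ x, fb x = 1 / (Fintype.card H : ℝ) * ∑ h : H, f (h * x) := by
      intro x; simp [fb, tr]
    have hfb : fb ∈ Wsp len γ :=
      Submodule.smul_mem _ _ (Submodule.sum_mem _ fun h _ => tr_mem hf _)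
    have hfbinv : ∀ h ∈ H, ∀ x, fb (h * x) = fb x := by
      intro h hh x
      rw [hfbval, hfbval]
      congr 1
      rw [← Equiv.sum_comp (Equiv.mulRight (⟨h, hh⟩ : H)) (fun k : H => f ((k : G) * x))]
      exact Finset.sum_congr rfl fun k _ => by simp [mul_assoc]
    set g := f - fb with hg
    have hgW : g ∈ Wsp len γ := Submodule.sub_mem _ hf hfb
    have hgs : ∀ x, ∑ h : H, g (h * x) = 0 := by
      intro x
      simp only [hg, Pi.sub_apply, Finset.sum_sub_distrib]
      rw [Finset.sum_congr rfl (fun (h : H) _ => hfbinv h h.2 x), hfbval]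
      simp
    have hgx : ∀ x, g x ^ 2 ≤ nm g / n ^ 2 := by
      intro x
      have h1 : |∑ h : H, (g (h * x) - g x)| ≤ ∑ h : H, 1 / n * √(nm g) :=
        (Finset.abs_sum_le_sum_abs _ _).trans (Finset.sum_le_sum fun h _ => hbound h h.2 g hgW x)
      rw [Finset.sum_sub_distrib, hgs, zero_sub, abs_neg] at h1
      simp only [Finset.sum_const, Finset.card_univ, nsmul_eq_mul, abs_mul, Nat.abs_cast] at h1
      have h2 := le_of_mul_le_mul_left h1 hc
      have h3 := pow_le_pow_left₀ (abs_nonneg _) h2 2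
      rw [sq_abs, mul_pow, Real.sq_sqrt (nm_nonneg g)] at h3
      refine h3.trans (le_of_eq (by field_simp))
    have hg0 : nm g = 0 := by
      have h1 : nm g ≤ ∑ x : G, nm g / n ^ 2 := Finset.sum_le_sum fun x _ => hgx x
      simp only [Finset.sum_const, Finset.card_univ, nsmul_eq_mul, ← hnn] at h1
      have h2 : (n:ℝ) * (nm g / n ^ 2) = nm g / n := by field_simp
      rw [h2, le_div_iff₀ hn0] at h1
      have h3 : (2:ℝ) ≤ n := by exact_mod_cast hn
      have h4 := nm_nonneg g
      nlinarith
    have hgz : ∀ x, g x = 0 := by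
      intro x
      have := (Finset.sum_eq_zero_iff_of_nonneg (fun x _ => sq_nonneg (g x))).1 hg0 x (Finset.mem_univ _)
      simpa using this
    intro x
    have a1 := hgz x
    have a2 := hgz (h0 * x)
    simp only [hg, Pi.sub_apply] at a1 a2
    rw [hfbinv h0 hh0] at a2
    linarith
  refine fun f hf x => hinv z ?_ f hf x
  exact Subgroup.subset_closure fun f hf x hx => hz f hf x (by omega)

end DR

namespace DR
set_option linter.unusedSectionVars false

lemma ucs_top {N : Type*} [Group N] (U : Set N) (hU : Subgroup.closure U = ⊤) (m : ℕ)
    (h : ∀ z, IC U m z → z = 1) : Subgroup.upperCentralSeries N m = ⊤ := by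
  have key : ∀ i ≤ m, ∀ z, IC U (m - i) z → z ∈ Subgroup.upperCentralSeries N i := by
    intro i
    induction i with
    | zero => intro _ z hz; rw [h z hz]; exact Subgroup.one_mem _
    | succ i ih =>
      intro hi z hz
      rw [Subgroup.mem_upperCentralSeries_succ_iff]
      let mk := QuotientGroup.mk' (Subgroup.upperCentralSeries N i)
      have h1 : Subgroup.closure U ≤ (Subgroup.centralizer {mk z}).comap mk := by
        rw [Subgroup.closure_le]
        intro u hu
        simp only [SetLike.mem_coe, Subgroup.mem_comap, Subgroup.mem_centralizer_singleton_iff]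
        have h2 := ih (by omega) _ (by
          have := IC.step _ z u hz hu
          rwa [show m - (i+1) + 1 = m - i by omega] at this)
        have h3 : mk (z⁻¹ * u⁻¹ * z * u) = 1 := (QuotientGroup.eq_one_iff _).2 h2
        simp only [map_mul, map_inv] at h3
        have h4 : mk z * mk u = mk u * mk z := by
          calc mk z * mk u = mk u * mk z * ((mk z)⁻¹ * (mk u)⁻¹ * mk z * mk u) := by group
            _ = _ := by rw [h3, mul_one]
        exact h4.symm
      intro y
      have h2 := h1 (hU ▸ Subgroup.mem_top y : y ∈ Subgroup.closure U)
      simp only [Subgroup.mem_comap, Subgroup.mem_centralizer_singleton_iff] at h2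
      refine (QuotientGroup.eq_one_iff _).1 ?_
      change mk (z * y * z⁻¹ * y⁻¹) = 1
      simp only [map_mul, map_inv]
      rw [← h2]; group
  rw [eq_top_iff, ← hU, Subgroup.closure_le]
  intro u hu
  exact key m le_rfl u (by rw [Nat.sub_self]; exact IC.base u hu)

lemma lcs_bot {N : Type*} [Group N] (U : Set N) (hU : Subgroup.closure U = ⊤) (m : ℕ)
    (h : ∀ z, IC U m z → z = 1) : (⊤ : Subgroup N).lowerCentralSeries m = ⊥ := by
  rw [Subgroup.lowerCentralSeries_eq_bot_iff_upperCentralSeries_eq_top]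
  exact ucs_top U hU m h

/-- small generating sets -/
lemma small_gen {N : Type*} [Group N] [Fintype N] (U : Set N) :
    ∃ T : Finset N, (T : Set N) ⊆ U ∧ U ⊆ Subgroup.closure (T : Set N) ∧ 2 ^ T.card ≤ Fintype.card N := by
  classical
  have h0 : ∃ k, ∃ T : Finset N, (T : Set N) ⊆ U ∧ T.card = k ∧ 2 ^ T.card ≤ Nat.card (Subgroup.closure (T : Set N)) :=
    ⟨0, ∅, by simp, rfl, by simp⟩
  have hb : ∀ T : Finset N, T.card ≤ Fintype.card N := fun T => Finset.card_le_univ T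
  obtain ⟨T, hT, hTc⟩ : ∃ T : Finset N, ((T : Set N) ⊆ U ∧ 2 ^ T.card ≤ Nat.card (Subgroup.closure (T : Set N))) ∧
      ∀ T' : Finset N, ((T' : Set N) ⊆ U ∧ 2 ^ T'.card ≤ Nat.card (Subgroup.closure (T' : Set N))) → T'.card ≤ T.card := by
    have hne : ((Finset.univ : Finset (Finset N)).filter fun T : Finset N => (T : Set N) ⊆ U ∧
      2 ^ T.card ≤ Nat.card (Subgroup.closure (T : Set N))).Nonempty := ⟨∅, by simp⟩
    obtain ⟨T, hT, hm⟩ := Finset.exists_max_image _ Finset.card hne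
    refine ⟨T, (Finset.mem_filter.1 hT).2, fun T' hT' => hm T' (by simpa using hT')⟩
  refine ⟨T, hT.1, ?_, hT.2.trans (by rw [← Nat.card_eq_fintype_card]; exact Subgroup.card_le_card_group _)⟩
  intro u hu
  by_contra hcon
  have hnT : u ∉ T := fun h => hcon (Subgroup.subset_closure h)
  have h1 := hTc (insert u T) ⟨by
    rw [Finset.coe_insert]; exact Set.insert_subset hu hT.1, by
    rw [Finset.card_insert_of_notMem hnT]
    have hle : Subgroup.closure (T : Set N) ≤ Subgroup.closure ((insert u T : Finset N) : Set N) :=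
      Subgroup.closure_mono (by simp)
    obtain ⟨c, hc⟩ := Subgroup.card_dvd_of_le hle
    have hpos : 0 < Nat.card (Subgroup.closure ((insert u T : Finset N) : Set N)) := Nat.card_pos
    have hc2 : 2 ≤ c := by
      by_contra h
      have hc1 : c = 0 ∨ c = 1 := by omega
      rcases hc1 with rfl | rfl
      · omega
      · have := Subgroup.eq_of_le_of_card_ge hle (by omega)
        apply hcon
        rw [this]
        exact Subgroup.subset_closure (by simp)
    rw [hc, pow_succ]
    exact Nat.mul_le_mul hT.2 hc2⟩
  rw [Finset.card_insert_of_notMem hnT] at h1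
  omega

section nil
variable {N : Type*} [Group N]

local notation "LCS" => Subgroup.lowerCentralSeries (⊤ : Subgroup N)

instance lcsn (i : ℕ) : (LCS i).Normal := inferInstance

lemma comm_mem_lcs (i : ℕ) (a g : N) (ha : a ∈ LCS i) : a * g * a⁻¹ * g⁻¹ ∈ LCS (i+1) := by
  rw [Subgroup.lowerCentralSeries_succ]
  exact Subgroup.commutator_mem_commutator ha (Subgroup.mem_top g)

lemma nil_step (T : Finset N) (hT : Subgroup.closure (T : Set N) = ⊤) (l : N → ℕ) (l1 : l 1 = 0)
    (linv : ∀ x, l x⁻¹ = l x) (lmul : ∀ x y, l (x * y) ≤ l x + l y) (q ℓ ℓi : ℕ) (hq : T.card ≤ q)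
    (hℓ : ℓ ≤ ℓi) (hTl : ∀ t ∈ T, l t ≤ ℓ) (i : ℕ)
    (h : ∀ x ∈ LCS i, ∃ c ∈ LCS (i+1), l (x * c) ≤ ℓi) :
    ∀ x ∈ LCS (i+1), ∃ c ∈ LCS (i+2), l (x * c) ≤ 4 * q * ℓi := by
  classical
  let mk := QuotientGroup.mk' (LCS (i+2))
  have hcen : ∀ a ∈ LCS (i+1), mk a ∈ Subgroup.center (N ⧸ LCS (i+2)) := by
    intro a ha
    rw [Subgroup.mem_center_iff]
    intro g
    obtain ⟨g, rfl⟩ := QuotientGroup.mk'_surjective _ g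
    have h1 : mk (a * g * a⁻¹ * g⁻¹) = 1 := (QuotientGroup.eq_one_iff _).2 (comm_mem_lcs (i+1) a g ha)
    simp only [map_mul, map_inv] at h1
    change mk g * mk a = mk a * mk g
    calc mk g * mk a = (mk a * mk g * (mk a)⁻¹ * (mk g)⁻¹) * (mk g * mk a) := by rw [h1, one_mul]
      _ = _ := by group
  let B : N → N → N := fun a g => a * g * a⁻¹ * g⁻¹
  have hB : ∀ a ∈ LCS i, ∀ g, mk (B a g) ∈ Subgroup.center (N ⧸ LCS (i+2)) := fun a ha g => hcen _ (comm_mem_lcs i a g ha)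
  have hBl : ∀ a ∈ LCS i, ∀ b ∈ LCS i, ∀ g, mk (B (a * b) g) = mk (B a g) * mk (B b g) := by
    intro a ha b hb g
    have h1 := (Subgroup.mem_center_iff.1 (hB b hb g)) (mk a)
    have e1 : B (a * b) g = a * B b g * a⁻¹ * B a g := by simp only [B]; group
    have h2 := (Subgroup.mem_center_iff.1 (hB b hb g)) (mk (B a g))
    rw [e1, map_mul, map_mul, map_mul, h1, map_inv, mul_inv_cancel_right, h2]
  have hBr : ∀ a ∈ LCS i, ∀ g h, mk (B a (g * h)) = mk (B a g) * mk (B a h) := by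
    intro a ha g h
    have h1 := (Subgroup.mem_center_iff.1 (hB a ha h)) (mk g)
    have e1 : B a (g * h) = B a g * (g * B a h * g⁻¹) := by simp only [B]; group
    rw [e1, map_mul mk (B a g) (g * B a h * g⁻¹), map_mul mk (g * B a h) g⁻¹, map_mul mk g, h1, map_inv, mul_inv_cancel_right]
  have hBc : ∀ a ∈ LCS i, ∀ c ∈ LCS (i+1), ∀ g, mk (B (a * c) g) = mk (B a g) := by
    intro a ha c hc g
    rw [hBl a ha c (Subgroup.lowerCentralSeries_antitone _ (Nat.le_succ i) hc)]
    have : mk (B c g) = 1 := (QuotientGroup.eq_one_iff _).2 (comm_mem_lcs (i+1) c g hc)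
    rw [this, mul_one]
  let _ : CommGroup (Subgroup.center (N ⧸ LCS (i+2))) :=
    { (inferInstance : Group (Subgroup.center (N ⧸ LCS (i+2)))) with
      mul_comm := fun a b => Subtype.ext (Subgroup.mem_center_iff.1 b.2 a) }
  let φ : N → LCS i →* Subgroup.center (N ⧸ LCS (i+2)) := fun g =>
    MonoidHom.mk' (fun a => ⟨mk (B a g), hB a a.2 g⟩) (fun a b => Subtype.ext (hBl a a.2 b b.2 g))
  let χ : LCS i → N →* Subgroup.center (N ⧸ LCS (i+2)) := fun a =>
    MonoidHom.mk' (fun g => ⟨mk (B a g), hB a a.2 g⟩) (fun g h => Subtype.ext (hBr a a.2 g h))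
  let ψ : (T → LCS i) →* Subgroup.center (N ⧸ LCS (i+2)) :=
    ∏ t : T, (φ t).comp (Pi.evalMonoidHom (fun _ : T => LCS i) t)
  have hψ : ∀ a, ψ a = ∏ t : T, φ t (a t) := by
    intro a; simp only [ψ, MonoidHom.finsetProd_apply]; rfl
  have hT1 : ∀ a : LCS i, ∀ t : T, χ a t ∈ ψ.range := by
    intro a t
    refine ⟨Pi.mulSingle t a, ?_⟩
    rw [hψ, Finset.prod_eq_single t]
    · simp; rfl
    · intro b _ hb; rw [Pi.mulSingle_eq_of_ne hb]; exact map_one (φ b)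
    · simp
  have hT2 : ∀ a : LCS i, ∀ g, χ a g ∈ ψ.range := by
    intro a
    have : Subgroup.closure (T : Set N) ≤ ψ.range.comap (χ a) := by
      rw [Subgroup.closure_le]; intro t ht; exact hT1 a ⟨t, ht⟩
    intro g
    exact this (hT ▸ Subgroup.mem_top g)
  have hall : LCS (i+1) ≤ (ψ.range.map (Subgroup.center (N ⧸ LCS (i+2))).subtype).comap mk := by
    rw [Subgroup.lowerCentralSeries_succ, Subgroup.commutator_le]
    intro a ha g _
    exact ⟨_, hT2 ⟨a, ha⟩ g, rfl⟩
  intro x hx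
  obtain ⟨_, ⟨a, rfl⟩, ha⟩ := hall hx
  rw [hψ] at ha
  choose c hc hlc using fun t : T => h (a t) (a t).2
  have hprod : ∀ s : Finset T, ∃ y, mk y = ((∏ t ∈ s, φ t (a t) : Subgroup.center (N ⧸ LCS (i+2))) : N ⧸ LCS (i+2)) ∧
      l y ≤ s.card * (4 * ℓi) := by
    intro s
    induction s using Finset.induction_on with
    | empty => exact ⟨1, by rw [Finset.prod_empty, map_one]; rfl, by simp [l1]⟩
    | insert t s hts ih =>
      obtain ⟨y, hy, hly⟩ := ih
      refine ⟨B (a t * c t) t * y, ?_, ?_⟩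
      · rw [Finset.prod_insert hts, map_mul, hBc _ (a t).2 _ (hc t), hy]; rfl
      · rw [Finset.card_insert_of_notMem hts]
        have h1 := lmul (B (a t * c t) t) y
        have h2 := lmul (a t * c t * t * (a t * c t)⁻¹) (t : N)⁻¹
        have h3 := lmul (a t * c t * t) (a t * c t)⁻¹
        have h4 := lmul (a t * c t) t
        have h5 := hlc t
        have h6 := hTl t t.2
        rw [linv] at h2 h3
        have : l (B (a t * c t) t) ≤ 4 * ℓi := by simp only [B]; omega
        rw [add_mul, one_mul]; omega
  obtain ⟨y, hy, hly⟩ := hprod Finset.univ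
  refine ⟨x⁻¹ * y, ?_, ?_⟩
  · refine (QuotientGroup.eq_one_iff _).1 ?_
    change mk (x⁻¹ * y) = 1
    rw [map_mul, map_inv, hy, inv_mul_eq_one]
    exact ha.symm
  · rw [mul_inv_cancel_left]
    refine hly.trans ?_
    rw [Finset.card_univ, Fintype.card_coe]
    calc T.card * (4 * ℓi) ≤ q * (4 * ℓi) := Nat.mul_le_mul_right _ hq
      _ = _ := by ring

lemma nil_diam (T : Finset N) (hT : Subgroup.closure (T : Set N) = ⊤) (l : N → ℕ) (l1 : l 1 = 0)
    (linv : ∀ x, l x⁻¹ = l x) (lmul : ∀ x y, l (x * y) ≤ l x + l y) (q ℓ m : ℕ) (hq : T.card ≤ q) (hq1 : 1 ≤ q)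
    (hTl : ∀ t ∈ T, l t ≤ ℓ) (hm : LCS m = ⊥)
    (h : ∀ x, ∃ c ∈ LCS 1, l (x * c) ≤ ℓ) (x : N) : l x ≤ m * ((4 * q) ^ m * ℓ) := by
  have h1 : ∀ i, ∀ x ∈ LCS i, ∃ c ∈ LCS (i+1), l (x * c) ≤ (4 * q) ^ i * ℓ := by
    intro i
    induction i with
    | zero => intro x _; simpa using h x
    | succ i ih =>
      have := nil_step T hT l l1 linv lmul q ℓ ((4 * q) ^ i * ℓ) hq
        (Nat.le_mul_of_pos_left _ (by positivity)) hTl i ih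
      intro x hx
      obtain ⟨c, hc, hcl⟩ := this x hx
      exact ⟨c, hc, hcl.trans (le_of_eq (by ring))⟩
  have h2 : ∀ k ≤ m, ∀ x ∈ LCS (m - k), l x ≤ k * ((4 * q) ^ m * ℓ) := by
    intro k
    induction k with
    | zero =>
      intro _ x hx
      rw [Nat.sub_zero, hm, Subgroup.mem_bot] at hx
      rw [hx, l1]; omega
    | succ k ih =>
      intro hk x hx
      obtain ⟨c, hc, hcl⟩ := h1 _ x hx
      rw [show m - (k+1) + 1 = m - k by omega] at hc
      have h3 := ih (by omega) c hc
      have h4 := lmul (x * c) c⁻¹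
      rw [linv, mul_inv_cancel_right] at h4
      have h5 : (4 * q) ^ (m - (k+1)) * ℓ ≤ (4 * q) ^ m * ℓ :=
        Nat.mul_le_mul_right _ (Nat.pow_le_pow_right (by omega) (by omega))
      rw [add_mul, one_mul]; omega
  exact h2 m le_rfl x (by simp)

end nil
end DR

namespace DR
set_option linter.unusedSectionVars false

section big
variable {G : Type*} [Group G] [Fintype G] {len : G → ℕ}

lemma big_quot (hl : WLen len) {γ : ℝ} (hγ : 0 < γ) {f : G → ℝ} (hf : f ∈ Wsp len γ) (hf0 : f ≠ 0) (k1 : ℕ)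
    (hK : ((Bl len 3).card : ℝ) ≤ 8 ^ k1 * (Bl len 1).card) (R : ℕ)
    (hcov : ∀ x, ∃ y, len y ≤ R ∧ y⁻¹ * x ∈ Ker len γ) : 1 ≤ 4 * (R:ℝ) ^ 2 * γ * 8 ^ k1 := by
  have hnm : 0 < nm f := by
    obtain ⟨x, hx⟩ := Function.ne_iff.1 hf0
    exact Finset.sum_pos' (fun _ _ => sq_nonneg _) ⟨x, Finset.mem_univ _, by positivity [show f x ≠ 0 from hx]⟩
  have h1 : ∀ v, (Bl len 1).card * ∑ x, (f x - f (x * v)) ^ 2 ≤ 8 * R ^ 2 * γ * (Bl len 3).card * nm f := by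
    intro v
    obtain ⟨y, hy, hyk⟩ := hcov v
    have h2 : ∀ x, f (x * v) = f (x * y) := by
      intro x
      have := (Ker_normal.conj_mem _ hyk (x * y)) f hf (x * y)
      rw [← this]; congr 1; group
    simp only [h2]
    exact global_shift hl hf R y hy
  have h2 : ∑ v, ∑ x, (f x - f (x * v)) ^ 2 = 2 * Fintype.card G * nm f := by
    have hs := sum_zero_of_mem hγ.ne' hl hf
    have e : ∀ x, ∑ v, (f x - f (x * v)) ^ 2 = Fintype.card G * f x ^ 2 + nm f := by
      intro x
      have e1 : ∑ v, f (x * v) = 0 := by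
        rw [← hs]; exact Equiv.sum_comp (Equiv.mulLeft x) f
      have e2 : ∑ v, f (x * v) ^ 2 = nm f :=
        Equiv.sum_comp (Equiv.mulLeft x) (fun y => f y ^ 2)
      calc ∑ v, (f x - f (x * v)) ^ 2 = ∑ v, (f x ^ 2 - 2 * f x * f (x * v) + f (x * v) ^ 2) :=
            Finset.sum_congr rfl fun v _ => by ring
        _ = _ := by
            rw [Finset.sum_add_distrib, Finset.sum_sub_distrib, ← Finset.mul_sum, e1, e2]
            simp
    rw [Finset.sum_comm, Finset.sum_congr rfl fun x _ => e x, Finset.sum_add_distrib, ← Finset.mul_sum]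
    simp only [Finset.sum_const, Finset.card_univ, nsmul_eq_mul]
    change _ * nm f + _ = _
    ring
  have h3 := Finset.sum_le_sum fun v (_ : v ∈ (Finset.univ : Finset G)) => h1 v
  rw [← Finset.mul_sum, h2] at h3
  simp only [Finset.sum_const, Finset.card_univ, nsmul_eq_mul] at h3
  have hb : (0:ℝ) < (Bl len 1).card := by exact_mod_cast hl.card_pos 1
  have hn : (0:ℝ) < Fintype.card G := by exact_mod_cast Fintype.card_pos
  have h4 : (Bl len 1).card * (2 * Fintype.card G * nm f) ≤
      Fintype.card G * (8 * R ^ 2 * γ * (8 ^ k1 * (Bl len 1).card) * nm f) := by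
    refine h3.trans ?_
    gcongr
  have h5 : (0:ℝ) ≤ (2 * ((Bl len 1).card * Fintype.card G * nm f)) * (4 * (R:ℝ) ^ 2 * γ * 8 ^ k1 - 1) := by
    nlinarith
  have h6 := nonneg_of_mul_nonneg_right h5 (by positivity)
  linarith
end big

section ab
variable {A : Type*} [CommGroup A] [Fintype A] {l : A → ℕ}

lemma ab_char (hl : WLen l) {γ : ℝ} (hγ : 0 < γ) {f : A → ℝ} (hf : f ∈ Wsp l γ) (hf0 : f ≠ 0) (K : ℝ)
    (hK : ((Bl l 3).card : ℝ) ≤ K * (Bl l 1).card) :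
    ∃ χ : A →* ℂ, (∀ a, ‖χ a‖ = 1) ∧ (∃ a, χ a ≠ 1) ∧ ∀ s, l s ≤ 1 → ‖χ s - 1‖ ^ 2 ≤ 8 * K * γ := by
  classical
  obtain ⟨ψ, hψ⟩ : ∃ ψ : AddChar (Additive A) ℂ, ∑ x : A, (f x : ℂ) * ψ (Additive.ofMul x⁻¹) ≠ 0 := by
    by_contra hcon
    push Not at hcon
    apply hf0
    funext a
    have h1 : ∑ ψ : AddChar (Additive A) ℂ, ψ (Additive.ofMul a) * ∑ x : A, (f x : ℂ) * ψ (Additive.ofMul x⁻¹) = 0 := by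
      simp only [hcon, mul_zero, Finset.sum_const_zero]
    simp only [Finset.mul_sum] at h1
    rw [Finset.sum_comm] at h1
    have h2 : ∀ x : A, ∑ ψ : AddChar (Additive A) ℂ, ψ (Additive.ofMul a) * ((f x : ℂ) * ψ (Additive.ofMul x⁻¹)) =
        if x = a then (Fintype.card A : ℂ) * f x else 0 := by
      intro x
      have := AddChar.sum_apply_eq_ite (Additive.ofMul (a * x⁻¹))
      calc ∑ ψ : AddChar (Additive A) ℂ, ψ (Additive.ofMul a) * ((f x : ℂ) * ψ (Additive.ofMul x⁻¹))
          = f x * ∑ ψ : AddChar (Additive A) ℂ, ψ (Additive.ofMul (a * x⁻¹)) := by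
            rw [Finset.mul_sum]
            refine Finset.sum_congr rfl fun ψ _ => ?_
            rw [ofMul_mul, AddChar.map_add_eq_mul]; ring
        _ = _ := by
            rw [this]
            by_cases hxa : x = a
            · subst hxa; simp [mul_comm]
            · have : Additive.ofMul (a * x⁻¹) ≠ 0 := by
                intro h
                apply hxa
                have h' : a * x⁻¹ = 1 := h
                exact (mul_inv_eq_one.1 h').symm
              rw [if_neg this, if_neg hxa, mul_zero]
    rw [Finset.sum_congr rfl fun x _ => h2 x] at h1
    simpa using h1
  let χ : A →* ℂ := { toFun := fun a => ψ (Additive.ofMul a), map_one' := by simp,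
                      map_mul' := by intro a b; rw [ofMul_mul, AddChar.map_add_eq_mul] }
  have hn : ∀ a, ‖χ a‖ = 1 := fun a => AddChar.norm_apply ψ _
  change ∑ x : A, (f x : ℂ) * χ x⁻¹ ≠ 0 at hψ
  have h1 : ∑ u ∈ Bl l 3, (1 - χ u) = γ * (Bl l 3).card := by
    have h2 : ∑ x : A, ((∑ u ∈ Bl l 3, (f x - f (x * u)) : ℝ) : ℂ) * χ x⁻¹ =
        ∑ x : A, ((γ * (Bl l 3).card * f x : ℝ) : ℂ) * χ x⁻¹ :=
      Finset.sum_congr rfl fun x _ => by rw [hf x]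
    have h3 : ∑ x : A, ((γ * (Bl l 3).card * f x : ℝ) : ℂ) * χ x⁻¹ = γ * (Bl l 3).card * ∑ x : A, (f x : ℂ) * χ x⁻¹ := by
      rw [Finset.mul_sum]; refine Finset.sum_congr rfl fun x _ => ?_
      push_cast; ring
    have h4 : ∑ x : A, ((∑ u ∈ Bl l 3, (f x - f (x * u)) : ℝ) : ℂ) * χ x⁻¹ =
        (∑ u ∈ Bl l 3, (1 - χ u)) * ∑ x : A, (f x : ℂ) * χ x⁻¹ := by
      push_cast
      simp only [Finset.sum_mul]
      rw [Finset.sum_comm]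
      refine Finset.sum_congr rfl fun u _ => ?_
      have h5 : ∑ x : A, (f (x * u) : ℂ) * χ x⁻¹ = χ u * ∑ x : A, (f x : ℂ) * χ x⁻¹ := by
        rw [← Equiv.sum_comp (Equiv.mulRight u) (fun x => (f x : ℂ) * χ x⁻¹), Finset.mul_sum]
        refine Finset.sum_congr rfl fun x _ => ?_
        simp only [Equiv.coe_mulRight]
        have : χ x⁻¹ = χ u * χ (x * u)⁻¹ := by rw [← map_mul]; congr 1; simp [mul_inv]
        rw [this]; ring
      rw [sub_mul, one_mul, ← h5, ← Finset.sum_sub_distrib]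
      exact Finset.sum_congr rfl fun x _ => by ring
    rw [h4, h3] at h2
    exact mul_right_cancel₀ hψ h2
  have hB3 : (0:ℝ) < (Bl l 3).card := by exact_mod_cast hl.card_pos 3
  have hB1 : (0:ℝ) < (Bl l 1).card := by exact_mod_cast hl.card_pos 1
  have hsq : ∀ a, ‖χ a - 1‖ ^ 2 = 2 * (1 - (χ a).re) := by
    intro a
    have h := hn a
    have h' : (χ a).re ^ 2 + (χ a).im ^ 2 = 1 := by
      have := Complex.sq_norm (χ a)
      rw [h, Complex.normSq_apply] at this; nlinarith
    rw [Complex.sq_norm, Complex.normSq_apply]; simp; nlinarith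
  have hsum : ∑ u ∈ Bl l 3, ‖χ u - 1‖ ^ 2 = 2 * γ * (Bl l 3).card := by
    have := congrArg Complex.re h1
    rw [Complex.re_sum] at this
    simp only [hsq, ← Finset.mul_sum]
    simp only [Complex.sub_re, Complex.one_re] at this
    rw [this, mul_assoc]; norm_cast
  refine ⟨χ, hn, ?_, ?_⟩
  · by_contra hcon
    push Not at hcon
    simp only [hcon, sub_self, Finset.sum_const_zero, norm_zero] at hsum
    norm_num at hsum
    rcases hsum with h | h
    · exact hγ.ne' h
    · simp [h] at hB3
  · intro s hs
    have h2 : ∀ v ∈ Bl l 1, ‖χ s - 1‖ ^ 2 ≤ 2 * ‖χ (s * v) - 1‖ ^ 2 + 2 * ‖χ v - 1‖ ^ 2 := by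
      intro v _
      have e : χ (s * v) - 1 - (χ v - 1) = χ v * (χ s - 1) := by rw [map_mul]; ring
      have h3 := norm_sub_le (χ (s * v) - 1) (χ v - 1)
      rw [e, norm_mul, hn, one_mul] at h3
      have := norm_nonneg (χ s - 1)
      nlinarith [sq_nonneg (‖χ (s * v) - 1‖ - ‖χ v - 1‖)]
    have h3 := Finset.sum_le_sum h2
    rw [Finset.sum_add_distrib, ← Finset.mul_sum, ← Finset.mul_sum] at h3
    have h4 : ∑ v ∈ Bl l 1, ‖χ v - 1‖ ^ 2 ≤ 2 * γ * (Bl l 3).card := by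
      rw [← hsum]
      exact Finset.sum_le_sum_of_subset_of_nonneg (Bl_mono (by norm_num)) fun _ _ _ => sq_nonneg _
    have h5 : ∑ v ∈ Bl l 1, ‖χ (s * v) - 1‖ ^ 2 ≤ 2 * γ * (Bl l 3).card := by
      rw [← hsum, ← Finset.sum_image (s := Bl l 1) (g := fun v => s * v) (f := fun w => ‖χ w - 1‖ ^ 2)
        (fun a _ b _ h => mul_left_cancel h)]
      refine Finset.sum_le_sum_of_subset_of_nonneg ?_ fun _ _ _ => sq_nonneg _
      intro w hw
      obtain ⟨v, hv, rfl⟩ := Finset.mem_image.1 hw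
      rw [mem_Bl] at hv ⊢
      have := hl.mul s v; omega
    simp only [Finset.sum_const, nsmul_eq_mul] at h3
    have h6 : (Bl l 1).card * ‖χ s - 1‖ ^ 2 ≤ (Bl l 1).card * (8 * K * γ) := by nlinarith
    exact le_of_mul_le_mul_left h6 hB1
end ab
end DR

namespace DR
set_option linter.unusedSectionVars false

variable {G : Type*} [Group G] [Fintype G] {len : G → ℕ}

open scoped Pointwise in
lemma nil_char (hl : WLen len) (K : Subgroup G) [K.Normal] (U : Set G) (J m ℓ w q d p : ℕ)
    (hU : ∀ u ∈ U, len u ≤ 2 * J)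
    (hcov : ∀ x, ∃ y, len y ≤ J ∧ y⁻¹ * x ∈ Subgroup.closure U)
    (hIC : ∀ z, IC U m z → z ∈ K) (hq : Fintype.card G < 2 ^ (q + 1)) (hq1 : 1 ≤ q)
    (hJℓ : 2 * J ≤ ℓ) (hJw : 2 * J ≤ w)
    (hbig : ∃ x, ∀ y, len y ≤ J + m * ((4 * q) ^ m * ℓ) → y⁻¹ * x ∉ K)
    (hp : 8 * d + 3 ≤ p) (hwℓ : w * 8 ^ (4 * p) ≤ ℓ) (hn : Fintype.card G ≤ 8 ^ (4 * d * p)) :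
    ∃ χ : Subgroup.closure U →* ℂ, (∀ g, ‖χ g‖ = 1) ∧ (∃ g, χ g ≠ 1) ∧
      ∀ g : Subgroup.closure U, len g ≤ w → ‖χ g - 1‖ < 1 := by
  classical
  set Γ := Subgroup.closure U with hΓ
  let N := Γ ⧸ K.subgroupOf Γ
  let mk : Γ →* N := QuotientGroup.mk' (K.subgroupOf Γ)
  have hmks : Function.Surjective mk := QuotientGroup.mk'_surjective _
  have hmk1 : ∀ g : Γ, mk g = 1 ↔ (g : G) ∈ K := fun g =>
    (QuotientGroup.eq_one_iff g).trans Subgroup.mem_subgroupOf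
  let U' : Set Γ := {g | (g : G) ∈ U}
  have hU'c : Subgroup.closure U' = ⊤ := by
    have : U' = (Subtype.val : Γ → G) ⁻¹' U := rfl
    rw [this, hΓ]; exact Subgroup.closure_closure_coe_preimage
  have hUN : Subgroup.closure (mk '' U') = ⊤ := by
    rw [← MonoidHom.map_closure, hU'c, ← MonoidHom.range_eq_map, MonoidHom.range_eq_top]; exact hmks
  have hICN : ∀ j (z : N), IC (mk '' U') j z → ∃ z' : Γ, mk z' = z ∧ IC U j (z' : G) := by
    intro j z hz
    induction hz with
    | base u hu => obtain ⟨v, hv, rfl⟩ := hu; exact ⟨v, rfl, IC.base _ hv⟩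
    | step j z u _ hu ih =>
      obtain ⟨v, hv, rfl⟩ := hu
      obtain ⟨z', rfl, h⟩ := ih
      exact ⟨z'⁻¹ * v⁻¹ * z' * v, by simp only [map_mul, map_inv], IC.step j _ _ h hv⟩
  have hlcs := lcs_bot (mk '' U') hUN m (fun z hz => by
    obtain ⟨z', rfl, h⟩ := hICN m z hz
    exact (hmk1 _).2 (hIC _ h))
  have hNG : Fintype.card N ≤ Fintype.card G :=
    (Fintype.card_le_of_surjective mk hmks).trans (Fintype.card_le_of_injective _ Subtype.val_injective)
  obtain ⟨T, hTU, hUT, hTc⟩ := small_gen (mk '' U')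
  have hTq : T.card ≤ q := by
    have : 2 ^ T.card < 2 ^ (q+1) := (hTc.trans hNG).trans_lt hq
    have := (Nat.pow_lt_pow_iff_right (by norm_num)).1 this
    omega
  have hTgen : Subgroup.closure (T : Set N) = ⊤ := by
    rw [eq_top_iff, ← hUN, Subgroup.closure_le]; exact hUT
  -- length on N
  let l : N → ℕ := fun x => sInf {t | ∃ g : Γ, mk g = x ∧ len g = t}
  have hlatt : ∀ x, ∃ g : Γ, mk g = x ∧ len g = l x := by
    intro x
    obtain ⟨g, hg⟩ := hmks x
    exact Nat.sInf_mem (s := {t | ∃ g : Γ, mk g = x ∧ len g = t}) ⟨len g, g, hg, rfl⟩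
  have hlle : ∀ g : Γ, l (mk g) ≤ len g := fun g => Nat.sInf_le ⟨g, rfl, rfl⟩
  have l1 : l 1 = 0 := by
    have := hlle 1
    rw [map_one, Subgroup.coe_one, hl.one] at this
    omega
  have linv' : ∀ x, l x⁻¹ ≤ l x := by
    intro x
    obtain ⟨g, rfl, hg⟩ := hlatt x
    have := hlle g⁻¹
    rw [map_inv, Subgroup.coe_inv, hl.inv] at this
    omega
  have linv : ∀ x, l x⁻¹ = l x := fun x => le_antisymm (linv' x) (by have := linv' x⁻¹; rwa [inv_inv] at this)
  have lmul : ∀ x y, l (x * y) ≤ l x + l y := by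
    intro x y
    obtain ⟨g, rfl, hg⟩ := hlatt x
    obtain ⟨h, rfl, hh⟩ := hlatt y
    have := hlle (g * h)
    rw [map_mul, Subgroup.coe_mul] at this
    have := hl.mul g h
    omega
  have hTl : ∀ t ∈ T, l t ≤ ℓ := by
    intro t ht
    obtain ⟨u, hu, rfl⟩ := hTU ht
    have := hlle u
    have := hU _ hu
    omega
  obtain ⟨x0, hx0⟩ : ∃ x0 : N, ∀ c ∈ (⊤ : Subgroup N).lowerCentralSeries 1, ℓ < l (x0 * c) := by
    by_contra hcon
    push Not at hcon
    have hd := nil_diam T hTgen l l1 linv lmul q ℓ m hTq hq1 hTl hlcs hcon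
    obtain ⟨x, hx⟩ := hbig
    obtain ⟨y, hy, hyx⟩ := hcov x
    obtain ⟨g, hg, hgl⟩ := hlatt (mk ⟨_, hyx⟩)
    have h1 := hd (mk ⟨_, hyx⟩)
    refine hx (y * g) ?_ ?_
    · have := hl.mul y g; omega
    · have h2 : mk (g⁻¹ * ⟨_, hyx⟩) = 1 := by rw [map_mul, map_inv, hg, inv_mul_cancel]
      have := (hmk1 _).1 h2
      simpa [mul_assoc] using this
  -- abelianization
  let A := Abelianization N
  let π : Γ →* A := Abelianization.of.comp mk
  have hπs : Function.Surjective π := (QuotientGroup.mk_surjective).comp hmks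
  have hA : ∀ x y : N, (Abelianization.of x : A) = Abelianization.of y → x⁻¹ * y ∈ (⊤ : Subgroup N).lowerCentralSeries 1 := by
    intro x y h
    have : x⁻¹ * y ∈ commutator N := QuotientGroup.eq.1 h
    rw [Subgroup.top_lowerCentralSeries_one]
    exact this
  let V : Set A := π '' {g | len g ≤ w}
  obtain ⟨lA, hlA, hlA1, hlAt⟩ := exists_wlen V ⟨1, by simp [hl.one], map_one _⟩ (by
      rintro _ ⟨g, hg, rfl⟩
      exact ⟨g⁻¹, by simpa [hl.inv] using hg, map_inv _ _⟩) (by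
      rw [eq_top_iff]
      have : Subgroup.closure (π '' U') = ⊤ := by
        rw [← MonoidHom.map_closure, hU'c, ← MonoidHom.range_eq_map, MonoidHom.range_eq_top]; exact hπs
      rw [← this]
      refine Subgroup.closure_mono (Set.image_mono fun g hg => ?_)
      exact (hU _ hg).trans hJw)
  have hpow : ∀ t (a : A), a ∈ V ^ t → ∃ g : Γ, π g = a ∧ len g ≤ t * w := by
    intro t
    induction t with
    | zero => intro a ha; exact ⟨1, by simpa [eq_comm] using ha, by simp [hl.one]⟩
    | succ t ih =>
      intro a ha
      rw [pow_succ] at ha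
      obtain ⟨b, hb, c, ⟨h, hh, rfl⟩, rfl⟩ := Set.mem_mul.1 ha
      obtain ⟨g, rfl, hg⟩ := ih b hb
      refine ⟨g * h, map_mul _ _ _, ?_⟩
      have := hl.mul g h
      have hh' : len h ≤ w := hh
      rw [Subgroup.coe_mul, add_mul, one_mul]; omega
  have hbigA : 8 ^ (4 * p) ≤ lA (Abelianization.of x0) := by
    by_contra hcon
    have h1 : lA (Abelianization.of x0) ≤ 8 ^ (4 * p) := by omega
    obtain ⟨g, hg, hgl⟩ := hpow _ _ ((hlAt _ _).1 h1)
    have h2 := hx0 _ (hA x0 (mk g) hg.symm)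
    rw [mul_inv_cancel_left] at h2
    have := hlle g
    rw [mul_comm] at hgl
    omega
  have hAG : Fintype.card A ≤ Fintype.card G :=
    (Fintype.card_le_of_surjective π hπs).trans (Fintype.card_le_of_injective _ Subtype.val_injective)
  obtain ⟨r, hr, hK3, γ, f, hf, hf0, hγ, hγp⟩ := EF d p (by omega) hlA ⟨_, hbigA⟩ (hAG.trans hn)
  obtain ⟨χ, hχ1, ⟨a, ha⟩, hχ⟩ := ab_char (hlA.rescale hr) hγ hf hf0 _ hK3
  refine ⟨χ.comp π, fun g => hχ1 _, ?_, ?_⟩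
  · obtain ⟨g, rfl⟩ := hπs a
    exact ⟨g, ha⟩
  · intro g hg
    have h1 : lA (π g) ≤ 1 := (hlA1 _).2 ⟨g, hg, rfl⟩
    have h2 := hχ (π g) ((rl_le hr).2 (by omega))
    have h3 : 8 * (8:ℝ) ^ (4 * d + 1) * γ < 1 := by
      have h4 : 8 * (8:ℝ) ^ (4 * d + 1) * 8 ≤ 8 ^ p := by
        calc 8 * (8:ℝ) ^ (4 * d + 1) * 8 = 8 ^ (4 * d + 3) := by ring
          _ ≤ 8 ^ p := pow_le_pow_right₀ (by norm_num) (by omega)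
      nlinarith [pow_pos (show (0:ℝ) < 8 by norm_num) (4 * d + 1)]
    have h5 : ‖χ (π g) - 1‖ ^ 2 < 1 := h2.trans_lt h3
    exact (sq_lt_one_iff₀ (norm_nonneg _)).1 h5
end DR

namespace DR
set_option linter.unusedSectionVars false

section core
variable {G : Type*} [Group G] [Fintype G] {len : G → ℕ}

lemma inv_pow_le {a b : ℕ} (h : a ≤ b) : (1 / 8 : ℝ) ^ b ≤ (1 / 8) ^ a :=
  pow_le_pow_of_le_one (by norm_num) (by norm_num) h

lemma few_big (hl : WLen len) {γ : ℝ} (hγ : 0 < γ) (d Q a b k1 : ℕ) (hd : 1 ≤ d) (hQ : 1 ≤ Q) (hba : b < a)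
    (haQ : a ≤ 4 * Q) (hak : 3 + k1 + 2 * (72 * d) ≤ a)
    (hK : ((Bl len 3).card : ℝ) ≤ 8 ^ k1 * (Bl len 1).card) (hγQ : γ * 8 ^ (18 * Q) ≤ 1)
    (hn : Fintype.card G ≤ 8 ^ (72 * d * Q)) (t : ℕ) (ht : t ≤ 8 ^ (4 * Q)) :
    FewBig len γ ((1 / 8) ^ (b * Q)) t (2 * 8 ^ (72 * d * (a + 1))) := by
  classical
  apply fewBig_mono ht
  intro u hu hon h0
  let F : ℕ → ℝ := fun i => lg len (4 * Q - a + i)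
  have hF : Monotone F := fun i j h => lg_mono hl (by omega)
  have hF0 : ∀ i, 0 ≤ F i := fun i => lg_nonneg hl _
  have hFH : ∀ i, F i ≤ (72 * d * Q : ℕ) := fun i => lg_le hl _ hn _
  have hb1 := pg F (72 * d * Q : ℕ) (72 * d : ℕ) 1 (4 * Q) one_pos hF hF0 hFH
  have hb2 := pg F (72 * d * Q : ℕ) (72 * d : ℕ) (a + 1) (4 * Q) (by omega) hF hF0 hFH
  set b1 := (Finset.range (4 * Q)).filter (fun i => ((1:ℕ):ℝ) * (72 * d : ℕ) < F (i + 1) - F i) with hb1d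
  set b2 := (Finset.range (4 * Q)).filter (fun i => ((a+1:ℕ):ℝ) * (72 * d : ℕ) < F (i + (a+1)) - F i) with hb2d
  have hb1' : b1.card ≤ Q := by
    have : b1.card * (72 * d) ≤ 72 * d * Q := by exact_mod_cast hb1
    nlinarith
  have hb2' : b2.card ≤ Q := by
    have : b2.card * (72 * d) ≤ 72 * d * Q := by exact_mod_cast hb2
    nlinarith
  let T := Finset.range (4 * Q) \ (b1 ∪ b2)
  have hT : T ⊆ Finset.range (4 * Q) := Finset.sdiff_subset
  have hTc : 2 * Q ≤ T.card := by
    have h1 := Finset.le_card_sdiff (b1 ∪ b2) (Finset.range (4 * Q))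
    have h2 := Finset.card_union_le b1 b2
    rw [Finset.card_range] at h1
    change _ ≤ T.card at h1
    omega
  have hrb := rank_bound hl hγ.le (4 * Q) (4 * Q) a (72 * d) k1 T hT hK (by omega) haQ (by
      have e : (64:ℝ) ^ (4 * Q + 4 * Q) = 8 ^ (16 * Q) := by
        rw [show (64:ℝ) = 8 ^ 2 by norm_num, ← pow_mul]; congr 1; ring
      rw [e]
      have e2 : (8:ℝ) ^ (18 * Q) = 8 ^ (16 * Q) * 8 ^ (2 * Q) := by rw [← pow_add]; congr 1; ring
      rw [e2] at hγQ
      have h8 : (8:ℝ) ^ 1 ≤ 8 ^ (2 * Q) := pow_le_pow_right₀ (by norm_num) (by omega)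
      have : 0 < γ * 8 ^ (16 * Q) := by positivity
      nlinarith) (by
      intro i hi
      have hi' := Finset.mem_sdiff.1 hi
      have hir := hi'.1
      have hi1 : i ∉ b1 := fun h => hi'.2 (Finset.mem_union_left _ h)
      have hi2 : i ∉ b2 := fun h => hi'.2 (Finset.mem_union_right _ h)
      rw [hb1d, Finset.mem_filter, not_and, not_lt] at hi1
      rw [hb2d, Finset.mem_filter, not_and, not_lt] at hi2
      have h1 := hi1 hir
      have h2 := hi2 hir
      constructor
      · apply card_of_lg hl
        simp only [F] at h1
        rw [show 4 * Q - a + i = 4 * Q + i - a by omega, show 4 * Q - a + (i + 1) = 4 * Q + i - a + 1 by omega] at h1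
        simpa using h1
      · apply card_of_lg hl
        simp only [F] at h2
        rw [show 4 * Q - a + i = 4 * Q + i - a by omega, show 4 * Q - a + (i + (a + 1)) = 4 * Q + i + 1 by omega] at h2
        refine h2.trans (le_of_eq ?_)
        push_cast; ring) hak (by simp) u hu hon _ (by positivity) h0
  have h1 : ((1 / 8 : ℝ) ^ (b * Q)) ^ 2 ≤ (1 / 8) ^ (a * (2 * Q)) := by
    refine hrb.trans ?_
    rw [show (1 / (8:ℝ) ^ a) = (1 / 8) ^ a by rw [one_div, one_div, inv_pow], ← pow_mul]
    exact inv_pow_le (Nat.mul_le_mul_left _ hTc)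
  rw [← pow_mul] at h1
  have h2 : (1 / 8 : ℝ) ^ (a * (2 * Q)) < (1 / 8) ^ (b * Q * 2) :=
    pow_lt_pow_right_of_lt_one₀ (by norm_num) (by norm_num) (by nlinarith)
  linarith

set_option maxHeartbeats 2000000 in
lemma core (hl0 : WLen len) (d Q L Λ a b y M m E : ℕ) (C : ℝ) (hd : 1 ≤ d) (hL : 1 ≤ L)
    (hy : y = 288 * d + 2) (hb : b = y + 72 * d + 2) (ha : a = b + 152 * d + 4)
    (hM : M = 2 * 8 ^ (72 * d * (a + 1))) (hC : C = Real.exp (M * (1 + 3 * y) + 2))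
    (hE : C * M ^ 2 ≤ (E:ℝ) ^ 2) (hΛ : Λ = 2 * (M * M)) (hm : m = 288 * d * Λ + 1) (hQ : Q = Λ * L)
    (c1 : 80 * C ^ 3 ≤ 8 ^ L) (c2 : 3 * E ≤ 8 ^ L) (c3 : 2 * 4 ^ m ≤ 8 ^ Q) (c4 : (24 * C) ^ m ≤ 8 ^ Q)
    (c5 : 216 * d * Q < 8 ^ (2 * Q)) (c6 : m * (4 * (216 * d * Q)) ^ m + 1 ≤ 8 ^ Q) (c7 : 144 * d + 3 ≤ Q)
    (c8 : a ≤ Q)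
    (hyl : ∃ y, 8 ^ (72 * Q) ≤ len y) (hn : Fintype.card G ≤ 8 ^ (72 * d * Q)) :
    ∃ (Γ : Subgroup G) (R : ℕ), 1 ≤ R ∧ (∀ x, ∃ y, len y ≤ R ∧ y⁻¹ * x ∈ Γ) ∧
      ∃ χ : Γ →* ℂ, (∀ g, ‖χ g‖ = 1) ∧ (∃ g, χ g ≠ 1) ∧ ∀ g : Γ, len g ≤ 40 * R → ‖χ g - 1‖ < 1 := by
  classical
  obtain ⟨r, hr, hK, γ, f, hf, hf0, hγ, hγQ⟩ := EF d (18 * Q) (by omega) hl0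
    (by rwa [show 4 * (18 * Q) = 72 * Q by ring]) (by rwa [show 4 * d * (18 * Q) = 72 * d * Q by ring])
  have hl := hl0.rescale hr
  set ln := rl r len with hln
  have hn2 : 2 ≤ Fintype.card G := by
    obtain ⟨z, hz⟩ := hyl
    have h1 := wlen_lt_card hl0 z
    have : 1 ≤ 8 ^ (72 * Q) := Nat.one_le_pow _ _ (by norm_num)
    omega
  have hn0 : (0:ℝ) < Fintype.card G := by positivity
  have hnR : (Fintype.card G : ℝ) ≤ 8 ^ (72 * d * Q) := by exact_mod_cast hn
  have hQ1 : 1 ≤ Q := by omega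
  have hM1 : 1 ≤ M := by rw [hM]; have : 0 < 8 ^ (72 * d * (a+1)) := by positivity
                         omega
  have hMM : 1 ≤ M * M := Nat.one_le_iff_ne_zero.2 (by positivity)
  have hLQ : L ≤ Q := by rw [hQ]; exact Nat.le_mul_of_pos_left _ (by omega)
  have hC1 : 1 ≤ C := by rw [hC]; exact Real.one_le_exp (by positivity)
  set ξ : ℝ := (1 / 8) ^ (b * Q) with hξ
  set η : ℝ := (1 / 8) ^ (y * Q) with hη
  set δ : ℝ := (1 / 8) ^ L with hδ
  have hξ0 : 0 < ξ := by positivity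
  have hη0 : 0 < η := by positivity
  have hδ0 : 0 < δ := by positivity
  have hη1 : η ≤ 1 := pow_le_one₀ (by norm_num) (by norm_num)
  have h88 : ∀ k : ℕ, (8:ℝ) ^ k * (1 / 8) ^ k = 1 := by intro k; rw [← mul_pow]; norm_num
  have hfew : ∀ t ≤ 8 ^ (4 * Q), FewBig ln γ ξ t M := by
    intro t ht
    rw [hM]
    exact few_big hl hγ d Q a b (4 * d + 1) hd hQ1 (by omega) (by omega) (by omega) hK hγQ hn t ht
  have hkξ : Fintype.card G * ξ ≤ η := by
    calc Fintype.card G * ξ ≤ 8 ^ (72 * d * Q) * (1 / 8) ^ (72 * d * Q + y * Q) := by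
          apply mul_le_mul hnR _ hξ0.le (by positivity)
          apply inv_pow_le
          rw [hb]; nlinarith
      _ = η := by rw [pow_add, ← mul_assoc, h88, one_mul]
  obtain ⟨j, hj1, hj2, hD⟩ := form_doubling hl (γ := γ) M (2 * Q) Q hη0 hη1 hξ0.le
    (fun j hj => hfew _ (Nat.pow_le_pow_right (by norm_num) (by omega))) hkξ (M * (1 + 3 * y) + 2) (by
      have h1 : Real.log (2 / η) ≤ Q * (1 + 3 * y) := by
        have e : 2 / η = 2 * 8 ^ (y * Q) := by
          rw [hη, one_div, inv_pow, div_inv_eq_mul]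
        have l2 := Real.log_two_lt_d9
        have l8 : Real.log 8 = 3 * Real.log 2 := by
          rw [show (8:ℝ) = 2 ^ 3 by norm_num, Real.log_pow]; norm_num
        have hQr : (1:ℝ) ≤ Q := by exact_mod_cast hQ1
        rw [e, Real.log_mul (by norm_num) (by positivity), Real.log_pow, l8]
        push_cast
        have : (0:ℝ) ≤ y * Q := by positivity
        nlinarith
      have hMr : (0:ℝ) ≤ M := by positivity
      have hQr : (1:ℝ) ≤ Q := by exact_mod_cast hQ1
      nlinarith)
  rw [← hC] at hD
  set ρ := 8 ^ j with hρ
  have hDbl : Dbl ln γ η C ρ := hD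
  have hρ2 : 8 ^ (2 * Q) ≤ ρ := Nat.pow_le_pow_right (by norm_num) hj1
  have hρ3 : 2 * ρ ≤ 8 ^ (4 * Q) := by
    calc 2 * ρ ≤ 8 * 8 ^ j := by omega
      _ = 8 ^ (j + 1) := by ring
      _ ≤ 8 ^ (4 * Q) := Nat.pow_le_pow_right (by norm_num) (by omega)
  set s := E * 8 ^ L with hs
  set J := (2 * s + 1) ^ (M * M) with hJ
  have hs1 : 2 * s + 1 ≤ 8 ^ (2 * L) := by
    have hE1 : 1 ≤ E := by
      by_contra h
      have : E = 0 := by omega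
      rw [this] at hE
      have hMr : (1:ℝ) ≤ M := by exact_mod_cast hM1
      have : 0 < C * (M:ℝ) ^ 2 := by positivity
      norm_num at hE; linarith
    have h8 : 1 ≤ 8 ^ L := Nat.one_le_pow _ _ (by norm_num)
    have : 1 ≤ s := Nat.one_le_iff_ne_zero.2 (by positivity)
    calc 2 * s + 1 ≤ 3 * E * 8 ^ L := by rw [mul_assoc]; omega
      _ ≤ 8 ^ L * 8 ^ L := Nat.mul_le_mul_right _ c2
      _ = _ := by ring
  have hJQ : J ≤ 8 ^ Q := by
    calc J ≤ (8 ^ (2 * L)) ^ (M * M) := Nat.pow_le_pow_left hs1 _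
      _ = 8 ^ Q := by rw [← pow_mul, hQ, hΛ]; congr 1; ring
  have hJ1 : 1 ≤ J := Nat.one_le_pow _ _ (by omega)
  have h8Q : 8 ^ (2 * Q) = 8 ^ Q * 8 ^ Q := by ring
  have h8Q1 : 8 ≤ 8 ^ Q := by
    calc 8 = 8 ^ 1 := by norm_num
      _ ≤ _ := Nat.pow_le_pow_right (by norm_num) hQ1
  have hJρ : J ≤ ρ := (hJQ.trans (Nat.pow_le_pow_right (by norm_num) (by omega))).trans hρ2
  set ε : ℝ := 20 * C ^ 2 * δ ^ 2 with hε
  have hε0 : 0 ≤ ε := by positivity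
  have h4 : 4 * C * ε ≤ δ := by
    calc 4 * C * ε = (80 * C ^ 3 * δ) * δ := by rw [hε]; ring
      _ ≤ (8 ^ L * δ) * δ := by gcongr
      _ = δ := by rw [hδ, h88, one_mul]
  have hδ1 : δ ≤ 1 := pow_le_one₀ (by norm_num) (by norm_num)
  let S : Set G := {h | Sm ln γ ρ ε (ε * η) h}
  have hcov := coset_cover hl J S (by
    intro g hg
    obtain ⟨i, j, hij, hjJ, h⟩ := pigeon hl (s := s) hC1 hη0 hξ0.le hδ0 hM1 (by
        rw [hξ, hδ, hη, ← pow_mul, ← pow_add]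
        apply inv_pow_le
        rw [hb]; nlinarith) (by
        rw [hs, hδ]; push_cast
        calc C * (M:ℝ) ^ 2 ≤ (E:ℝ) ^ 2 := hE
          _ = (8 ^ L * (1 / 8) ^ L) ^ 2 * (E:ℝ) ^ 2 := by rw [h88]; ring
          _ ≤ _ := le_of_eq (by ring)) hDbl (hfew _ hρ3) g
        (fun i hi => (hg i hi).trans (le_trans hi hJρ))
    refine ⟨i, j, hij, hjJ, fun f hf => (h f hf).trans (le_of_eq ?_)⟩
    rw [hε]; ring)
  set U := S ∩ {h | ln h ≤ 2 * J} with hUdef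
  have hIC : ∀ z, IC U m z → z ∈ Ker ln γ := by
    intro z hz
    have hsm := (IC_small hl hDbl hC1 hη0.le hε0 (h4.trans hδ1) (m := m) (J := J) (by
      calc 4 ^ m * (2 * J) = 2 * 4 ^ m * J := by ring
        _ ≤ 8 ^ Q * 8 ^ Q := Nat.mul_le_mul c3 hJQ
        _ ≤ ρ := by rw [← h8Q]; exact hρ2) U (fun u hu => ⟨hu.1, hu.2⟩) m le_rfl z hz).1
    apply nss hl hn2 (ρ := ρ) ?_ z
    · intro f hf x hx
      have h1 := hsm f hf
      have h2 : (f (z * x) - f x) ^ 2 ≤ Qm ln ρ (tr z f - f) := by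
        have := Finset.single_le_sum (f := fun x => (tr z f - f) x ^ 2) (fun _ _ => sq_nonneg _)
          ((mem_Bl).2 hx : x ∈ Bl ln ρ)
        exact this
      have hα : (4 * C * ε) ^ m ≤ (1 / 8) ^ (288 * d * Q + 1) := by
        calc (4 * C * ε) ^ m ≤ δ ^ m := pow_le_pow_left₀ (by positivity) h4 _
          _ = (1 / 8) ^ (L * m) := by rw [hδ, pow_mul]
          _ ≤ _ := inv_pow_le (by rw [hm, hQ]; nlinarith)
      have hβ : (24 * C) ^ m * η ≤ (1 / 8) ^ (288 * d * Q + 1) := by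
        calc (24 * C) ^ m * η ≤ 8 ^ Q * (1 / 8) ^ (Q + (288 * d * Q + 1)) := by
              apply mul_le_mul c4 _ hη0.le (by positivity)
              apply inv_pow_le
              rw [hy]; nlinarith
          _ = _ := by rw [pow_add, ← mul_assoc, h88, one_mul]
      have hq1 := Qm_le_nm (len := ln) ρ f
      have hnm := nm_nonneg f
      have hq0 := Qm_nonneg (len := ln) ρ f
      have hα0 : 0 ≤ (4 * C * ε) ^ m := by positivity
      have h3 : (f (z * x) - f x) ^ 2 ≤ (1 / 8) ^ (288 * d * Q) * nm f := by
        calc (f (z * x) - f x) ^ 2 ≤ (4 * C * ε) ^ m * nm f + (24 * C) ^ m * η * nm f := by nlinarith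
          _ ≤ (1 / 8) ^ (288 * d * Q + 1) * nm f + (1 / 8) ^ (288 * d * Q + 1) * nm f := by gcongr
          _ ≤ _ := by
            rw [pow_succ]
            have : 0 ≤ (1 / 8 : ℝ) ^ (288 * d * Q) * nm f := by positivity
            nlinarith
      have h4 : (1 / 8 : ℝ) ^ (288 * d * Q) ≤ (1 / (Fintype.card G : ℝ) ^ 2) ^ 2 := by
        rw [div_pow, div_pow, one_pow, one_pow, ← pow_mul]
        apply one_div_le_one_div_of_le (by positivity)
        calc (Fintype.card G : ℝ) ^ (2 * 2) ≤ (8 ^ (72 * d * Q)) ^ (2 * 2) := pow_le_pow_left₀ hn0.le hnR _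
          _ = _ := by rw [← pow_mul]; congr 1; ring
      refine abs_le_of_sq_le_sq ?_ (by positivity)
      rw [mul_pow, Real.sq_sqrt hnm]
      exact h3.trans (by gcongr)
    · calc Fintype.card G ≤ 8 ^ (72 * d * Q) := hn
        _ = 2 ^ (216 * d * Q) := by rw [show 8 = 2 ^ 3 by norm_num, ← pow_mul]; congr 1; ring
        _ < 2 ^ ρ := Nat.pow_lt_pow_right (by norm_num) (by omega)
  have hbig : ∃ x, ∀ y, ln y ≤ J + m * ((4 * (216 * d * Q)) ^ m * 8 ^ (7 * Q)) → y⁻¹ * x ∉ Ker ln γ := by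
    by_contra hcon
    push Not at hcon
    have hR : J + m * ((4 * (216 * d * Q)) ^ m * 8 ^ (7 * Q)) ≤ 8 ^ (8 * Q) := by
      have : 8 ^ Q ≤ 8 ^ (7 * Q) := Nat.pow_le_pow_right (by norm_num) (by omega)
      calc _ ≤ 8 ^ (7 * Q) + m * ((4 * (216 * d * Q)) ^ m * 8 ^ (7 * Q)) := by omega
        _ = (m * (4 * (216 * d * Q)) ^ m + 1) * 8 ^ (7 * Q) := by ring
        _ ≤ 8 ^ Q * 8 ^ (7 * Q) := Nat.mul_le_mul_right _ c6
        _ = _ := by rw [← pow_add]; congr 1; ring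
    have := big_quot hl hγ hf hf0 (4 * d + 1) hK (8 ^ (8 * Q)) (fun x => by
      obtain ⟨y, hy, hyk⟩ := hcon x
      exact ⟨y, hy.trans hR, hyk⟩)
    push_cast at this
    have e : 4 * ((8:ℝ) ^ (8 * Q)) ^ 2 * γ * 8 ^ (4 * d + 1) * 2 ≤ γ * 8 ^ (18 * Q) := by
      calc 4 * ((8:ℝ) ^ (8 * Q)) ^ 2 * γ * 8 ^ (4 * d + 1) * 2 = γ * 8 ^ (16 * Q + (4 * d + 2)) := by
            rw [← pow_mul]; ring
        _ ≤ _ := by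
          apply mul_le_mul_of_nonneg_left _ hγ.le
          exact pow_le_pow_right₀ (by norm_num) (by omega)
    have h5 : (1:ℝ) * 2 ≤ 4 * ((8:ℝ) ^ (8 * Q)) ^ 2 * γ * 8 ^ (4 * d + 1) * 2 := by linarith
    linarith
  obtain ⟨χ, hχ1, hχ2, hχ3⟩ := nil_char hl (Ker ln γ) U J m (8 ^ (7 * Q)) (40 * J) (216 * d * Q) (18 * d) Q
    (fun u hu => hu.2) hcov hIC (by
      calc Fintype.card G ≤ 8 ^ (72 * d * Q) := hn
        _ = 2 ^ (216 * d * Q) := by rw [show 8 = 2 ^ 3 by norm_num, ← pow_mul]; congr 1; ring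
        _ < 2 ^ (216 * d * Q + 1) := Nat.pow_lt_pow_right (by norm_num) (by omega))
    (Nat.one_le_iff_ne_zero.2 (by positivity)) (by
      calc 2 * J ≤ 8 ^ Q * 8 ^ Q := Nat.mul_le_mul (by omega) hJQ
        _ = 8 ^ (2 * Q) := h8Q.symm
        _ ≤ 8 ^ (7 * Q) := Nat.pow_le_pow_right (by norm_num) (by omega)) (by omega) hbig (by omega) (by
      calc 40 * J * 8 ^ (4 * Q) ≤ (8 ^ Q * 8 ^ Q * 8 ^ Q) * 8 ^ (4 * Q) := by
            apply Nat.mul_le_mul_right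
            calc 40 * J ≤ (8 * 8) * J := by omega
              _ ≤ (8 ^ Q * 8 ^ Q) * 8 ^ Q := Nat.mul_le_mul (Nat.mul_le_mul h8Q1 h8Q1) hJQ
        _ = _ := by ring) (by rwa [show 4 * (18 * d) * Q = 72 * d * Q by ring])
  refine ⟨Subgroup.closure U, r * J, Nat.one_le_iff_ne_zero.2 (by positivity), ?_, χ, hχ1, hχ2, ?_⟩
  · intro x
    obtain ⟨y, hy, hyx⟩ := hcov x
    exact ⟨y, (rl_le hr).1 hy, hyx⟩
  · intro g hg
    exact hχ3 g ((rl_le hr).2 (hg.trans (le_of_eq (by ring))))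
end core

end DR

namespace DR
set_option linter.unusedSectionVars false

lemma ev_pow (K : ℝ) : ∀ᶠ L : ℕ in atTop, K ≤ (8:ℝ) ^ L :=
  (tendsto_pow_atTop_atTop_of_one_lt (by norm_num : (1:ℝ) < 8)).eventually_ge_atTop K

lemma ev_poly (m c k : ℕ) : ∀ᶠ Q : ℕ in atTop, m * (4 * (c * Q)) ^ k + 1 ≤ 8 ^ Q := by
  have h := tendsto_pow_const_div_const_pow_of_one_lt k (by norm_num : (1:ℝ) < 8)
  have h1 : Tendsto (fun Q : ℕ => (m * (4 * c) ^ k + 1 : ℝ) * ((Q:ℝ) ^ k / 8 ^ Q)) atTop (nhds 0) := by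
    simpa using h.const_mul (m * (4 * c) ^ k + 1 : ℝ)
  filter_upwards [h1.eventually_lt_const (zero_lt_one), eventually_ge_atTop 1] with Q hQ hQ1
  have h8 : (0:ℝ) < 8 ^ Q := by positivity
  rw [← mul_div_assoc, div_lt_one h8] at hQ
  have hQk : (1:ℝ) ≤ (Q:ℝ) ^ k := one_le_pow₀ (by exact_mod_cast hQ1)
  have : (m * (4 * (c * Q)) ^ k + 1 : ℝ) ≤ 8 ^ Q := by
    calc (m * (4 * (c * Q)) ^ k + 1 : ℝ) = m * (4 * c) ^ k * Q ^ k + 1 := by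
          rw [← mul_assoc, mul_pow _ (Q:ℝ)]; ring
      _ ≤ (m * (4 * c) ^ k + 1) * Q ^ k := by nlinarith
      _ ≤ _ := hQ.le
  exact_mod_cast this

theorem GT (d' : ℕ) : ∃ D0 : ℕ, ∀ (G : Type*) [Group G] [Fintype G] (len : G → ℕ), WLen len → ∀ D ≥ D0,
    (∃ y, D ≤ len y) → Fintype.card G ≤ D ^ d' →
    ∃ (Γ : Subgroup G) (R : ℕ), 1 ≤ R ∧ (∀ x, ∃ y, len y ≤ R ∧ y⁻¹ * x ∈ Γ) ∧
      ∃ χ : Γ →* ℂ, (∀ g, ‖χ g‖ = 1) ∧ (∃ g, χ g ≠ 1) ∧ ∀ g : Γ, len g ≤ 40 * R → ‖χ g - 1‖ < 1 := by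
  obtain ⟨d, hd⟩ : ∃ d, d = 2 * d' + 1 := ⟨_, rfl⟩
  obtain ⟨y, hy⟩ : ∃ y, y = 288 * d + 2 := ⟨_, rfl⟩
  obtain ⟨b, hb⟩ : ∃ b, b = y + 72 * d + 2 := ⟨_, rfl⟩
  obtain ⟨a, ha⟩ : ∃ a, a = b + 152 * d + 4 := ⟨_, rfl⟩
  obtain ⟨M, hM⟩ : ∃ M, M = 2 * 8 ^ (72 * d * (a + 1)) := ⟨_, rfl⟩
  obtain ⟨C, hC⟩ : ∃ C, C = Real.exp (M * (1 + 3 * y) + 2) := ⟨_, rfl⟩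
  obtain ⟨E, hE⟩ : ∃ E : ℕ, C * M ^ 2 ≤ (E:ℝ) ^ 2 := by
    obtain ⟨E, hE⟩ := exists_nat_ge (C * M ^ 2)
    refine ⟨E, hE.trans ?_⟩
    exact_mod_cast Nat.le_self_pow (by norm_num) E
  obtain ⟨Λ, hΛ⟩ : ∃ Λ, Λ = 2 * (M * M) := ⟨_, rfl⟩
  obtain ⟨m, hm⟩ : ∃ m, m = 288 * d * Λ + 1 := ⟨_, rfl⟩
  have hM0 : M ≠ 0 := by rw [hM]; positivity
  have hΛ1 : 1 ≤ Λ := by rw [hΛ]; exact Nat.one_le_iff_ne_zero.2 (by positivity)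
  have hQt : Tendsto (fun L : ℕ => Λ * L) atTop atTop := tendsto_id.const_mul_atTop' hΛ1
  have ev : ∀ᶠ L : ℕ in atTop, 1 ≤ L ∧ 80 * C ^ 3 ≤ 8 ^ L ∧ 3 * E ≤ 8 ^ L ∧ 2 * 4 ^ m ≤ 8 ^ (Λ * L) ∧
      (24 * C) ^ m ≤ 8 ^ (Λ * L) ∧ 216 * d * (Λ * L) < 8 ^ (2 * (Λ * L)) ∧
      m * (4 * (216 * d * (Λ * L))) ^ m + 1 ≤ 8 ^ (Λ * L) ∧ 144 * d + 3 ≤ Λ * L ∧ a ≤ Λ * L := by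
    filter_upwards [eventually_ge_atTop 1, ev_pow (80 * C ^ 3), ev_pow (3 * E : ℕ), hQt.eventually (ev_pow (2 * 4 ^ m : ℕ)),
      hQt.eventually (ev_pow ((24 * C) ^ m)), hQt.eventually (ev_poly 1 (216 * d) 1),
      hQt.eventually (ev_poly m (216 * d) m), hQt.eventually (eventually_ge_atTop (144 * d + 3)),
      hQt.eventually (eventually_ge_atTop a)] with L h1 h2 h3 h4 h5 h6 h7 h8 h9
    refine ⟨h1, h2, by exact_mod_cast h3, by exact_mod_cast h4, h5, ?_, h7, h8, h9⟩
    have : 8 ^ (Λ * L) ≤ 8 ^ (2 * (Λ * L)) := Nat.pow_le_pow_right (by norm_num) (by omega)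
    simp only [pow_one, one_mul] at h6
    omega
  obtain ⟨L0, hL0⟩ := eventually_atTop.1 ev
  refine ⟨(8 ^ (72 * Λ)) ^ (L0 + 1), ?_⟩
  intro G _ _ len hl D hD hyl hn
  have hB : 1 < 8 ^ (72 * Λ) := Nat.one_lt_pow (by omega) (by norm_num)
  have hD0 : D ≠ 0 := by
    have : 0 < (8 ^ (72 * Λ)) ^ (L0 + 1) := by positivity
    omega
  set L := Nat.log (8 ^ (72 * Λ)) D with hLdef
  have hLL0 : L0 ≤ L := by
    have := (Nat.le_log_iff_pow_le hB hD0).2 hD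
    omega
  have hlow : (8 ^ (72 * Λ)) ^ L ≤ D := Nat.pow_log_le_self _ hD0
  have hup : D < (8 ^ (72 * Λ)) ^ (L + 1) := Nat.lt_pow_succ_log_self hB D
  obtain ⟨h1, h2, h3, h4, h5, h6, h7, h8, h9⟩ := hL0 L hLL0
  refine core hl d (Λ * L) L Λ a b y M m E C (by omega) h1 hy hb ha hM hC hE hΛ hm rfl h2 h3 h4 h5 h6 h7 h8 h9 ?_ ?_
  · obtain ⟨z, hz⟩ := hyl
    refine ⟨z, le_trans (le_trans (le_of_eq ?_) hlow) hz⟩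
    rw [← pow_mul, mul_assoc]
  · refine hn.trans ?_
    calc D ^ d' ≤ ((8 ^ (72 * Λ)) ^ (L + 1)) ^ d' := Nat.pow_le_pow_left hup.le _
      _ = 8 ^ (72 * Λ * (L + 1) * d') := by rw [← pow_mul, ← pow_mul, mul_assoc (72 * Λ)]
      _ ≤ _ := Nat.pow_le_pow_right (by norm_num) (by
          rw [hd]
          calc 72 * Λ * (L + 1) * d' ≤ 72 * Λ * (2 * L) * d' := by gcongr; omega
            _ ≤ 72 * (2 * d' + 1) * (Λ * L) := by nlinarith [Nat.zero_le (Λ * L)])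

end DR

namespace DR
set_option linter.unusedSectionVars false

section topo
variable {X Xt : Type*} [MetricSpace X] [MetricSpace Xt]

lemma ls_curve (h : IsLengthSpace X) {x y : X} {r : ENNReal} (hlt : edist x y < r) :
    ∃ γ : ℝ → X, ContinuousOn γ (Icc 0 1) ∧ γ 0 = x ∧ γ 1 = y ∧ eVariationOn γ (Icc 0 1) < r := by
  rw [h x y] at hlt
  simp only [iInf_lt_iff] at hlt
  obtain ⟨γ, ⟨h1, h2, h3⟩, h4⟩ := hlt
  exact ⟨γ, h1, h2, h3, h4⟩

lemma zero_mem01 : (0 : ℝ) ∈ Icc (0 : ℝ) 1 := ⟨le_refl _, zero_le_one⟩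
lemma one_mem01 : (1 : ℝ) ∈ Icc (0 : ℝ) 1 := ⟨zero_le_one, le_refl _⟩

lemma curve_le {x y : X} (γ : ℝ → X) (h0 : γ 0 = x) (h1 : γ 1 = y) :
    edist x y ≤ eVariationOn γ (Icc 0 1) := by
  rw [← h0, ← h1]
  exact eVariationOn.edist_le γ zero_mem01 one_mem01

lemma ls_lpc (h : IsLengthSpace Xt) : LocallyPathConnectedSpace Xt := by
  refine LocallyPathConnectedSpace.of_bases (fun x => Metric.nhds_basis_ball (x := x)) ?_
  intro x r hr
  refine ⟨x, Metric.mem_ball_self hr, ?_⟩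
  intro y hy
  have hy' : edist x y < ENNReal.ofReal r := by
    rw [edist_dist]
    refine (ENNReal.ofReal_lt_ofReal_iff hr).2 ?_
    rw [dist_comm]; exact hy
  obtain ⟨γ, hc, h0, h1, hv⟩ := ls_curve h hy'
  refine JoinedIn.ofLine hc h0 h1 ?_
  rintro _ ⟨t, ht, rfl⟩
  have := lt_of_le_of_lt (eVariationOn.edist_le γ ht zero_mem01) hv
  rw [h0, edist_dist, ENNReal.ofReal_lt_ofReal_iff hr] at this
  exact this

/-- Deck transformation group. -/
def deck (ρ : Xt → X) : Subgroup (Equiv.Perm Xt) where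
  carrier := {σ | Continuous σ ∧ Continuous σ.symm ∧ ∀ x, ρ (σ x) = ρ x}
  one_mem' := ⟨continuous_id, continuous_id, fun _ => rfl⟩
  mul_mem' := by
    rintro a b ⟨a1, a2, a3⟩ ⟨b1, b2, b3⟩
    refine ⟨a1.comp b1, b2.comp a2, fun x => ?_⟩
    rw [Equiv.Perm.mul_apply, a3, b3]
  inv_mem' := by
    rintro a ⟨a1, a2, a3⟩
    refine ⟨a2, a1, fun x => ?_⟩
    have := a3 (a.symm x)
    rw [Equiv.apply_symm_apply] at this
    exact this.symm

lemma deck_free [ConnectedSpace Xt] {ρ : Xt → X} (hρ : IsCoveringMap ρ) {g h : Equiv.Perm Xt}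
    (hg : g ∈ deck ρ) (hh : h ∈ deck ρ) {x : Xt} (he : g x = h x) : g = h := by
  have := hρ.eq_of_comp_eq hg.1 hh.1 (by funext y; simp [hg.2.2, hh.2.2]) x he
  exact Equiv.ext (congrFun this)

lemma deck_trans [SimplyConnectedSpace Xt] {ρ : Xt → X} (hρ : IsCoveringMap ρ)
    (h : IsLengthSpace Xt) {x y : Xt} (hxy : ρ x = ρ y) : ∃ g ∈ deck ρ, g x = y := by
  have := ls_lpc h
  obtain ⟨F, ⟨F0, F1⟩, -⟩ := hρ.existsUnique_continuousMap_lifts ⟨ρ, hρ.continuous⟩ x y hxy.symm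
  obtain ⟨F', ⟨F0', F1'⟩, -⟩ := hρ.existsUnique_continuousMap_lifts ⟨ρ, hρ.continuous⟩ y x hxy
  have F1a : ∀ z, ρ (F z) = ρ z := fun z => congrFun F1 z
  have F1b : ∀ z, ρ (F' z) = ρ z := fun z => congrFun F1' z
  have e1 : (F' ∘ F : Xt → Xt) = id := by
    refine hρ.eq_of_comp_eq (F'.continuous.comp F.continuous) continuous_id ?_ x ?_
    · funext z; simp [F1a, F1b]
    · simp [F0, F0']
  have e2 : (F ∘ F' : Xt → Xt) = id := by
    refine hρ.eq_of_comp_eq (F.continuous.comp F'.continuous) continuous_id ?_ y ?_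
    · funext z; simp [F1a, F1b]
    · simp [F0, F0']
  exact ⟨⟨F, F', congrFun e1, congrFun e2⟩, ⟨F.continuous, F'.continuous, F1a⟩, F0⟩

lemma deck_le {ρ : Xt → X} (h : IsLengthSpace Xt) (hl : IsLiftedMetric ρ) {g : Equiv.Perm Xt}
    (hg : g ∈ deck ρ) (x y : Xt) : edist (g x) (g y) ≤ edist x y := by
  refine le_of_forall_gt fun r hr => ?_
  obtain ⟨γ, hc, h0, h1, hv⟩ := ls_curve h hr
  refine lt_of_le_of_lt (curve_le (g ∘ γ) (by simp [h0]) (by simp [h1])) ?_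
  rw [← hl (g ∘ γ) (hg.1.comp_continuousOn hc)]
  rw [← hl γ hc] at hv
  convert hv using 2
  funext t; simp [hg.2.2]

lemma deck_dist {ρ : Xt → X} (h : IsLengthSpace Xt) (hl : IsLiftedMetric ρ) {g : Equiv.Perm Xt}
    (hg : g ∈ deck ρ) (x y : Xt) : edist (g x) (g y) = edist x y := by
  refine le_antisymm (deck_le h hl hg x y) ?_
  have := deck_le h hl (inv_mem hg) (g x) (g y)
  simpa using this

lemma deck_dense [CompactSpace X] [SimplyConnectedSpace Xt] {ρ : Xt → X} (hρ : IsCoveringMap ρ)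
    (hX : IsLengthSpace X) (h : IsLengthSpace Xt) (hl : IsLiftedMetric ρ)
    (hΔ : 0 < Metric.diam (univ : Set X)) (x0 z : Xt) :
    ∃ g ∈ deck ρ, dist z (g x0) < 2 * Metric.diam (univ : Set X) := by
  set Δ := Metric.diam (univ : Set X)
  have hd : dist (ρ z) (ρ x0) ≤ Δ :=
    Metric.dist_le_diam_of_mem isCompact_univ.isBounded (mem_univ _) (mem_univ _)
  have hd' : edist (ρ z) (ρ x0) < ENNReal.ofReal (2 * Δ) := by
    rw [edist_dist]
    exact (ENNReal.ofReal_lt_ofReal_iff (by linarith)).2 (by linarith)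
  obtain ⟨γ, hc, h0, h1, hv⟩ := ls_curve hX hd'
  let γ' : C(unitInterval, X) := ⟨fun t => γ t, continuousOn_iff_continuous_domRestrict.1 hc⟩
  have g0 : γ' 0 = ρ z := h0
  let Γ := hρ.liftPath γ' z g0
  have hΓ : ∀ t, ρ (Γ t) = γ t := fun t => congrFun (hρ.liftPath_lifts γ' z g0) t
  have hΓ0 : Γ 0 = z := hρ.liftPath_zero γ' z g0
  let Γ' : ℝ → Xt := fun t => Γ (projIcc 0 1 zero_le_one t)
  have hΓc : Continuous Γ' := Γ.continuous.comp continuous_projIcc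
  have hΓ1 : ρ (Γ 1) = ρ x0 := by rw [hΓ]; exact h1
  obtain ⟨g, hg, hgx⟩ := deck_trans hρ h hΓ1.symm
  refine ⟨g, hg, ?_⟩
  have e1 : eVariationOn Γ' (Icc 0 1) = eVariationOn γ (Icc 0 1) := by
    rw [← hl Γ' hΓc.continuousOn]
    refine eVariationOn.eq_of_eqOn fun t ht => ?_
    show ρ (Γ _) = _
    rw [hΓ, projIcc_of_mem _ ht]
  have e2 : edist z (g x0) ≤ eVariationOn Γ' (Icc 0 1) := by
    refine curve_le Γ' ?_ ?_
    · show Γ _ = z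
      rw [projIcc_left]; exact hΓ0
    · show Γ _ = _
      rw [projIcc_right, hgx]; rfl
  have := lt_of_le_of_lt e2 (e1 ▸ hv)
  rw [edist_dist] at this
  exact (ENNReal.ofReal_lt_ofReal_iff (by linarith)).1 this

/-- Splitting a near geodesic. -/
lemma ls_split (h : IsLengthSpace Xt) {x y : Xt} {a b : ℝ} (ha : 0 ≤ a) (hab : a ≤ dist x y)
    (hb : dist x y < b) : ∃ z, dist x z = a ∧ dist z y < b - a := by
  have hb0 : 0 < b := lt_of_le_of_lt dist_nonneg hb
  have hd' : edist x y < ENNReal.ofReal b := by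
    rw [edist_dist]
    exact (ENNReal.ofReal_lt_ofReal_iff hb0).2 hb
  obtain ⟨γ, hc, h0, h1, hv⟩ := ls_curve h hd'
  have hcont : ContinuousOn (fun t => dist x (γ t)) (Icc 0 1) := 
    (continuous_const.dist continuous_id).comp_continuousOn hc
  have := intermediate_value_Icc zero_le_one hcont
  obtain ⟨t, ht, hta⟩ := this (show a ∈ Icc (dist x (γ 0)) (dist x (γ 1)) by
    rw [h0, h1, dist_self]; exact ⟨ha, hab⟩)
  refine ⟨γ t, hta, ?_⟩
  have h2 := eVariationOn.Icc_add_Icc γ (s := Icc (0:ℝ) 1) ht.1 ht.2 ht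
  have h3 : Icc (0:ℝ) 1 ∩ Icc 0 t = Icc 0 t := inter_eq_right.2 (Icc_subset_Icc_right ht.2)
  have h4 : Icc (0:ℝ) 1 ∩ Icc t 1 = Icc t 1 := inter_eq_right.2 (Icc_subset_Icc_left ht.1)
  rw [h3, h4, inter_self] at h2
  have h5 := eVariationOn.edist_le γ (s := Icc 0 t) ⟨le_refl _, ht.1⟩ ⟨ht.1, le_refl _⟩
  have h6 := eVariationOn.edist_le γ (s := Icc t 1) ⟨le_refl _, ht.2⟩ ⟨ht.2, le_refl _⟩
  have h7 := lt_of_le_of_lt ((add_le_add h5 h6).trans h2.le) hv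
  rw [h0, h1, edist_dist, edist_dist, ← ENNReal.ofReal_add dist_nonneg dist_nonneg,
    ENNReal.ofReal_lt_ofReal_iff hb0] at h7
  have : dist x (γ t) = a := hta
  linarith

end topo
end DR

namespace DR
set_option linter.unusedSectionVars false

section topo2
variable {Xt : Type*} [MetricSpace Xt] {G : Type*} [Group G] [MulAction G Xt]

open scoped Pointwise in
lemma chain (h : IsLengthSpace Xt) (hiso : ∀ (g : G) (x y : Xt), dist (g • x) (g • y) = dist x y)
    {Δ : ℝ} (hΔ : 0 < Δ) (x0 : Xt) (hdense : ∀ z, ∃ g : G, dist z (g • x0) < 2 * Δ)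
    (S : Set G) (hS : ∀ g : G, g ∈ S ↔ dist x0 (g • x0) ≤ 6 * Δ) (k : ℕ) :
    ∀ (y : Xt) (g : G), dist x0 y < (k + 1) * Δ → dist y (g • x0) < 2 * Δ → g ∈ S ^ (k + 1) := by
  induction k with
  | zero =>
    intro y g h1 h2
    rw [zero_add, pow_one, hS]
    have := dist_triangle x0 y (g • x0)
    push_cast at h1
    linarith
  | succ k ih =>
    intro y g h1 h2
    obtain ⟨z, hz1, hz2⟩ : ∃ z, dist x0 z < (k + 1) * Δ ∧ dist z y < 2 * Δ := by
      by_cases hc : dist x0 y < (k + 1) * Δ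
      · exact ⟨y, hc, by rw [dist_self]; linarith⟩
      · push Not at hc
        push_cast at h1
        obtain ⟨z, hz1, hz2⟩ := ls_split h (a := k * Δ) (b := (k + 1 + 1) * Δ) (x := x0) (y := y)
          (by positivity) (by nlinarith) h1
        exact ⟨z, by rw [hz1]; nlinarith, by linarith⟩
    obtain ⟨u, hu⟩ := hdense z
    have hu' := ih z u hz1 hu
    have : u⁻¹ * g ∈ S := by
      rw [hS]
      have e : dist x0 ((u⁻¹ * g) • x0) = dist (u • x0) (g • x0) := by
        rw [← hiso u x0, smul_smul, mul_inv_cancel_left]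
      rw [e]
      have a1 := dist_triangle (u • x0) z (g • x0)
      have a2 := dist_triangle z y (g • x0)
      rw [dist_comm (u • x0) z] at a1
      linarith
    rw [pow_succ]
    exact ⟨u, hu', u⁻¹ * g, this, by simp⟩

open scoped Pointwise in
/-- Word length attached to the orbit of the basepoint. -/
lemma orbit_len (h : IsLengthSpace Xt)
    (hiso : ∀ (g : G) (x y : Xt), dist (g • x) (g • y) = dist x y)
    {Δ : ℝ} (hΔ : 0 < Δ) (x0 : Xt) (hdense : ∀ z, ∃ g : G, dist z (g • x0) < 2 * Δ) :
    ∃ len : G → ℕ, WLen len ∧ (∀ g, dist x0 (g • x0) ≤ 6 * Δ * len g) ∧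
      ∀ (g : G) (k : ℕ), 1 ≤ k → dist x0 (g • x0) < k * Δ → len g ≤ k := by
  set S : Set G := {g | dist x0 (g • x0) ≤ 6 * Δ} with hSdef
  have hS : ∀ g : G, g ∈ S ↔ dist x0 (g • x0) ≤ 6 * Δ := fun g => Iff.rfl
  have hch := chain h hiso hΔ x0 hdense S hS
  have hch' : ∀ (g : G) (k : ℕ), 1 ≤ k → dist x0 (g • x0) < k * Δ → g ∈ S ^ k := by
    intro g k hk hd
    obtain ⟨k, rfl⟩ : ∃ j, k = j + 1 := ⟨k - 1, by omega⟩
    push_cast at hd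
    exact hch k (g • x0) g hd (by rw [dist_self]; linarith)
  have h1 : (1 : G) ∈ S := by rw [hS]; simp; positivity
  have hinv : ∀ x ∈ S, x⁻¹ ∈ S := by
    intro x hx
    rw [hS] at hx ⊢
    rw [← hiso x, smul_inv_smul, dist_comm]
    exact hx
  have hgen : Subgroup.closure S = ⊤ := by
    rw [eq_top_iff]
    intro g _
    obtain ⟨k, hk⟩ := exists_nat_gt (dist x0 (g • x0) / Δ)
    have : g ∈ S ^ (k + 1) := by
      refine hch' g (k + 1) (by omega) ?_
      rw [div_lt_iff₀ hΔ] at hk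
      push_cast
      linarith
    have key : ∀ m : ℕ, S ^ m ⊆ (Subgroup.closure S : Set G) := by
      intro m
      induction m with
      | zero => intro x hx; rw [pow_zero] at hx; rw [show x = 1 from hx]; exact one_mem _
      | succ m ih =>
        rw [pow_succ]
        rintro _ ⟨a, ha, b, hb, rfl⟩
        exact mul_mem (ih ha) (Subgroup.subset_closure hb)
    exact key _ this
  obtain ⟨len, hw, hl1, hlt⟩ := exists_wlen S h1 hinv hgen
  refine ⟨len, hw, ?_, fun g k hk hd => (hlt g k).2 (hch' g k hk hd)⟩
  have key : ∀ (m : ℕ) (g : G), g ∈ S ^ m → dist x0 (g • x0) ≤ 6 * Δ * m := by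
    intro m
    induction m with
    | zero => intro x hx; rw [pow_zero] at hx; rw [show x = 1 from hx]; simp
    | succ m ih =>
      rw [pow_succ]
      rintro _ ⟨a, ha, b, hb, rfl⟩
      have a1 := ih a ha
      have a2 : dist x0 (b • x0) ≤ 6 * Δ := hb
      have a3 := dist_triangle x0 (a • x0) ((a * b) • x0)
      have a4 : dist (a • x0) ((a * b) • x0) = dist x0 (b • x0) := by
        rw [mul_smul, hiso]
      show dist x0 ((a * b) • x0) ≤ _
      push_cast
      linarith
  exact fun g => key _ g ((hlt g _).1 le_rfl)

/-- No small nontrivial characters on a group acting on a simply connected space. -/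
lemma sc_char [SimplyConnectedSpace Xt] [LocallyPathConnectedSpace Xt] [Fintype G]
    (hiso : ∀ (g : G) (x y : Xt), dist (g • x) (g • y) = dist x y) (x0 : Xt) {a : ℝ}
    (hdense : ∀ z, ∃ g : G, dist z (g • x0) < a)
    (χ : G →* ℂ) (hχ : ∀ g, ‖χ g‖ = 1)
    (hsmall : ∀ g : G, dist x0 (g • x0) < 2 * a → ‖χ g - 1‖ < 1) (k : G) : χ k = 1 := by
  let w : G → Xt → ℝ := fun g z => max 0 (a - dist z (g • x0))
  let Φ : Xt → ℂ := fun z => ∑ g, (w g z : ℂ) * χ g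
  have hΦc : Continuous Φ := by
    refine continuous_finsetSum _ fun g _ => ?_
    refine Continuous.mul (Complex.continuous_ofReal.comp ?_) continuous_const
    exact continuous_const.max (continuous_const.sub (continuous_id.dist continuous_const))
  have hΦe : ∀ h z, Φ (h • z) = χ h * Φ z := by
    intro h z
    show ∑ g, (w g (h • z) : ℂ) * χ g = χ h * ∑ g, (w g z : ℂ) * χ g
    rw [← Equiv.sum_comp (Equiv.mulLeft h), Finset.mul_sum]
    refine Finset.sum_congr rfl fun g _ => ?_
    have : w (h * g) (h • z) = w g z := by
      show max 0 _ = max 0 _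
      rw [mul_smul, hiso]
    simp only [Equiv.coe_mulLeft, this, map_mul]
    ring
  have hΦ0 : ∀ z, Φ z ≠ 0 := by
    intro z hz
    obtain ⟨g0, hg0⟩ := hdense z
    have e1 : Φ z * χ g0⁻¹ = ∑ g, (w g z : ℂ) * χ (g0⁻¹ * g) := by
      show (∑ g, (w g z : ℂ) * χ g) * χ g0⁻¹ = _
      rw [Finset.sum_mul]
      refine Finset.sum_congr rfl fun g _ => ?_
      rw [map_mul]; ring
    have e2 : 0 < (∑ g, (w g z : ℂ) * χ (g0⁻¹ * g)).re := by
      rw [Complex.re_sum]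
      have hre : ∀ g, 0 < w g z → 0 < (χ (g0⁻¹ * g)).re := by
        intro g hg
        have hg' : 0 < a - dist z (g • x0) := by
          by_contra hcon
          push Not at hcon
          have : w g z = 0 := max_eq_left hcon
          linarith
        have h1 : dist x0 ((g0⁻¹ * g) • x0) < 2 * a := by
          rw [← hiso g0, smul_smul, mul_inv_cancel_left]
          have := dist_triangle (g0 • x0) z (g • x0)
          rw [dist_comm (g0 • x0) z] at this
          linarith
        have h2 := hsmall _ h1
        have h3 := (Complex.abs_re_le_norm (χ (g0⁻¹ * g) - 1)).trans_lt h2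
        rw [Complex.sub_re, Complex.one_re, abs_lt] at h3
        linarith [h3.1]
      refine Finset.sum_pos' (fun g _ => ?_) ⟨g0, Finset.mem_univ _, ?_⟩
      · rw [Complex.re_ofReal_mul]
        have hw0 : 0 ≤ w g z := le_max_left 0 _
        rcases hw0.eq_or_lt with h | h
        · rw [← h]; simp
        · exact (mul_pos h (hre g h)).le
      · rw [Complex.re_ofReal_mul]
        have h : 0 < w g0 z := lt_max_of_lt_right (by linarith)
        exact mul_pos h (hre g0 h)
    rw [← e1, hz] at e2
    simp at e2
  obtain ⟨L, ⟨-, hL⟩, -⟩ := Complex.isCoveringMap_exp.existsUnique_continuousMap_lifts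
    (⟨fun z => ⟨Φ z, hΦ0 z⟩, hΦc.subtype_mk _⟩ : C(Xt, {z : ℂ // z ≠ 0})) x0
    (Complex.log (Φ x0)) (Subtype.ext (Complex.exp_log (hΦ0 x0)))
  have hL' : ∀ z, Complex.exp (L z) = Φ z := fun z => congrArg Subtype.val (congrFun hL z)
  have hkc : Continuous (fun z : Xt => k • z) :=
    (Isometry.of_dist_eq (hiso k)).continuous
  have hc : ∀ z, L (k • z) = L z + (L (k • x0) - L x0) := by
    have := Complex.isCoveringMap_exp.eq_of_comp_eq (g₁ := fun z => L (k • z))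
      (g₂ := fun z => L z + (L (k • x0) - L x0)) (L.continuous.comp hkc)
      (L.continuous.add continuous_const) ?_ x0 (by ring)
    · exact congrFun this
    · funext z
      refine Subtype.ext ?_
      show Complex.exp (L (k • z)) = Complex.exp (L z + (L (k • x0) - L x0))
      rw [Complex.exp_add, Complex.exp_sub, hL', hL', hL', hL', hΦe, hΦe]
      field_simp [hΦ0 x0]
  set c := L (k • x0) - L x0
  have hm : ∀ m : ℕ, L (k ^ m • x0) = L x0 + m * c := by
    intro m
    induction m with
    | zero => simp
    | succ m ih =>
      rw [pow_succ', mul_smul, hc, ih]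
      push_cast; ring
  have h1 := hm (Fintype.card G)
  rw [pow_card_eq_one, one_smul] at h1
  have h2 : (Fintype.card G : ℂ) * c = 0 := by linear_combination -h1
  have h3 : c = 0 := by
    rcases mul_eq_zero.1 h2 with h | h
    · exact absurd (Nat.cast_eq_zero.1 h) Fintype.card_ne_zero
    · exact h
  have h4 := hc x0
  rw [h3, add_zero] at h4
  have h5 := hΦe k x0
  rw [← hL', h4, hL'] at h5
  exact (mul_right_cancel₀ (hΦ0 x0) (by rw [one_mul]; exact h5)).symm

end topo2
end DR

namespace DR
set_option linter.unusedSectionVars false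

lemma orbit_main {Xt : Type*} [MetricSpace Xt] {G : Type*} [Group G] [MulAction G Xt] [Fintype G]
    [SimplyConnectedSpace Xt] (h : IsLengthSpace Xt)
    (hiso : ∀ (g : G) (x y : Xt), dist (g • x) (g • y) = dist x y)
    {Δ : ℝ} (hΔ : 0 < Δ) (x0 : Xt) (hdense : ∀ z, ∃ g : G, dist z (g • x0) < 2 * Δ)
    (D : ℕ) (hGT : ∀ len : G → ℕ, WLen len → (∃ y, D ≤ len y) →
      ∃ (Γ : Subgroup G) (R : ℕ), 1 ≤ R ∧ (∀ x, ∃ y, len y ≤ R ∧ y⁻¹ * x ∈ Γ) ∧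
        ∃ χ : Γ →* ℂ, (∀ g, ‖χ g‖ = 1) ∧ (∃ g, χ g ≠ 1) ∧
          ∀ g : Γ, len g ≤ 40 * R → ‖χ g - 1‖ < 1) :
    Metric.diam (univ : Set Xt) ≤ (4 + 6 * D) * Δ := by
  obtain ⟨len, hw, hlen1, hlen2⟩ := orbit_len h hiso hΔ x0 hdense
  have hsm : ∀ y, len y < D := by
    by_contra hcon
    push Not at hcon
    obtain ⟨Γ, R, hR, hcov, χ, hχ1, ⟨g, hg⟩, hχ⟩ := hGT len hw hcon
    have := ls_lpc h
    have : Fintype Γ := Fintype.ofFinite Γ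
    have hR' : (1 : ℝ) ≤ R := by exact_mod_cast hR
    refine hg (sc_char (G := Γ) (fun g x y => hiso (g : G) x y) x0 (a := (2 + 6 * R) * Δ) ?_ χ hχ1
      ?_ g)
    · intro z
      obtain ⟨u, hu⟩ := hdense z
      obtain ⟨y, hy1, hy2⟩ := hcov u⁻¹
      have hy3 : u * y ∈ Γ := by
        have := Γ.inv_mem hy2
        simpa using this
      refine ⟨⟨u * y, hy3⟩, ?_⟩
      show dist z ((u * y) • x0) < _
      have a1 := dist_triangle z (u • x0) ((u * y) • x0)
      have a2 : dist (u • x0) ((u * y) • x0) = dist x0 (y • x0) := by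
        rw [mul_smul, hiso]
      have a3 := hlen1 y
      have a4 : (len y : ℝ) ≤ R := by exact_mod_cast hy1
      nlinarith
    · intro v hv
      refine hχ v ?_
      have : len (v : G) ≤ 16 * R := by
        refine hlen2 v (16 * R) (by omega) ?_
        have hv' : dist x0 ((v : G) • x0) < 2 * ((2 + 6 * R) * Δ) := hv
        push_cast
        nlinarith
      omega
  refine Metric.diam_le_of_forall_dist_le (by positivity) fun z _ w _ => ?_
  obtain ⟨g, hg⟩ := hdense z
  obtain ⟨k, hk⟩ := hdense w
  have a1 := dist_triangle z (g • x0) w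
  have a2 := dist_triangle (g • x0) (k • x0) w
  have a3 := hlen1 (g⁻¹ * k)
  rw [← hiso g, smul_smul, mul_inv_cancel_left] at a3
  have a4 : (len (g⁻¹ * k) : ℝ) ≤ D := by exact_mod_cast (hsm _).le
  rw [dist_comm w] at hk
  nlinarith

end DR

/-- For a sequence of compact length spaces `Xᵢ` with `|π₁(Xᵢ)| = nᵢ → ∞` and
universal covers `X̃ᵢ` with the lifted metric, the ratio `diam X̃ᵢ / diam Xᵢ` is
`o(nᵢᵖ)` for every `p > 0`. -/
theorem diam_ratio_littleO {X Xt : ℕ → Type*}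
    [∀ i, MetricSpace (X i)] [∀ i, MetricSpace (Xt i)]
    [∀ i, CompactSpace (X i)] [∀ i, SimplyConnectedSpace (Xt i)]
    (hX : ∀ i, IsLengthSpace (X i)) (hXt : ∀ i, IsLengthSpace (Xt i))
    (ρ : ∀ i, Xt i → X i) (hρ : ∀ i, IsCoveringMap (ρ i))
    (hlift : ∀ i, IsLiftedMetric (ρ i))
    (n : ℕ → ℕ) (hn : ∀ i, ∀ x : X i, Nat.card (ρ i ⁻¹' {x}) = n i)
    (htop : Tendsto n atTop atTop) :
    ∀ p : ℝ, 0 < p →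
      (fun i => Metric.diam (univ : Set (Xt i)) / Metric.diam (univ : Set (X i)))
        =o[atTop] fun i => (n i : ℝ) ^ p := by
  intro p hp
  obtain ⟨D0, hD0⟩ := DR.GT ⌈2 / p⌉₊
  have hx : Tendsto (fun i => (n i : ℝ) ^ (p / 2)) atTop atTop :=
    (tendsto_rpow_atTop (by positivity)).comp (tendsto_natCast_atTop_atTop.comp htop)
  rw [Asymptotics.isLittleO_iff]
  intro c hc
  filter_upwards [hx.eventually_ge_atTop 1, hx.eventually_ge_atTop (16 / c),
    hx.eventually_ge_atTop (D0 : ℝ), htop.eventually_ge_atTop 1] with i h1 h2 h3 h4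
  set x : ℝ := (n i : ℝ) ^ (p / 2) with hxdef
  have hn0 : (0 : ℝ) ≤ n i := Nat.cast_nonneg _
  have hxx : (n i : ℝ) ^ p = x * x := by
    rw [hxdef, ← Real.rpow_add_of_nonneg hn0 (by positivity) (by positivity)]
    congr 1; ring
  rw [hxx, Real.norm_of_nonneg (div_nonneg Metric.diam_nonneg Metric.diam_nonneg),
    Real.norm_of_nonneg (mul_self_nonneg x)]
  rcases (Metric.diam_nonneg (s := (univ : Set (X i)))).eq_or_lt with hΔ | hΔ
  · rw [← hΔ, div_zero]; positivity
  set D := ⌈x⌉₊ with hD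
  have hxD : x ≤ D := Nat.le_ceil x
  have hD1 : (D : ℝ) < x + 1 := Nat.ceil_lt_add_one (by linarith)
  have hcard : n i ≤ D ^ ⌈2 / p⌉₊ := by
    have e1 : (n i : ℝ) = x ^ (2 / p) := by
      rw [hxdef, ← Real.rpow_mul hn0]
      rw [show p / 2 * (2 / p) = 1 by field_simp, Real.rpow_one]
    have e2 : (n i : ℝ) ≤ (D : ℝ) ^ ⌈2 / p⌉₊ := by
      rw [e1, ← Real.rpow_natCast]
      calc x ^ (2 / p) ≤ (D : ℝ) ^ (2 / p) := by gcongr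
        _ ≤ (D : ℝ) ^ ((⌈2 / p⌉₊ : ℕ) : ℝ) :=
          Real.rpow_le_rpow_of_exponent_le (by linarith) (Nat.le_ceil _)
    exact_mod_cast e2
  have hDD : D0 ≤ D := by
    have : (D0 : ℝ) ≤ D := h3.trans hxD
    exact_mod_cast this
  obtain ⟨x0⟩ : Nonempty (Xt i) := inferInstance
  have hfib := hn i (ρ i x0)
  have hfin : Finite (ρ i ⁻¹' {ρ i x0}) := Nat.finite_of_card_ne_zero (by omega)
  let φ : DR.deck (ρ i) → (ρ i ⁻¹' {ρ i x0}) := fun g => ⟨(g : Equiv.Perm (Xt i)) x0, g.2.2.2 x0⟩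
  have hφ : Function.Injective φ := by
    intro g k hgk
    exact Subtype.ext (DR.deck_free (hρ i) g.2 k.2 (congrArg Subtype.val hgk))
  have hfinG : Finite (DR.deck (ρ i)) := Finite.of_injective φ hφ
  have : Fintype (DR.deck (ρ i)) := Fintype.ofFinite _
  have hG : Fintype.card (DR.deck (ρ i)) ≤ n i := by
    rw [← Nat.card_eq_fintype_card, ← hfib]
    exact Nat.card_le_card_of_injective φ hφ
  have hmain := DR.orbit_main (G := DR.deck (ρ i)) (hXt i) (fun g a b => by
    have := DR.deck_dist (hXt i) (hlift i) g.2 a b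
    rw [edist_dist, edist_dist] at this
    exact (ENNReal.ofReal_eq_ofReal_iff dist_nonneg dist_nonneg).1 this) hΔ x0 (fun z => by
    obtain ⟨g, hg, hd⟩ := DR.deck_dense (hρ i) (hX i) (hXt i) (hlift i) hΔ x0 z
    exact ⟨⟨g, hg⟩, hd⟩) D
    (fun len hw hy => hD0 _ len hw D hDD hy (hG.trans hcard))
  rw [div_le_iff₀ hΔ]
  refine hmain.trans ?_
  refine mul_le_mul_of_nonneg_right ?_ hΔ.le
  rw [div_le_iff₀ hc] at h2
  nlinarith
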